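/- arXiv:1402.2878 — 2 statements merged into one kernel-verified Lean document; each statement's English description precedes it below -/
import Mathlib

section
/- The number of edge-magic total labelings of the path P_10 (the path with 11 vertices and 10 edges), counted up to the reversal symmetry of the path, is 751008. -/
/-- The path `P n` has vertices `0,…,n` and edges `{j,j+1}` for `0 ≤ j < n`, a total of
`2n+1` graph elements, encoded as `Fin (2n+1)` with vertex `j` at index `2j` and edge
`{j,j+1}` at index `2j+1`.  An edge-magic total labeling is a bijection from these
elements to `{1,…,2n+1}` (encoded as a permutation `σ` of `Fin (2n+1)`, the label of
element `x` being `(σ x).val + 1`) such that every edge weight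
`λ(u) + λ({u,v}) + λ(v)` equals a common constant `k`.  This counts such labelings up
to the reversal symmetry of the path, i.e. those with `λ(vertex 0) < λ(vertex n)`. -/
noncomputable def pathEMTLCountUpToRev (n : ℕ) : ℕ := by
  classical
  exact (Finset.univ.filter (fun σ : Equiv.Perm (Fin (2 * n + 1)) =>
    (∃ k : ℕ, ∀ i : Fin n,
      ((σ ⟨2 * i.1, by have := i.isLt; omega⟩).val + 1) +
      ((σ ⟨2 * i.1 + 1, by have := i.isLt; omega⟩).val + 1) +
      ((σ ⟨2 * i.1 + 2, by have := i.isLt; omega⟩).val + 1) = k) ∧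
    (σ ⟨0, by omega⟩).val < (σ ⟨2 * n, by omega⟩).val)).card

namespace EMTL

/-- number of bits from slot `0` to slot `2^t` (eight bits per slot) -/
def sh (t : ℕ) : ℕ := Nat.mul 8 (Nat.pow 2 t)

def nextRow (s : ℕ) : ℕ → List ℕ → List ℕ
  | _, [] => []
  | p, x :: xs => Nat.add x (Nat.shiftLeft p s) :: nextRow s x xs

def rows : ℕ → List ℕ
  | 0 => [255, 0, 0, 0, 0, 0, 0, 0, 0, 0, 0]
  | b + 1 => nextRow (sh b) 0 (rows b)

def dbl (x s : ℕ) : ℕ := Nat.add x (Nat.shiftLeft x s)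

/-- repeat the pattern `x` in slots `0, 2^a, 2·2^a, …, (2^b-1)·2^a` -/
def rep (x a : ℕ) : ℕ → ℕ
  | 0 => x
  | b + 1 => dbl (rep x a b) (sh (Nat.add a b))

def hstep (M : ℕ) : ℕ → List ℕ → List ℕ
  | _, [] => []
  | w, g :: gs => Nat.land (Nat.shiftLeft g (sh w)) M :: hstep M (Nat.succ w) gs

def accum (hi c : ℕ) : ℕ → List ℕ → (ℕ → Bool) → Bool
  | _, [], k => k 0
  | w, h :: hs, k =>
    bif Nat.ble w c then
      bif Nat.ble (Nat.sub c w) 20 then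
        accum hi c (Nat.succ w) hs (fun n =>
          bif Nat.beq (Nat.land (Nat.add n (Nat.shiftLeft h (sh (Nat.sub c w)))) hi) 0 then
            k (Nat.add n (Nat.shiftLeft h (sh (Nat.sub c w))))
          else false)
      else accum hi c (Nat.succ w) hs k
    else accum hi c (Nat.succ w) hs k

/-- compute the entries `v-1, …, 0` of the next vector and push them on `l` -/
def vstep (hi K M : ℕ) (H : List ℕ) (k : List ℕ → Bool) : ℕ → List ℕ → Bool
  | 0, l => k l
  | v + 1, l => accum hi (Nat.sub K v) 0 H (fun n => vstep hi K M H k v (Nat.land n M :: l))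

def levels (hi K : ℕ) (k : List ℕ → Bool) : List ℕ → List ℕ → Bool
  | M1 :: M2 :: Ms, g => vstep hi K M2 (hstep M1 0 g) (levels hi K k Ms) 21 []
  | _, g => k g

/-- the slots congruent to `r` modulo 4 -/
def lane (L Q r : ℕ) : ℕ := Nat.land Q (Nat.shiftLeft L (Nat.mul 8 r))

/-- the part of the product of two lanes in slot `f` -/
def coef (L Q F r s : ℕ) : ℕ := Nat.land (Nat.mul (lane L Q r) (lane L Q s)) F

def symCoef (L Q F r s : ℕ) : ℕ :=
  bif Nat.ble r s then
    bif Nat.beq r s then coef L Q F r s else Nat.mul 2 (coef L Q F r s)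
  else 0

def dot (L Q f F : ℕ) : ℕ :=
  Nat.add (Nat.add (symCoef L Q F 0 (Nat.mod f 4)) (symCoef L Q F 1 (Nat.mod (Nat.add f 3) 4)))
   (Nat.add (symCoef L Q F 2 (Nat.mod (Nat.add f 2) 4)) (symCoef L Q F 3 (Nat.mod (Nat.add f 1) 4)))

def total (L F : ℕ) : ℕ → List ℕ → ℕ
  | _, [] => 0
  | m, Q :: Qs => Nat.add (total L F (Nat.succ m) Qs)
      (Nat.shiftLeft (dot L Q (Nat.sub F (Nat.pow 2 m))
        (Nat.shiftLeft 4294967295 (Nat.mul 8 (Nat.sub F (Nat.pow 2 m))))) (sh m))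

def verify (K N : ℕ) : Bool :=
  levels (rep 192 0 22) K
    (fun g => Nat.beq (total (rep 255 2 19) 2097151 0 g) (Nat.shiftLeft N (Nat.mul 8 2097151)))
    (rows 21).tail (List.replicate 21 1)

open Polynomial

/-! ### Binary digit sums -/

def pop (n : ℕ) : ℕ := (Nat.digits 2 n).sum

theorem pop_zero : pop 0 = 0 := by simp [pop]

theorem pop_two_mul_add (n r : ℕ) (hr : r < 2) : pop (2 * n + r) = pop n + r := by
  unfold pop
  rcases Nat.eq_zero_or_pos (2 * n + r) with h | h
  · have h1 : n = 0 := by omega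
    have h2 : r = 0 := by omega
    subst h1 h2; simp
  · rw [Nat.digits_def' (by norm_num) h]
    have h1 : (2 * n + r) % 2 = r := by omega
    have h2 : (2 * n + r) / 2 = n := by omega
    rw [h1, h2, List.sum_cons]; omega

theorem pop_add_le : ∀ a b : ℕ, pop (a + b) ≤ pop a + pop b := by
  intro a
  induction a using Nat.strong_induction_on with
  | _ a ih =>
    intro b
    have ea : a = 2 * (a / 2) + a % 2 := by omega
    have eb : b = 2 * (b / 2) + b % 2 := by omega
    rcases Nat.eq_zero_or_pos a with h0 | hpos
    · subst h0; simp
    have pa := pop_two_mul_add (a / 2) (a % 2) (by omega)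
    have pb := pop_two_mul_add (b / 2) (b % 2) (by omega)
    rw [← ea] at pa
    rw [← eb] at pb
    have h1 := ih (a / 2) (by omega) (b / 2)
    by_cases hc : a % 2 + b % 2 < 2
    · have h2 := pop_two_mul_add (a / 2 + b / 2) (a % 2 + b % 2) hc
      have : a + b = 2 * (a / 2 + b / 2) + (a % 2 + b % 2) := by omega
      rw [← this] at h2; omega
    · have h2 := pop_two_mul_add (a / 2 + b / 2 + 1) 0 (by omega)
      have : a + b = 2 * (a / 2 + b / 2 + 1) + 0 := by omega
      rw [← this] at h2
      rcases Nat.lt_or_ge (a / 2) a with hlt | hge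
      · -- the carry is absorbed through the induction hypothesis twice
        have h3 : pop (a / 2 + b / 2 + 1) ≤ pop (a / 2 + b / 2) + 1 := by
          have key : ∀ n : ℕ, pop (n + 1) ≤ pop n + 1 := by
            intro n
            induction n using Nat.strong_induction_on with
            | _ n ihn =>
              have en : n = 2 * (n / 2) + n % 2 := by omega
              have pn := pop_two_mul_add (n / 2) (n % 2) (by omega)
              rw [← en] at pn
              by_cases hn : n % 2 = 0
              · have := pop_two_mul_add (n / 2) 1 (by omega)
                have e : 2 * (n / 2) + 1 = n + 1 := by omega
                rw [e] at this; omega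
              · have := pop_two_mul_add (n / 2 + 1) 0 (by omega)
                have e : 2 * (n / 2 + 1) + 0 = n + 1 := by omega
                rw [e] at this
                have := ihn (n / 2) (by omega)
                omega
          exact key _
        omega
      · omega

theorem pop_two_pow_add : ∀ b i : ℕ, i < 2 ^ b → pop (2 ^ b + i) = pop i + 1 := by
  intro b
  induction b with
  | zero =>
    intro i hi
    have : i = 0 := by simpa using hi
    subst this; simp [pop]
  | succ b ih =>
    intro i hi
    rw [pow_succ] at hi ⊢
    have e : 2 ^ b * 2 + i = 2 * (2 ^ b + i / 2) + i % 2 := by omega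
    have e' : i = 2 * (i / 2) + i % 2 := by omega
    have p' := pop_two_mul_add (i / 2) (i % 2) (by omega)
    rw [← e'] at p'
    rw [e, pop_two_mul_add _ _ (by omega), ih _ (by omega), p']
    omega

theorem pop_two_pow (b : ℕ) : pop (2 ^ b) = 1 := by
  have := pop_two_pow_add b 0 (by positivity)
  simpa [pop_zero] using this

theorem pop_sum_le {ι : Type*} (s : Finset ι) (f : ι → ℕ) :
    pop (∑ i ∈ s, 2 ^ f i) ≤ s.card := by
  classical
  induction s using Finset.induction_on with
  | empty => simp [pop_zero]
  | insert a s ha ih =>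
    rw [Finset.sum_insert ha, Finset.card_insert_of_notMem ha]
    have := pop_add_le (2 ^ f a) (∑ i ∈ s, 2 ^ f i)
    rw [pop_two_pow] at this; omega

/-! ### Digits of evaluated polynomials -/

theorem eval_div_pow (b : ℕ) (hb : 0 < b) : ∀ (i : ℕ) (p : ℕ[X]), (∀ j, p.coeff j < b) →
    p.eval b / b ^ i % b = p.coeff i := by
  intro i
  induction i with
  | zero =>
    intro p hp
    have h := congrArg (eval b) (divX_mul_X_add p)
    simp only [eval_add, eval_mul, eval_X, eval_C] at h
    rw [← h, pow_zero, Nat.div_one, Nat.mul_comm, Nat.mul_add_mod, Nat.mod_eq_of_lt (hp 0)]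
  | succ i ih =>
    intro p hp
    have h := congrArg (eval b) (divX_mul_X_add p)
    simp only [eval_add, eval_mul, eval_X, eval_C] at h
    have h1 : p.eval b / b = (divX p).eval b := by
      rw [← h, Nat.mul_comm, Nat.mul_add_div hb, Nat.div_eq_of_lt (hp 0), Nat.add_zero]
    rw [pow_succ', ← Nat.div_div_eq_div_mul, h1, ih (divX p) (fun j => by
      rw [coeff_divX]; exact hp _), coeff_divX]

/-- the `i`-th byte of `n` -/
def byte (n i : ℕ) : ℕ := n / 256 ^ i % 256

theorem byte_eval (p : ℕ[X]) (hp : ∀ j, p.coeff j < 256) (i : ℕ) :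
    byte (p.eval 256) i = p.coeff i := eval_div_pow 256 (by norm_num) i p hp

theorem pow256 (i : ℕ) : (256 : ℕ) ^ i = 2 ^ (8 * i) := by
  rw [pow_mul]; norm_num

theorem testBit_byte (n k : ℕ) : n.testBit k = (byte n (k / 8)).testBit (k % 8) := by
  unfold byte
  have h : (256 : ℕ) = 2 ^ 8 := by norm_num
  rw [pow256]
  conv_rhs => rw [h]
  rw [Nat.testBit_mod_two_pow, Nat.testBit_div_two_pow]
  have : k % 8 < 8 := Nat.mod_lt _ (by norm_num)
  simp only [this, decide_true, Bool.true_and]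
  congr 1; omega

theorem byte_land (x y i : ℕ) : byte (Nat.land x y) i = Nat.land (byte x i) (byte y i) := by
  unfold byte
  have h : (256 : ℕ) = 2 ^ 8 := by norm_num
  change (x &&& y) / 256 ^ i % 256 = (x / 256 ^ i % 256) &&& (y / 256 ^ i % 256)
  rw [pow256]
  conv_lhs => rw [h]
  conv_rhs => rw [h]
  rw [Nat.and_div_two_pow, Nat.and_mod_two_pow]

theorem eq_of_byte {x y : ℕ} (h : ∀ i, byte x i = byte y i) : x = y := by
  apply Nat.eq_of_testBit_eq
  intro k
  rw [testBit_byte x, testBit_byte y, h]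

/-- keep only the terms of `p` with exponent satisfying `P` -/
noncomputable def res (P : ℕ → Prop) [DecidablePred P] (p : ℕ[X]) : ℕ[X] :=
  ∑ i ∈ p.support with P i, monomial i (p.coeff i)

theorem coeff_res (P : ℕ → Prop) [DecidablePred P] (p : ℕ[X]) (i : ℕ) :
    (res P p).coeff i = if P i then p.coeff i else 0 := by
  unfold res
  rw [finsetSum_coeff]
  simp only [coeff_monomial]
  rw [Finset.sum_ite_eq']
  simp only [Finset.mem_filter, mem_support_iff]
  by_cases hP : P i <;> by_cases h0 : p.coeff i = 0 <;> simp [hP, h0]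

/-- `M` has the byte `a` at the positions in `P`, and zero elsewhere -/
def Mask (a M : ℕ) (P : ℕ → Prop) [DecidablePred P] : Prop :=
  ∀ i, byte M i = if P i then a else 0

theorem land_mask (P : ℕ → Prop) [DecidablePred P] {M : ℕ} (hM : Mask 255 M P) (p : ℕ[X])
    (hp : ∀ j, p.coeff j < 256) : Nat.land (p.eval 256) M = (res P p).eval 256 := by
  apply eq_of_byte
  intro i
  rw [byte_land, byte_eval p hp, byte_eval (res P p), coeff_res, hM]
  · split_ifs
    · have : p.coeff i &&& (2 ^ 8 - 1) = p.coeff i % 2 ^ 8 := Nat.and_two_pow_sub_one_eq_mod _ _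
      change p.coeff i &&& 255 = p.coeff i
      rw [show (255 : ℕ) = 2 ^ 8 - 1 by norm_num, this]
      exact Nat.mod_eq_of_lt (hp i)
    · exact Nat.and_zero _
  · intro j; rw [coeff_res]; split_ifs
    · exact hp j
    · norm_num

/-- polynomial with coefficient `a` at the exponents below `D` satisfying `P` -/
noncomputable def mpoly (a D : ℕ) (P : ℕ → Prop) [DecidablePred P] : ℕ[X] :=
  ∑ i ∈ Finset.range D, monomial i (if P i then a else 0)

theorem coeff_mpoly (a D : ℕ) (P : ℕ → Prop) [DecidablePred P] (i : ℕ) :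
    (mpoly a D P).coeff i = if i < D ∧ P i then a else 0 := by
  unfold mpoly
  rw [finsetSum_coeff]
  simp only [coeff_monomial]
  rw [Finset.sum_ite_eq']
  simp only [Finset.mem_range]
  by_cases h : i < D <;> by_cases hP : P i <;> simp [h, hP]

theorem mask_mpoly (a D : ℕ) (ha : a < 256) (P : ℕ → Prop) [DecidablePred P] :
    Mask a ((mpoly a D P).eval 256) (fun i => i < D ∧ P i) := by
  intro i
  rw [byte_eval, coeff_mpoly]
  intro j; rw [coeff_mpoly]; split_ifs
  · exact ha
  · norm_num

theorem shiftLeft_eval (p : ℕ[X]) (t : ℕ) :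
    Nat.shiftLeft (p.eval 256) (Nat.mul 8 t) = (X ^ t * p).eval 256 := by
  rw [eval_mul, eval_pow, eval_X, pow256]
  change (p.eval 256) <<< (8 * t) = _
  rw [Nat.shiftLeft_eq, Nat.mul_comm]

theorem mpoly_double (a D : ℕ) (P Q R : ℕ → Prop) [DecidablePred P] [DecidablePred Q]
    [DecidablePred R] (h1 : ∀ i < D, R i ↔ P i) (h2 : ∀ i < D, R (D + i) ↔ Q i) :
    mpoly a (D + D) R = mpoly a D P + X ^ D * mpoly a D Q := by
  ext i
  rw [coeff_add, coeff_X_pow_mul', coeff_mpoly, coeff_mpoly, coeff_mpoly]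
  by_cases hi : i < D
  · have h3 : ¬ D ≤ i := by omega
    have h4 : i < D + D := by omega
    simp [hi, h3, h4, h1 i hi]
  · have h3 : D ≤ i := by omega
    obtain ⟨j, rfl⟩ := Nat.exists_eq_add_of_le h3
    by_cases hj : j < D
    · simp [hj, h2 j hj]
    · simp [hj]

/-! ### The masks -/

noncomputable def rowP (b p : ℕ) : ℕ[X] := mpoly 255 (2 ^ b) (fun i => pop i = p)
noncomputable def prevP (b p : ℕ) : ℕ[X] := mpoly 255 (2 ^ b) (fun i => pop i + 1 = p)

theorem prevP_zero (b : ℕ) : prevP b 0 = 0 := by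
  ext i; unfold prevP; rw [coeff_mpoly]; simp

theorem prevP_succ (b p : ℕ) : prevP b (p + 1) = rowP b p := by
  ext i; unfold prevP rowP; rw [coeff_mpoly, coeff_mpoly]; simp

theorem rowP_succ (b p : ℕ) : rowP (b + 1) p = rowP b p + X ^ (2 ^ b) * prevP b p := by
  unfold rowP prevP
  have h : 2 ^ (b + 1) = 2 ^ b + 2 ^ b := by rw [pow_succ]; omega
  rw [h]
  apply mpoly_double
  · intro i _; exact Iff.rfl
  · intro i hi; rw [pop_two_pow_add b i hi]

/-- the list holds the masks for the digit sums `p, p+1, …` -/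
def RL (b : ℕ) : ℕ → List ℕ → Prop
  | _, [] => True
  | p, x :: xs => x = (rowP b p).eval 256 ∧ RL b (p + 1) xs

theorem nextRow_sound (b : ℕ) : ∀ (xs : List ℕ) (p prev : ℕ), RL b p xs →
    prev = (prevP b p).eval 256 → RL (b + 1) p (nextRow (sh b) prev xs) := by
  intro xs
  induction xs with
  | nil => intro p prev _ _; trivial
  | cons x xs ih =>
    rintro p prev ⟨hx, hxs⟩ hprev
    refine ⟨?_, ih (p + 1) x hxs (by rw [prevP_succ]; exact hx)⟩
    rw [rowP_succ, eval_add, ← shiftLeft_eval, ← hx, ← hprev]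
    rfl

theorem length_nextRow (s : ℕ) : ∀ (xs : List ℕ) (p : ℕ), (nextRow s p xs).length = xs.length := by
  intro xs
  induction xs with
  | nil => intro p; rfl
  | cons x xs ih => intro p; simp [nextRow, ih]

theorem length_rows : ∀ b : ℕ, (rows b).length = 11 := by
  intro b
  induction b with
  | zero => rfl
  | succ b ih => rw [rows, length_nextRow, ih]

theorem rowP_zero_zero : (rowP 0 0).eval 256 = 255 := by
  have : rowP 0 0 = C 255 := by
    ext i; unfold rowP; rw [coeff_mpoly, coeff_C]
    by_cases h : i = 0 <;> simp [h, pop_zero]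
  rw [this, eval_C]

theorem rowP_zero_succ (p : ℕ) : (rowP 0 (p + 1)).eval 256 = 0 := by
  have : rowP 0 (p + 1) = 0 := by
    ext i; unfold rowP; rw [coeff_mpoly]
    by_cases h : i = 0 <;> simp [h, pop_zero]
  rw [this, eval_zero]

theorem rows_sound : ∀ b : ℕ, RL b 0 (rows b) := by
  intro b
  induction b with
  | zero =>
    simp only [rows, RL, rowP_zero_zero, rowP_zero_succ, and_self]
  | succ b ih =>
    exact nextRow_sound b _ _ _ ih (by rw [prevP_zero, eval_zero])

theorem RL_tail (b p : ℕ) : ∀ l : List ℕ, RL b p l → RL b (p + 1) l.tail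
  | [], _ => trivial
  | _ :: _, h => h.2

theorem rep_sound (x a : ℕ) : ∀ b : ℕ,
    rep x a b = (mpoly x (2 ^ (a + b)) (fun i => i % 2 ^ a = 0)).eval 256 := by
  intro b
  induction b with
  | zero =>
    have : mpoly x (2 ^ (a + 0)) (fun i => i % 2 ^ a = 0) = C x := by
      ext i; rw [coeff_mpoly, coeff_C, Nat.add_zero]
      by_cases h : i = 0
      · simp [h]
      · rw [if_neg, if_neg h]
        rintro ⟨h1, h2⟩
        rw [Nat.mod_eq_of_lt h1] at h2; exact h h2
    rw [this, eval_C]; rfl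
  | succ b ih =>
    have h : 2 ^ (a + (b + 1)) = 2 ^ (a + b) + 2 ^ (a + b) := by
      rw [← Nat.add_assoc, pow_succ]; omega
    rw [h, mpoly_double x (2 ^ (a + b)) (fun i => i % 2 ^ a = 0) (fun i => i % 2 ^ a = 0)
      (fun i => i % 2 ^ a = 0), eval_add, ← shiftLeft_eval, ← ih]
    · rfl
    · intro i _; exact Iff.rfl
    · intro i _
      rw [pow_add, Nat.mul_add_mod]

/-! ### Soundness of the packed computation -/

def Good (D n : ℕ) (p : ℕ[X]) : Prop :=
  n = p.eval 256 ∧ (∀ i, p.coeff i < 64) ∧ ∀ i, D ≤ i → p.coeff i = 0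

def GList (D : ℕ) (ps : ℕ → ℕ[X]) : ℕ → List ℕ → Prop
  | w, [] => w = 21
  | w, h :: hs => Good D h (ps w) ∧ GList D ps (w + 1) hs

theorem GList_len (D : ℕ) (ps : ℕ → ℕ[X]) : ∀ (l : List ℕ) (w : ℕ), GList D ps w l →
    w + l.length = 21 := by
  intro l
  induction l with
  | nil => intro w h; exact h
  | cons x xs ih => intro w h; have := ih _ h.2; rw [List.length_cons]; omega

theorem GList_congr (D : ℕ) (ps qs : ℕ → ℕ[X]) : ∀ (l : List ℕ) (w : ℕ),
    (∀ x, x < 21 → ps x = qs x) → GList D ps w l → GList D qs w l := by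
  intro l
  induction l with
  | nil => intro w _ h; exact h
  | cons x xs ih =>
    intro w he h
    have := GList_len D ps _ w h
    rw [List.length_cons] at this
    exact ⟨he w (by omega) ▸ h.1, ih _ he h.2⟩

theorem land192 : ∀ c < 256, Nat.land c 192 = 0 → c < 64 := by decide +kernel

theorem good_check {n m hi : ℕ} {p q : ℕ[X]} (hp : Good (2 ^ 22) n p) (hq : Good (2 ^ 22) m q)
    (hhi : ∀ i < 2 ^ 22, byte hi i = 192) (h : Nat.land (Nat.add n m) hi = 0) :
    Good (2 ^ 22) (Nat.add n m) (p + q) := by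
  obtain ⟨hp1, hp2, hp3⟩ := hp
  obtain ⟨hq1, hq2, hq3⟩ := hq
  have he : Nat.add n m = (p + q).eval 256 := by rw [eval_add, ← hp1, ← hq1]; rfl
  have hz : ∀ i, 2 ^ 22 ≤ i → (p + q).coeff i = 0 := by
    intro i hi; rw [coeff_add, hp3 i hi, hq3 i hi]
  have hb : ∀ i, (p + q).coeff i < 256 := by
    intro i; rw [coeff_add]; have := hp2 i; have := hq2 i; omega
  refine ⟨he, ?_, hz⟩
  intro i
  rcases Nat.lt_or_ge i (2 ^ 22) with hi | hi
  · apply land192 _ (hb i)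
    rw [← byte_eval _ hb, ← hhi i hi, ← he, ← byte_land, h]
    simp [byte]
  · rw [hz i hi]; norm_num

theorem good_shift {n t : ℕ} {p : ℕ[X]} (hp : Good (2 ^ 21) n p) (ht : t ≤ 20) :
    Good (2 ^ 22) (Nat.shiftLeft n (sh t)) (X ^ (2 ^ t) * p) := by
  obtain ⟨hp1, hp2, hp3⟩ := hp
  have h20 : 2 ^ t ≤ 2 ^ 20 := Nat.pow_le_pow_right (by norm_num) ht
  refine ⟨?_, ?_, ?_⟩
  · rw [← shiftLeft_eval, ← hp1]; rfl
  · intro i; rw [coeff_X_pow_mul']; split_ifs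
    · exact hp2 _
    · norm_num
  · intro i hi; rw [coeff_X_pow_mul']; split_ifs
    · apply hp3; omega
    · rfl

theorem good_mask {n M : ℕ} {p : ℕ[X]} (P : ℕ → Prop) [DecidablePred P]
    (hM : Mask 255 M P) (hP : ∀ i, P i → i < 2 ^ 21)
    (hp : Good (2 ^ 22) n p) : Good (2 ^ 21) (Nat.land n M) (res P p) := by
  obtain ⟨hp1, hp2, hp3⟩ := hp
  refine ⟨?_, ?_, ?_⟩
  · rw [hp1]; exact land_mask P hM p (fun j => lt_trans (hp2 j) (by norm_num))
  · intro i; rw [coeff_res]; split_ifs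
    · exact hp2 _
    · norm_num
  · intro i hi; rw [coeff_res, if_neg]
    intro h; have := hP i h; omega

theorem accum_sound {hi c : ℕ} (hhi : ∀ i < 2 ^ 22, byte hi i = 192) (ps : ℕ → ℕ[X]) :
    ∀ (hs : List ℕ) (w : ℕ) (k : ℕ → Bool), accum hi c w hs k = true → GList (2 ^ 21) ps w hs →
    ∃ n, k n = true ∧ Good (2 ^ 22) n
      (∑ x ∈ Finset.Ico w 21, if x ≤ c ∧ c - x ≤ 20 then X ^ (2 ^ (c - x)) * ps x else 0) := by
  intro hs
  induction hs with
  | nil =>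
    intro w k h hw
    have hw' : w = 21 := hw
    subst hw'
    refine ⟨0, h, ?_⟩
    simp [Good]
  | cons x xs ih =>
    intro w k h hg
    have hlen := GList_len _ _ _ _ hg
    rw [List.length_cons] at hlen
    have hw : w < 21 := by omega
    rw [Finset.sum_eq_sum_Ico_succ_bot hw]
    rw [accum] at h
    by_cases h1 : w ≤ c
    · by_cases h2 : c - w ≤ 20
      · have b1 : Nat.ble w c = true := Nat.ble_eq.mpr h1
        have b2 : Nat.ble (Nat.sub c w) 20 = true := Nat.ble_eq.mpr h2
        rw [b1, b2, cond_true, cond_true] at h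
        obtain ⟨n, hn, hgood⟩ := ih _ _ h hg.2
        by_cases h3 : Nat.beq (Nat.land (Nat.add n (Nat.shiftLeft x (sh (Nat.sub c w)))) hi) 0 = true
        · rw [h3, cond_true] at hn
          refine ⟨_, hn, ?_⟩
          rw [if_pos ⟨h1, h2⟩, add_comm]
          exact good_check hgood (good_shift hg.1 h2) hhi (Nat.eq_of_beq_eq_true h3)
        · rw [Bool.not_eq_true] at h3
          rw [h3, cond_false] at hn
          exact absurd hn (by decide)
      · have b1 : Nat.ble w c = true := Nat.ble_eq.mpr h1
        have b2 : Nat.ble (Nat.sub c w) 20 = false := by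
          rw [← Bool.not_eq_true, Nat.ble_eq]; exact h2
        rw [b1, b2, cond_true, cond_false] at h
        rw [if_neg (fun hh => h2 hh.2), zero_add]
        exact ih _ _ h hg.2
    · have b1 : Nat.ble w c = false := by rw [← Bool.not_eq_true, Nat.ble_eq]; exact h1
      rw [b1, cond_false] at h
      rw [if_neg (fun hh => h1 hh.1), zero_add]
      exact ih _ _ h hg.2

theorem hstep_sound {M : ℕ} (P : ℕ → Prop) [DecidablePred P]
    (hM : Mask 255 M P) (hP : ∀ i, P i → i < 2 ^ 21) (ps : ℕ → ℕ[X]) :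
    ∀ (gs : List ℕ) (w : ℕ), GList (2 ^ 21) ps w gs →
    GList (2 ^ 21) (fun x => res P (X ^ (2 ^ x) * ps x)) w (hstep M w gs) := by
  intro gs
  induction gs with
  | nil => intro w h; exact h
  | cons x xs ih =>
    intro w h
    have hlen := GList_len _ _ _ _ h
    rw [List.length_cons] at hlen
    exact ⟨good_mask P hM hP (good_shift h.1 (by omega)), ih _ h.2⟩

/-- transition without masks -/
noncomputable def tr (K : ℕ) (ps : ℕ → ℕ[X]) (v : ℕ) : ℕ[X] :=
  ∑ x ∈ Finset.Ico 0 21, if x ≤ K - v ∧ K - v - x ≤ 20 then X ^ (2 ^ (K - v - x)) * ps x else 0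

theorem vstep_sound {hi K M : ℕ} (hhi : ∀ i < 2 ^ 22, byte hi i = 192)
    (P : ℕ → Prop) [DecidablePred P]
    (hM : Mask 255 M P) (hP : ∀ i, P i → i < 2 ^ 21) (ps : ℕ → ℕ[X]) (H : List ℕ)
    (hH : GList (2 ^ 21) ps 0 H) (k : List ℕ → Bool) :
    ∀ (v : ℕ) (l : List ℕ), vstep hi K M H k v l = true →
    GList (2 ^ 21) (fun v => res P (tr K ps v)) v l →
    ∃ l', k l' = true ∧ GList (2 ^ 21) (fun v => res P (tr K ps v)) 0 l' := by
  intro v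
  induction v with
  | zero => intro l h hg; exact ⟨l, h, hg⟩
  | succ v ih =>
    intro l h hg
    rw [vstep] at h
    obtain ⟨n, hn, hgood⟩ := accum_sound hhi ps H 0 _ h hH
    exact ih _ hn ⟨good_mask P hM hP hgood, hg⟩

/-! ### The exact generating functions -/

noncomputable def u (K : ℕ) : ℕ → ℕ → ℕ[X]
  | 0, _ => 1
  | j + 1, v => tr K (fun x => X ^ (2 ^ x) * u K j x) v

def PP (q i : ℕ) : Prop := i < 2 ^ 21 ∧ pop i = q

instance (q : ℕ) : DecidablePred (PP q) := fun i => by unfold PP; infer_instance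

def Supp (q : ℕ) (p : ℕ[X]) : Prop := ∀ i, p.coeff i ≠ 0 → pop i ≤ q

theorem supp_mul {q t : ℕ} {p : ℕ[X]} (h : Supp q p) : Supp (q + 1) (X ^ (2 ^ t) * p) := by
  intro i hi
  rw [coeff_X_pow_mul'] at hi
  split_ifs at hi with h1
  · have h2 := h _ hi
    have h3 := pop_add_le (2 ^ t) (i - 2 ^ t)
    rw [pop_two_pow, Nat.add_sub_cancel' h1] at h3
    omega
  · exact absurd rfl hi

theorem supp_u (K : ℕ) : ∀ j v, Supp (2 * j) (u K j v) := by
  intro j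
  induction j with
  | zero =>
    intro v i hi
    have : (1 : ℕ[X]).coeff i ≠ 0 := hi
    rw [coeff_one] at this
    have h0 : i = 0 := by by_contra h; simp [h] at this
    rw [h0, pop_zero]
  | succ j ih =>
    intro v i hi
    rw [u, tr, finsetSum_coeff] at hi
    obtain ⟨x, _, hx⟩ := Finset.exists_ne_zero_of_sum_ne_zero hi
    split_ifs at hx
    · exact supp_mul (supp_mul (ih x)) i hx
    · simp at hx

theorem res_mul {q t : ℕ} {p : ℕ[X]} (h : Supp q p) :
    res (PP (q + 1)) (X ^ (2 ^ t) * res (PP q) p) = res (PP (q + 1)) (X ^ (2 ^ t) * p) := by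
  ext i
  rw [coeff_res, coeff_res]
  split_ifs with hP
  · rw [coeff_X_pow_mul', coeff_X_pow_mul']
    split_ifs with h1
    · rw [coeff_res]
      split_ifs with h2
      · rfl
      · by_contra h3
        apply h2
        have h4 := h _ (Ne.symm h3)
        have h5 := pop_add_le (2 ^ t) (i - 2 ^ t)
        rw [pop_two_pow, Nat.add_sub_cancel' h1, hP.2] at h5
        exact ⟨lt_of_le_of_lt (Nat.sub_le _ _) hP.1, by omega⟩
    · rfl
  · rfl

theorem res_tr (P : ℕ → Prop) [DecidablePred P] (K : ℕ) (ps qs : ℕ → ℕ[X]) (v : ℕ)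
    (h : ∀ x t, res P (X ^ (2 ^ t) * ps x) = res P (X ^ (2 ^ t) * qs x)) :
    res P (tr K ps v) = res P (tr K qs v) := by
  ext i
  rw [coeff_res, coeff_res]
  split_ifs with hP
  · unfold tr
    rw [finsetSum_coeff, finsetSum_coeff]
    apply Finset.sum_congr rfl
    intro x _
    split_ifs
    · have := congrArg (fun p => p.coeff i) (h x (K - v - x))
      simp only [coeff_res, if_pos hP] at this
      exact this
    · rfl
  · rfl

theorem mask_PP {b p M : ℕ} (hb : b = 21) (h : M = (rowP b p).eval 256) : Mask 255 M (PP p) := by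
  subst hb
  rw [h]
  intro i
  have := mask_mpoly 255 (2 ^ 21) (by norm_num) (fun i => pop i = p) i
  unfold rowP
  rw [this]
  rfl

theorem levels_sound {hi K b : ℕ} (hb : b = 21) (hhi : ∀ i < 2 ^ 22, byte hi i = 192)
    (k : List ℕ → Bool) :
    ∀ (n j : ℕ) (Ms g : List ℕ), Ms.length = 2 * n → RL b (2 * j + 1) Ms →
    GList (2 ^ 21) (fun v => res (PP (2 * j)) (u K j v)) 0 g → levels hi K k Ms g = true →
    ∃ g', k g' = true ∧ GList (2 ^ 21) (fun v => res (PP (2 * (j + n))) (u K (j + n) v)) 0 g' := by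
  intro n
  induction n with
  | zero =>
    intro j Ms g hlen _ hg h
    have : Ms = [] := List.length_eq_zero_iff.mp (by omega)
    subst this
    exact ⟨g, h, hg⟩
  | succ n ih =>
    intro j Ms g hlen hR hg h
    match Ms, hlen, hR, h with
    | M1 :: M2 :: Ms, hlen, hR, h =>
      rw [levels] at h
      have hm1 := mask_PP hb hR.1
      have hm2 := mask_PP hb hR.2.1
      have hH := hstep_sound (PP (2 * j + 1)) hm1 (fun i h => h.1) _ g 0 hg
      obtain ⟨l, hl, hgl⟩ := vstep_sound (K := K) hhi (PP (2 * j + 1 + 1)) hm2 (fun i h => h.1)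
        _ _ hH _ 21 [] h rfl
      have e : ∀ v, res (PP (2 * j + 1 + 1)) (tr K (fun x => res (PP (2 * j + 1))
          (X ^ (2 ^ x) * res (PP (2 * j)) (u K j x))) v) =
          res (PP (2 * (j + 1))) (u K (j + 1) v) := by
        intro v
        rw [u]
        apply res_tr
        intro x t
        rw [res_mul (supp_u K j x), res_mul (supp_mul (supp_u K j x))]
      have hgl' := GList_congr _ _ _ _ _ (fun x _ => e x) hgl
      have := ih (j + 1) Ms l (by simp only [List.length_cons] at hlen; omega) hR.2.2 hgl' hl
      rw [show j + 1 + n = j + (n + 1) by omega] at this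
      exact this

/-! ### The dot products -/

/-- the coefficients of `q` in positions congruent to `r` modulo 4 -/
noncomputable def lp (q : ℕ[X]) (r : ℕ) : ℕ[X] :=
  ∑ x ∈ Finset.range (2 ^ 19), C (q.coeff (4 * x + r)) * X ^ x

theorem coeff_lp (q : ℕ[X]) (r i : ℕ) :
    (lp q r).coeff i = if i < 2 ^ 19 then q.coeff (4 * i + r) else 0 := by
  unfold lp
  rw [finsetSum_coeff]
  simp only [coeff_C_mul_X_pow]
  rw [Finset.sum_ite_eq]
  simp only [Finset.mem_range]

theorem coeff_mul_bound (B b : ℕ) (a : ℕ → ℕ) (p0 p : ℕ[X])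
    (h0 : p0 = ∑ x ∈ Finset.range B, C (a x) * X ^ x) (ha : ∀ x, a x ≤ b)
    (hp : ∀ x, p.coeff x ≤ b) (i : ℕ) :
    (p0 * p).coeff i ≤ B * (b * b) := by
  rw [h0, Finset.sum_mul, finsetSum_coeff]
  have := Finset.sum_le_card_nsmul (Finset.range B)
    (fun x => (C (a x) * X ^ x * p).coeff i) (b * b) ?_
  · rwa [Finset.card_range, smul_eq_mul] at this
  · intro x _
    rw [mul_assoc, coeff_C_mul, coeff_X_pow_mul']
    apply Nat.mul_le_mul (ha x)
    split_ifs
    · exact hp _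
    · exact Nat.zero_le _

theorem coeff_lp_mul_lt (q : ℕ[X]) (hq : ∀ i, q.coeff i < 64) (r s i : ℕ) :
    (lp q r * lp q s).coeff i < 2 ^ 32 := by
  have hs : ∀ j, (lp q s).coeff j ≤ 63 := by
    intro j; rw [coeff_lp]; split_ifs
    · have := hq (4 * j + s); omega
    · omega
  have h : (lp q r * lp q s).coeff i ≤ 2 ^ 19 * (63 * 63) :=
    coeff_mul_bound (2 ^ 19) 63 (fun x => q.coeff (4 * x + r)) (lp q r) (lp q s) (by rw [lp])
      (fun x => Nat.le_of_lt_succ (hq _)) hs i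
  have h2 : 2 ^ 19 * (63 * 63) < 2 ^ 32 := by norm_num
  exact lt_of_le_of_lt h h2

theorem coeff_exp (g : ℕ[X]) (k f : ℕ) : (X ^ k * expand ℕ 4 g).coeff f =
    if k ≤ f ∧ 4 ∣ f - k then g.coeff ((f - k) / 4) else 0 := by
  rw [coeff_X_pow_mul', coeff_expand (by norm_num)]
  by_cases h : k ≤ f <;> simp [h]

theorem eval_exp (g : ℕ[X]) (k B : ℕ) (hB : 256 ^ 4 = B) :
    (X ^ k * expand ℕ 4 g).eval 256 = 256 ^ k * g.eval B := by
  rw [eval_mul, eval_pow, eval_X, expand_eval, hB]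

theorem coef_core (B f r s t : ℕ) (g h : ℕ[X]) (hB : 256 ^ 4 = B) (hpos : 0 < B)
    (ht : f = (r + s) + 4 * t) (hb : ∀ i, (g * h).coeff i < B) :
    Nat.mul ((X ^ r * expand ℕ 4 g).eval 256) ((X ^ s * expand ℕ 4 h).eval 256) / 256 ^ f % B =
      (g * h).coeff t := by
  rw [eval_exp g r B hB, eval_exp h s B hB, ht, pow_add 256 (r + s), pow_mul 256 4 t, hB]
  have e : Nat.mul (256 ^ r * g.eval B) (256 ^ s * h.eval B) =
      256 ^ (r + s) * (g * h).eval B := by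
    rw [eval_mul, pow_add]
    change (256 ^ r * g.eval B) * (256 ^ s * h.eval B) = _
    ring
  rw [e, Nat.mul_div_mul_left _ _ (by positivity)]
  exact eval_div_pow B hpos t _ hb

theorem lane_sound {L n r : ℕ} {q : ℕ[X]}
    (hL : L = (mpoly 255 (2 ^ (2 + 19)) (fun i => i % 2 ^ 2 = 0)).eval 256)
    (hq : Good (2 ^ 21) n q) :
    lane L n r = (X ^ r * expand ℕ 4 (lp q r)).eval 256 := by
  obtain ⟨h1, h2, h3⟩ := hq
  have hM : Mask 255 (Nat.shiftLeft L (Nat.mul 8 r))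
      (fun i => r ≤ i ∧ i - r < 2 ^ (2 + 19) ∧ (i - r) % 2 ^ 2 = 0) := by
    rw [hL, shiftLeft_eval]
    intro i
    rw [byte_eval]
    · rw [coeff_X_pow_mul', coeff_mpoly]
      by_cases h : r ≤ i
      · simp only [h, true_and, if_true]
      · simp only [h, false_and, if_false]
    · intro j
      rw [coeff_X_pow_mul', coeff_mpoly]
      split_ifs <;> norm_num
  unfold lane
  rw [h1, land_mask _ hM q (fun j => lt_trans (h2 j) (by norm_num))]
  congr 1
  ext i
  rw [coeff_res, coeff_exp, coeff_lp]
  have e : (2 : ℕ) ^ 2 = 4 := by norm_num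
  have e2 : (2 : ℕ) ^ (2 + 19) = 2 ^ 21 := by norm_num
  rw [e, e2]
  by_cases h4 : r ≤ i
  · by_cases h5 : (i - r) % 4 = 0
    · have h6 : 4 ∣ i - r := Nat.dvd_of_mod_eq_zero h5
      have h7 : 4 * ((i - r) / 4) + r = i := by omega
      by_cases h8 : i - r < 2 ^ 21
      · rw [if_pos ⟨h4, h8, h5⟩, if_pos ⟨h4, h6⟩, if_pos (by omega), h7]
      · rw [if_neg (fun h => h8 h.2.1), if_pos ⟨h4, h6⟩, if_neg (by omega)]
    · rw [if_neg (fun h => h5 h.2.2), if_neg (fun h => h5 (Nat.mod_eq_zero_of_dvd h.2))]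
  · rw [if_neg (fun h => h4 h.1), if_neg (fun h => h4 h.1)]

theorem land_window (x n : ℕ) :
    Nat.land x (Nat.shiftLeft 4294967295 n) = (x / 2 ^ n % 2 ^ 32) * 2 ^ n := by
  rw [← Nat.shiftLeft_eq]
  change x &&& ((4294967295 : ℕ) <<< n) = _
  apply Nat.eq_of_testBit_eq
  intro i
  rw [show (4294967295 : ℕ) = 2 ^ 32 - 1 by norm_num]
  rw [Nat.testBit_and, Nat.testBit_shiftLeft, Nat.testBit_shiftLeft, Nat.testBit_two_pow_sub_one,
    Nat.testBit_mod_two_pow, Nat.testBit_div_two_pow]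
  by_cases h : n ≤ i
  · rw [Nat.sub_add_cancel h]
    simp [h, Bool.and_comm]
  · simp [h]

/-- contribution of lanes `r`, `s` to the coefficient `f` of the square -/
noncomputable def cc (q : ℕ[X]) (f r s : ℕ) : ℕ :=
  (X ^ (r + s) * expand ℕ 4 (lp q r * lp q s)).coeff f

theorem cc_comm_aux (g h : ℕ[X]) (f r s : ℕ) :
    (X ^ (r + s) * expand ℕ 4 (g * h)).coeff f = (X ^ (s + r) * expand ℕ 4 (h * g)).coeff f := by
  have e1 : r + s = s + r := add_comm r s
  have e2 : g * h = h * g := mul_comm g h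
  rw [e1, e2]

theorem cc_comm (q : ℕ[X]) (f r s : ℕ) : cc q f r s = cc q f s r :=
  cc_comm_aux (lp q r) (lp q s) f r s

theorem cc_zero (q : ℕ[X]) {f r s : ℕ} (h : (r + s) % 4 ≠ f % 4) : cc q f r s = 0 := by
  unfold cc; rw [coeff_exp, if_neg]; omega

theorem window_data (L n r s m : ℕ) (q : ℕ[X]) (hq : ∀ i, q.coeff i < 64) :
    ∃ B : ℕ, 256 ^ 4 = B ∧ (∀ i, (lp q r * lp q s).coeff i < B) ∧
      Nat.land (Nat.mul (lane L n r) (lane L n s)) (Nat.shiftLeft 4294967295 m) =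
        (Nat.mul (lane L n r) (lane L n s) / 2 ^ m % B) * 2 ^ m :=
  ⟨2 ^ 32, by norm_num, coeff_lp_mul_lt q hq r s, land_window _ m⟩

theorem coef_sound {L n r s f : ℕ} {q : ℕ[X]}
    (hL : L = (mpoly 255 (2 ^ (2 + 19)) (fun i => i % 2 ^ 2 = 0)).eval 256)
    (hq : Good (2 ^ 21) n q) (hr : r < 4) (hs : s < 4) (hf : 6 ≤ f) (h : (r + s) % 4 = f % 4) :
    coef L n (Nat.shiftLeft 4294967295 (Nat.mul 8 f)) r s = cc q f r s * 256 ^ f := by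
  obtain ⟨t, ht⟩ : ∃ t, f = (r + s) + 4 * t := ⟨(f - (r + s)) / 4, by omega⟩
  have e2 : (f - (r + s)) / 4 = t := by omega
  have e3 : 2 ^ (Nat.mul 8 f) = 256 ^ f := (pow256 f).symm
  obtain ⟨B, hB, hb, hw⟩ := window_data L n r s (Nat.mul 8 f) q hq.2.1
  have hpos : 0 < B := by rw [← hB]; positivity
  unfold coef cc
  rw [hw, coeff_exp, if_pos (by omega), e2, e3, lane_sound hL hq, lane_sound hL hq,
    coef_core B f r s t (lp q r) (lp q s) hB hpos ht hb]

theorem lanes_sum {n : ℕ} {q : ℕ[X]} (hq : Good (2 ^ 21) n q) :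
    q = ∑ r ∈ Finset.range 4, X ^ r * expand ℕ 4 (lp q r) := by
  ext i
  rw [finsetSum_coeff, Finset.sum_eq_single (i % 4)]
  · rw [coeff_exp, if_pos (by omega), coeff_lp]
    split_ifs with h
    · congr 1; omega
    · exact hq.2.2 i (by omega)
  · intro b hb hne
    rw [Finset.mem_range] at hb
    rw [coeff_exp, if_neg]
    omega
  · intro h
    exact absurd (Finset.mem_range.mpr (Nat.mod_lt _ (by norm_num))) h

theorem sq_coeff {n : ℕ} {q : ℕ[X]} (hq : Good (2 ^ 21) n q) (f : ℕ) :
    (q * q).coeff f = ∑ r ∈ Finset.range 4, ∑ s ∈ Finset.range 4, cc q f r s := by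
  conv_lhs => rw [lanes_sum hq]
  rw [Finset.sum_mul_sum, finsetSum_coeff]
  apply Finset.sum_congr rfl
  intro r _
  rw [finsetSum_coeff]
  apply Finset.sum_congr rfl
  intro s _
  unfold cc
  rw [map_mul, pow_add]
  congr 1
  ring

theorem dot_core {L n f W E : ℕ} {q : ℕ[X]} (hq : Good (2 ^ 21) n q)
    (hcoef : ∀ r s, r < 4 → s < 4 → (r + s) % 4 = f % 4 → coef L n W r s = cc q f r s * E) :
    dot L n f W = (q * q).coeff f * E := by
  have hsym : ∀ r s, r < 4 → s < 4 → (r + s) % 4 = f % 4 →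
      symCoef L n W r s =
      (if r < s then 2 * cc q f r s else if r = s then cc q f r s else 0) * E := by
    intro r s hr hs h
    unfold symCoef
    have hc := hcoef r s hr hs h
    rw [hc]
    rcases lt_trichotomy r s with h1 | h1 | h1
    · have b1 : Nat.ble r s = true := Nat.ble_eq.mpr (by omega)
      have b2 : Nat.beq r s = false := by
        rw [← Bool.not_eq_true]; intro hh; have := Nat.eq_of_beq_eq_true hh; omega
      rw [b1, b2, cond_true, cond_false, if_pos h1]
      exact (mul_assoc 2 _ _).symm
    · subst h1
      have b1 : Nat.ble r r = true := Nat.ble_eq.mpr (by omega)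
      have b2 : Nat.beq r r = true := Nat.beq_refl r
      rw [b1, b2, cond_true, cond_true, if_neg (by omega), if_pos rfl]
    · have b1 : Nat.ble r s = false := by rw [← Bool.not_eq_true, Nat.ble_eq]; omega
      rw [b1, cond_false, if_neg (by omega), if_neg (by omega), zero_mul]
  unfold dot
  change symCoef L n W 0 (f % 4) + symCoef L n W 1 ((f + 3) % 4) +
    (symCoef L n W 2 ((f + 2) % 4) + symCoef L n W 3 ((f + 1) % 4)) = _
  rw [hsym 0 _ (by omega) (by omega) (by omega), hsym 1 _ (by omega) (by omega) (by omega),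
    hsym 2 _ (by omega) (by omega) (by omega), hsym 3 _ (by omega) (by omega) (by omega),
    sq_coeff hq f, ← add_mul, ← add_mul, ← add_mul]
  congr 1
  simp only [Finset.sum_range_succ, Finset.sum_range_zero, zero_add]
  rw [cc_comm q f 1 0, cc_comm q f 2 0, cc_comm q f 3 0, cc_comm q f 2 1, cc_comm q f 3 1,
    cc_comm q f 3 2]
  have z : ∀ r s, (r + s) % 4 ≠ f % 4 → cc q f r s = 0 := fun r s h => cc_zero q h
  have h4 : f % 4 = 0 ∨ f % 4 = 1 ∨ f % 4 = 2 ∨ f % 4 = 3 := by omega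
  rcases h4 with h | h | h | h
  · have e1 : (f + 3) % 4 = 3 := by omega
    have e2 : (f + 2) % 4 = 2 := by omega
    have e3 : (f + 1) % 4 = 1 := by omega
    rw [h, e1, e2, e3, z 0 1 (by omega), z 0 2 (by omega), z 0 3 (by omega), z 1 1 (by omega),
      z 1 2 (by omega), z 2 3 (by omega), z 3 3 (by omega)]
    norm_num
    omega
  · have e1 : (f + 3) % 4 = 0 := by omega
    have e2 : (f + 2) % 4 = 3 := by omega
    have e3 : (f + 1) % 4 = 2 := by omega
    rw [h, e1, e2, e3, z 0 0 (by omega), z 0 2 (by omega), z 0 3 (by omega), z 1 1 (by omega),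
      z 1 2 (by omega), z 1 3 (by omega), z 2 2 (by omega), z 3 3 (by omega)]
    norm_num
    omega
  · have e1 : (f + 3) % 4 = 1 := by omega
    have e2 : (f + 2) % 4 = 0 := by omega
    have e3 : (f + 1) % 4 = 3 := by omega
    rw [h, e1, e2, e3, z 0 0 (by omega), z 0 1 (by omega), z 0 3 (by omega), z 2 2 (by omega),
      z 1 2 (by omega), z 1 3 (by omega), z 2 3 (by omega)]
    norm_num
    omega
  · have e1 : (f + 3) % 4 = 2 := by omega
    have e2 : (f + 2) % 4 = 1 := by omega
    have e3 : (f + 1) % 4 = 0 := by omega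
    rw [h, e1, e2, e3, z 0 0 (by omega), z 0 1 (by omega), z 0 2 (by omega), z 1 1 (by omega),
      z 2 2 (by omega), z 1 3 (by omega), z 2 3 (by omega), z 3 3 (by omega)]
    norm_num
    omega

theorem dot_sound {L n f : ℕ} {q : ℕ[X]}
    (hL : L = (mpoly 255 (2 ^ (2 + 19)) (fun i => i % 2 ^ 2 = 0)).eval 256)
    (hq : Good (2 ^ 21) n q) (hf : 6 ≤ f) :
    dot L n f (Nat.shiftLeft 4294967295 (Nat.mul 8 f)) = (q * q).coeff f * 256 ^ f :=
  dot_core hq (fun _ _ hr hs h => coef_sound hL hq hr hs hf h)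

theorem total_sound {L F : ℕ} (hF : F = 2 ^ 21 - 1)
    (hL : L = (mpoly 255 (2 ^ (2 + 19)) (fun i => i % 2 ^ 2 = 0)).eval 256) (ps : ℕ → ℕ[X]) :
    ∀ (Qs : List ℕ) (m : ℕ), GList (2 ^ 21) ps m Qs → total L F m Qs =
    (∑ x ∈ Finset.Ico m 21, (ps x * ps x).coeff (F - 2 ^ x)) * 256 ^ F := by
  intro Qs
  induction Qs with
  | nil =>
    intro m h
    have h' : m = 21 := h
    subst h'
    simp [total]
  | cons Q Qs ih =>
    intro m h
    have hlen := GList_len _ _ _ _ h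
    rw [List.length_cons] at hlen
    have hm : m < 21 := by omega
    have h20 : 2 ^ m ≤ 2 ^ 20 := Nat.pow_le_pow_right (by norm_num) (by omega)
    rw [Finset.sum_eq_sum_Ico_succ_bot hm, total, ih _ h.2]
    have e := dot_sound (f := F - 2 ^ m) hL h.1 (by omega)
    change _ + Nat.shiftLeft (dot L Q (F - 2 ^ m)
        (Nat.shiftLeft 4294967295 (Nat.mul 8 (F - 2 ^ m)))) (sh m) = _
    rw [e]
    change _ + (_ <<< (8 * 2 ^ m)) = _
    rw [Nat.shiftLeft_eq, ← pow256, mul_assoc, ← pow_add, Nat.sub_add_cancel (by omega), add_mul,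
      add_comm]

theorem pop_compl : ∀ x < 21, pop (2 ^ 21 - 1 - 2 ^ x) = 20 := by
  intro x hx
  interval_cases x <;> simp [pop]

theorem res_sq {q f : ℕ} {p : ℕ[X]} (hp : Supp q p) (hf : f < 2 ^ 21) (hpf : pop f = 2 * q) :
    (res (PP q) p * res (PP q) p).coeff f = (p * p).coeff f := by
  rw [coeff_mul, coeff_mul]
  apply Finset.sum_congr rfl
  rintro ⟨a, b⟩ hab
  rw [Finset.HasAntidiagonal.mem_antidiagonal] at hab
  simp only at hab ⊢
  rw [coeff_res, coeff_res]
  by_cases ha : p.coeff a = 0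
  · simp [ha]
  by_cases hb : p.coeff b = 0
  · simp [hb]
  have h1 := hp a ha
  have h2 := hp b hb
  have h3 := pop_add_le a b
  rw [hab, hpf] at h3
  rw [if_pos ⟨by omega, by omega⟩, if_pos ⟨by omega, by omega⟩]

theorem good_one : GList (2 ^ 21) (fun v => res (PP (2 * 0)) (u 0 0 v)) 0 (List.replicate 21 1) := by
  have h : Good (2 ^ 21) 1 (res (PP (2 * 0)) (1 : ℕ[X])) := by
    have e : res (PP (2 * 0)) (1 : ℕ[X]) = 1 := by
      ext i
      rw [coeff_res, coeff_one]
      by_cases hi : i = 0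
      · subst hi; simp [PP, pop_zero]
      · simp [hi]
    rw [e]
    refine ⟨by simp, ?_, ?_⟩
    · intro i; rw [coeff_one]; split_ifs <;> norm_num
    · intro i hi; rw [coeff_one, if_neg (by omega)]
  simp only [List.replicate, GList]
  simp only [u]
  simp only [h, true_and]

theorem verify_aux {K N F L hi : ℕ} {R : List ℕ} (hF : F = 2 ^ 21 - 1)
    (hL : L = (mpoly 255 (2 ^ (2 + 19)) (fun i => i % 2 ^ 2 = 0)).eval 256)
    (hhi : hi = (mpoly 192 (2 ^ (0 + 22)) (fun i => i % 2 ^ 0 = 0)).eval 256)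
    (hR : RL 21 0 R) (hlen : R.length = 11)
    (h : levels hi K (fun g => Nat.beq (total L F 0 g) (Nat.shiftLeft N (Nat.mul 8 F)))
      R.tail (List.replicate 21 1) = true) :
    ∑ x ∈ Finset.Ico 0 21, (u K 5 x * u K 5 x).coeff (F - 2 ^ x) = N := by
  have hb : ∀ i < 2 ^ 22, byte hi i = 192 := by
    intro i hi'
    rw [hhi, mask_mpoly 192 (2 ^ (0 + 22)) (by norm_num) _ i, if_pos]
    exact ⟨by simpa using hi', by rw [pow_zero]; exact Nat.mod_one i⟩
  have h0 : GList (2 ^ 21) (fun v => res (PP (2 * 0)) (u K 0 v)) 0 (List.replicate 21 1) := good_one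
  obtain ⟨g, hg1, hg2⟩ := levels_sound (K := K) rfl hb _ 5 0 R.tail _
    (by rw [List.length_tail, hlen]) (RL_tail _ _ _ hR) h0 h
  have h1 := Nat.eq_of_beq_eq_true hg1
  rw [total_sound hF hL _ g 0 hg2] at h1
  change _ = N <<< (8 * F) at h1
  rw [Nat.shiftLeft_eq, ← pow256] at h1
  have h2 := Nat.eq_of_mul_eq_mul_right (by positivity) h1
  rw [← h2]
  apply Finset.sum_congr rfl
  intro x hx
  rw [Finset.mem_Ico] at hx
  symm
  apply res_sq (supp_u K 5 x)
  · exact lt_of_le_of_lt (Nat.sub_le _ _) (by omega)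
  · rw [hF]; exact pop_compl x hx.2

theorem verify_sound {K N : ℕ} (h : verify K N = true) :
    ∃ F, F = 2 ^ 21 - 1 ∧
      ∑ x ∈ Finset.Ico 0 21, (u K 5 x * u K 5 x).coeff (F - 2 ^ x) = N := by
  unfold verify at h
  have hF : 2097151 = 2 ^ 21 - 1 := by norm_num
  refine ⟨2097151, hF, ?_⟩
  exact verify_aux hF (rep_sound 255 2 19) (rep_sound 192 0 22) (rows_sound 21)
    (length_rows 21) h

/-! ### Meeting in the middle -/

noncomputable def TT (K i j : ℕ) : ℕ[X] :=
  ∑ m ∈ Finset.Ico 0 21, X ^ (2 ^ m) * u K i m * u K j m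

theorem TT_step {K : ℕ} (hK : 20 ≤ K) (i j : ℕ) : TT K (i + 1) j = TT K i (j + 1) := by
  unfold TT
  simp only [u, tr, Finset.mul_sum, Finset.sum_mul]
  rw [Finset.sum_comm]
  apply Finset.sum_congr rfl
  intro x hx
  apply Finset.sum_congr rfl
  intro m hm
  rw [Finset.mem_Ico] at hx hm
  by_cases h : x ≤ K - m ∧ K - m - x ≤ 20
  · have h' : m ≤ K - x ∧ K - x - m ≤ 20 := by omega
    have e : K - m - x = K - x - m := by omega
    rw [if_pos h, if_pos h', e]
    ring
  · have h' : ¬ (m ≤ K - x ∧ K - x - m ≤ 20) := by omega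
    rw [if_neg h, if_neg h', mul_zero, mul_zero, zero_mul]

theorem TT_zero {K : ℕ} (hK : 20 ≤ K) : TT K 5 5 = TT K 0 10 := by
  rw [TT_step hK 4 5, TT_step hK 3 6, TT_step hK 2 7, TT_step hK 1 8, TT_step hK 0 9]

theorem mitm {K F : ℕ} (hK : 20 ≤ K) (hF : F = 2 ^ 21 - 1) :
    ∑ x ∈ Finset.Ico 0 21, (u K 5 x * u K 5 x).coeff (F - 2 ^ x) =
    (∑ x ∈ Finset.Ico 0 21, X ^ (2 ^ x) * u K 10 x).coeff F := by
  have h : (TT K 5 5).coeff F = (TT K 0 10).coeff F := by rw [TT_zero hK]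
  unfold TT at h
  simp only [u.eq_1, mul_one] at h
  rw [← h, finsetSum_coeff]
  apply Finset.sum_congr rfl
  intro x hx
  rw [Finset.mem_Ico] at hx
  have h20 : 2 ^ x ≤ 2 ^ 20 := Nat.pow_le_pow_right (by norm_num) (by omega)
  rw [mul_assoc, coeff_X_pow_mul', if_pos (by omega)]

/-! ### Walks -/

/-- all edge weights of the (zero-based) labeling `f` are `K` -/
def Magic {α : Type} (val : α → ℕ) (K n : ℕ) (f : Fin (2 * n + 1) → α) : Prop :=
  ∀ i : Fin n, val (f ⟨2 * i.1, by have := i.isLt; omega⟩) +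
    val (f ⟨2 * i.1 + 1, by have := i.isLt; omega⟩) +
    val (f ⟨2 * i.1 + 2, by have := i.isLt; omega⟩) = K

open Classical in
noncomputable def WW (K n v : ℕ) : ℕ[X] :=
  ∑ f : Fin (2 * n + 1) → Fin 21,
    if (f 0).val = v ∧ Magic Fin.val K n f then X ^ (∑ i, 2 ^ (f i).val) else 0

theorem magic_cons (K n : ℕ) (a e : Fin 21) (f : Fin (2 * n + 1) → Fin 21) :
    Magic Fin.val K (n + 1) (Fin.cons a (Fin.cons e f : Fin (2 * n + 1 + 1) → Fin 21) :
      Fin (2 * n + 1 + 1 + 1) → Fin 21) ↔ a.val + e.val + (f 0).val = K ∧ Magic Fin.val K n f := by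
  constructor
  · intro h
    refine ⟨h ⟨0, Nat.succ_pos n⟩, fun i => ?_⟩
    exact h ⟨i.1 + 1, by have := i.isLt; omega⟩
  · rintro ⟨h0, h⟩ ⟨i, hi⟩
    cases i with
    | zero => exact h0
    | succ i => exact h ⟨i, by omega⟩

theorem sum_cons {M : Type} [AddCommMonoid M] (N : ℕ) (g : (Fin (N + 1) → Fin 21) → M) :
    ∑ f, g f = ∑ a : Fin 21, ∑ f : Fin N → Fin 21, g (Fin.cons a f) := by
  rw [← Fintype.sum_prod_type']
  exact (Fintype.sum_equiv (Fin.consEquiv (fun _ => Fin 21)) _ _ (fun _ => rfl)).symm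

theorem WW_zero (K v : ℕ) (hv : v < 21) : WW K 0 v = X ^ (2 ^ v) * u K 0 v := by
  unfold WW
  rw [Finset.sum_eq_single (fun _ => (⟨v, hv⟩ : Fin 21))]
  · rw [if_pos ⟨rfl, fun i => i.elim0⟩, u.eq_1, mul_one]
    simp
  · intro f _ hf
    rw [if_neg]
    rintro ⟨h, _⟩
    apply hf
    funext i
    have : i = 0 := Subsingleton.elim (α := Fin 1) _ _
    subst this
    exact Fin.ext h
  · intro h; exact absurd (Finset.mem_univ _) h

open Classical in
theorem WW_succ (K n v : ℕ) :
    WW K (n + 1) v = ∑ a : Fin 21, ∑ e : Fin 21, ∑ f : Fin (2 * n + 1) → Fin 21,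
        if a.val = v ∧ a.val + e.val + (f 0).val = K ∧ Magic Fin.val K n f then
          X ^ (2 ^ a.val) * (X ^ (2 ^ e.val) * X ^ (∑ i, 2 ^ (f i).val)) else 0 := by
  unfold WW
  refine (sum_cons (2 * n + 1 + 1) _).trans ?_
  apply Finset.sum_congr rfl
  intro a _
  refine (sum_cons (2 * n + 1) _).trans ?_
  apply Finset.sum_congr rfl
  intro e _
  apply Finset.sum_congr rfl
  intro f _
  apply if_congr
  · exact and_congr Iff.rfl (magic_cons K n a e f)
  · rw [← pow_add, ← pow_add]
    congr 1
    refine (Fin.sum_univ_succ (n := 2 * n + 1 + 1) _).trans ?_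
    congr 1
    exact (Fin.sum_univ_succ (n := 2 * n + 1) _)
  · rfl

open Classical in
theorem WW_row (K n v : ℕ) (e : Fin 21) :
    (∑ f : Fin (2 * n + 1) → Fin 21,
        if v + e.val + (f 0).val = K ∧ Magic Fin.val K n f then
          X ^ (2 ^ v) * (X ^ (2 ^ e.val) * X ^ (∑ i, 2 ^ (f i).val)) else 0) =
        ∑ x ∈ Finset.Ico 0 21, if v + e.val + x = K then
          X ^ (2 ^ v) * (X ^ (2 ^ e.val) * WW K n x) else (0 : ℕ[X]) := by
  unfold WW
  simp only [Finset.mul_sum]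
  have : ∀ x, (if v + e.val + x = K then ∑ f : Fin (2 * n + 1) → Fin 21,
      X ^ (2 ^ v) * (X ^ (2 ^ e.val) * (if (f 0).val = x ∧ Magic Fin.val K n f then
        X ^ (∑ i, 2 ^ (f i).val) else 0)) else (0 : ℕ[X])) =
      ∑ f : Fin (2 * n + 1) → Fin 21, if v + e.val + x = K then
      X ^ (2 ^ v) * (X ^ (2 ^ e.val) * (if (f 0).val = x ∧ Magic Fin.val K n f then
        X ^ (∑ i, 2 ^ (f i).val) else 0)) else (0 : ℕ[X]) := by
    intro x; split_ifs
    · rfl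
    · simp
  simp only [this]
  rw [Finset.sum_comm]
  apply Finset.sum_congr rfl
  intro f _
  rw [Finset.sum_eq_single (f 0).val]
  · by_cases ha : v + e.val + (f 0).val = K
    · by_cases hb : Magic Fin.val K n f
      · simp [ha, hb]
      · simp [hb]
    · simp [ha]
  · intro b _ hb
    have : ¬ ((f 0).val = b ∧ Magic Fin.val K n f) := fun h => hb h.1.symm
    rw [if_neg this]; simp
  · intro h
    exact absurd (Finset.mem_Ico.mpr ⟨Nat.zero_le _, (f 0).isLt⟩) h

open Classical in
theorem WW_succ_single (K n v : ℕ) (hv : v < 21) :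
    WW K (n + 1) v = ∑ e : Fin 21, ∑ f : Fin (2 * n + 1) → Fin 21,
        if v + e.val + (f 0).val = K ∧ Magic Fin.val K n f then
          X ^ (2 ^ v) * (X ^ (2 ^ e.val) * X ^ (∑ i, 2 ^ (f i).val)) else 0 := by
  refine (WW_succ K n v).trans ?_
  refine (Finset.sum_eq_single_of_mem (⟨v, hv⟩ : Fin 21) (Finset.mem_univ _) ?_).trans ?_
  · intro a _ ha
    apply Finset.sum_eq_zero; intro e _
    apply Finset.sum_eq_zero; intro f _
    rw [if_neg]
    rintro ⟨h, _⟩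
    exact ha (Fin.ext h)
  · apply Finset.sum_congr rfl
    intro e _
    apply Finset.sum_congr rfl
    intro f _
    exact if_congr ⟨fun h => h.2, fun h => ⟨rfl, h⟩⟩ rfl rfl

theorem WW_tail (K v : ℕ) (hK : 20 ≤ K) (hv : v < 21) (W U : ℕ → ℕ[X]) (P : ℕ[X])
    (ih : ∀ x, x < 21 → W x = X ^ (2 ^ x) * U x) :
    (∑ e : Fin 21, ∑ x ∈ Finset.Ico 0 21, if v + e.val + x = K then
          P * (X ^ (2 ^ e.val) * W x) else (0 : ℕ[X])) =
    P * ∑ x ∈ Finset.Ico 0 21, if x ≤ K - v ∧ K - v - x ≤ 20 then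
      X ^ (2 ^ (K - v - x)) * (X ^ (2 ^ x) * U x) else 0 := by
  rw [Finset.sum_comm, Finset.mul_sum]
  apply Finset.sum_congr rfl
  intro x hx
  rw [Finset.mem_Ico] at hx
  by_cases hc : x ≤ K - v ∧ K - v - x ≤ 20
  · rw [if_pos hc]
    refine (Finset.sum_eq_single_of_mem (⟨K - v - x, by omega⟩ : Fin 21)
      (Finset.mem_univ _) ?_).trans ?_
    · intro b _ hb
      rw [if_neg]
      intro h
      apply hb
      apply Fin.ext
      simp only
      omega
    · rw [ih x hx.2]
      refine if_pos ?_
      simp only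
      omega
  · rw [if_neg hc, mul_zero]
    apply Finset.sum_eq_zero
    intro e _
    rw [if_neg]
    have := e.isLt
    omega

theorem WW_step1 (K n v : ℕ) (hv : v < 21) :
    WW K (n + 1) v = ∑ e : Fin 21, ∑ x ∈ Finset.Ico 0 21, if v + e.val + x = K then
          X ^ (2 ^ v) * (X ^ (2 ^ e.val) * WW K n x) else (0 : ℕ[X]) :=
  (WW_succ_single K n v hv).trans (Finset.sum_congr rfl (fun e _ => WW_row K n v e))

theorem WW_step2 (K n v : ℕ) : (∑ x ∈ Finset.Ico 0 21, if x ≤ K - v ∧ K - v - x ≤ 20 then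
      X ^ (2 ^ (K - v - x)) * (X ^ (2 ^ x) * u K n x) else 0) = u K (n + 1) v := by
  rw [u.eq_2, tr]

theorem WW_eq {K : ℕ} (hK : 20 ≤ K) : ∀ n v, v < 21 → WW K n v = X ^ (2 ^ v) * u K n v := by
  intro n
  induction n with
  | zero => exact WW_zero K
  | succ n ih =>
    intro v hv
    rw [WW_step1 K n v hv, ← WW_step2 K n v]
    exact WW_tail K v hK hv (WW K n) (u K n) (X ^ (2 ^ v)) ih

theorem inj_of_sum (f : Fin 21 → Fin 21) (h : ∑ i, 2 ^ (f i).val = 2 ^ 21 - 1) :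
    Function.Injective f := by
  classical
  intro a b hab
  by_contra hne
  have h1 : ∑ i, 2 ^ (f i).val = ∑ i ∈ Finset.univ.erase b,
      2 ^ (if i = a then (f i).val + 1 else (f i).val) := by
    rw [← Finset.add_sum_erase Finset.univ _ (Finset.mem_univ b)]
    have ha : a ∈ Finset.univ.erase b := Finset.mem_erase.mpr ⟨hne, Finset.mem_univ _⟩
    rw [← Finset.add_sum_erase _ _ ha, ← Finset.add_sum_erase _ _ ha, if_pos rfl, ← hab]
    have h2 : ∑ i ∈ (Finset.univ.erase b).erase a, 2 ^ (f i).val =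
        ∑ i ∈ (Finset.univ.erase b).erase a, 2 ^ (if i = a then (f i).val + 1 else (f i).val) := by
      apply Finset.sum_congr rfl
      intro i hi
      rw [if_neg (Finset.mem_erase.mp hi).1]
    rw [h2, pow_succ]
    ring
  have h2 := pop_sum_le (Finset.univ.erase b)
    (fun i => if i = a then (f i).val + 1 else (f i).val)
  rw [← h1, h, Finset.card_erase_of_mem (Finset.mem_univ _)] at h2
  have h3 : pop (2 ^ 21 - 1) = 21 := by simp [pop]
  rw [h3] at h2
  simp at h2

theorem sum_of_perm (σ : Equiv.Perm (Fin 21)) : ∑ i, 2 ^ (σ i).val = 2 ^ 21 - 1 := by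
  rw [Equiv.sum_comp σ (fun i => 2 ^ i.val)]
  decide +kernel

set_option linter.constructorNameAsVariable false in
open Classical in
theorem count_of_verify {K N : ℕ} (hK : 20 ≤ K) (h : verify K N = true) :
    (Finset.univ.filter (fun σ : Equiv.Perm (Fin 21) => Magic (n := 10) Fin.val K σ)).card = N := by
  obtain ⟨F, hF, h1⟩ := verify_sound h
  rw [mitm hK hF] at h1
  rw [← h1]
  have h2 : ∑ x ∈ Finset.Ico 0 21, X ^ (2 ^ x) * u K 10 x =
      ∑ f : Fin 21 → Fin 21, if Magic (n := 10) Fin.val K f then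
        (X : ℕ[X]) ^ (∑ i, 2 ^ (f i).val) else 0 := by
    have : ∀ x ∈ Finset.Ico 0 21, X ^ (2 ^ x) * u K 10 x = WW K 10 x := by
      intro x hx
      rw [Finset.mem_Ico] at hx
      rw [WW_eq hK 10 x hx.2]
    rw [Finset.sum_congr rfl this]
    unfold WW
    rw [Finset.sum_comm]
    apply Finset.sum_congr rfl
    intro f _
    rw [Finset.sum_eq_single (f 0).val]
    · by_cases hb : Magic (n := 10) Fin.val K f
      · rw [if_pos ⟨rfl, hb⟩, if_pos hb]
      · rw [if_neg (fun hh => hb hh.2), if_neg hb]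
    · intro b _ hb
      rw [if_neg (fun hh => hb hh.1.symm)]
    · intro hh
      exact absurd (Finset.mem_Ico.mpr ⟨Nat.zero_le _, (f 0).isLt⟩) hh
  rw [h2, finsetSum_coeff]
  have h3 : ∀ f : Fin 21 → Fin 21, (if Magic (n := 10) Fin.val K f then
        (X : ℕ[X]) ^ (∑ i, 2 ^ (f i).val) else 0).coeff F =
        if Magic (n := 10) Fin.val K f ∧ ∑ i, 2 ^ (f i).val = F then 1 else 0 := by
    intro f
    by_cases hb : Magic (n := 10) Fin.val K f
    · rw [if_pos hb, coeff_X_pow]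
      by_cases hc : F = ∑ i, 2 ^ (f i).val
      · rw [if_pos hc, if_pos ⟨hb, hc.symm⟩]
      · rw [if_neg hc, if_neg (fun hh => hc hh.2.symm)]
    · rw [if_neg hb, if_neg (fun hh => hb hh.1), coeff_zero]
  rw [Finset.sum_congr rfl (fun f _ => h3 f), ← Finset.card_filter]
  apply Finset.card_bij (fun (σ : Equiv.Perm (Fin 21)) _ => (σ : Fin 21 → Fin 21))
  · intro σ hσ
    simp only [Finset.mem_filter, Finset.mem_univ, true_and] at hσ ⊢
    have e := sum_of_perm σ
    rw [← hF] at e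
    exact ⟨hσ, e⟩
  · intro σ _ τ _ hh
    exact DFunLike.coe_injective hh
  · intro f hf
    simp only [Finset.mem_filter, Finset.mem_univ, true_and] at hf
    have e := hf.2
    rw [hF] at e
    have hinj := inj_of_sum f e
    refine ⟨Equiv.ofBijective f (Finite.injective_iff_bijective.mp hinj), ?_, rfl⟩
    simp only [Finset.mem_filter, Finset.mem_univ, true_and]
    exact hf.1

/-! ### Symmetries and the final count -/

theorem magic_rev {K : ℕ} {σ : Equiv.Perm (Fin 21)} (h : Magic (n := 10) Fin.val K σ) :
    Magic (n := 10) Fin.val K (Fin.revPerm.trans σ : Equiv.Perm (Fin 21)) := by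
  intro i
  have hi := i.isLt
  have h1 := h ⟨9 - i.1, by omega⟩
  have e0 : (Fin.revPerm.trans σ : Equiv.Perm (Fin 21)) ⟨2 * i.1, by omega⟩ =
      σ ⟨2 * (9 - i.1) + 2, by omega⟩ := by
    rw [Equiv.trans_apply, Fin.revPerm_apply]
    congr 1
    apply Fin.ext
    rw [Fin.val_rev]
    simp only
    omega
  have e1 : (Fin.revPerm.trans σ : Equiv.Perm (Fin 21)) ⟨2 * i.1 + 1, by omega⟩ =
      σ ⟨2 * (9 - i.1) + 1, by omega⟩ := by
    rw [Equiv.trans_apply, Fin.revPerm_apply]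
    congr 1
    apply Fin.ext
    rw [Fin.val_rev]
    simp only
    omega
  have e2 : (Fin.revPerm.trans σ : Equiv.Perm (Fin 21)) ⟨2 * i.1 + 2, by omega⟩ =
      σ ⟨2 * (9 - i.1), by omega⟩ := by
    rw [Equiv.trans_apply, Fin.revPerm_apply]
    congr 1
    apply Fin.ext
    rw [Fin.val_rev]
    simp only
    omega
  refine (congrArg₂ (· + ·) (congrArg₂ (· + ·) (congrArg Fin.val e0) (congrArg Fin.val e1))
    (congrArg Fin.val e2)).trans ?_
  have h2 : (σ ⟨2 * (9 - i.1), by omega⟩).val + (σ ⟨2 * (9 - i.1) + 1, by omega⟩).val +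
    (σ ⟨2 * (9 - i.1) + 2, by omega⟩).val = K := h1
  omega

theorem magic_le {K : ℕ} {σ : Equiv.Perm (Fin 21)} (h : Magic (n := 10) Fin.val K σ) :
    K ≤ 60 := by
  have h0 : (σ 0).val + (σ 1).val + (σ 2).val = K := h ⟨0, by norm_num⟩
  have := (σ 0).isLt
  have := (σ 1).isLt
  have := (σ 2).isLt
  omega

theorem magic_dual {K : ℕ} {σ : Equiv.Perm (Fin 21)} (h : Magic (n := 10) Fin.val K σ) :
    Magic (n := 10) Fin.val (60 - K) (σ.trans Fin.revPerm : Equiv.Perm (Fin 21)) := by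
  intro i
  have hi := i.isLt
  have e : ∀ x : Fin 21, ((σ.trans Fin.revPerm : Equiv.Perm (Fin 21)) x).val = 20 - (σ x).val := by
    intro x
    rw [Equiv.trans_apply, Fin.revPerm_apply, Fin.val_rev]
    omega
  have h1 : (σ ⟨2 * i.1, by omega⟩).val + (σ ⟨2 * i.1 + 1, by omega⟩).val +
    (σ ⟨2 * i.1 + 2, by omega⟩).val = K := h i
  refine (congrArg₂ (· + ·) (congrArg₂ (· + ·) (e _) (e _)) (e _)).trans ?_
  have a0 := (σ ⟨2 * i.1, by omega⟩).isLt
  have a1 := (σ ⟨2 * i.1 + 1, by omega⟩).isLt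
  have a2 := (σ ⟨2 * i.1 + 2, by omega⟩).isLt
  omega

theorem sum21 (g : Fin 21 → ℕ) : ∑ i, g i = g 0 + g 1 + g 2 + g 3 + g 4 + g 5 + g 6 + g 7 + g 8 +
    g 9 + g 10 + g 11 + g 12 + g 13 + g 14 + g 15 + g 16 + g 17 + g 18 + g 19 + g 20 := by
  rw [Fin.sum_univ_castSucc, Fin.sum_univ_castSucc, Fin.sum_univ_castSucc, Fin.sum_univ_castSucc,
    Fin.sum_univ_castSucc, Fin.sum_univ_castSucc, Fin.sum_univ_castSucc, Fin.sum_univ_castSucc,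
    Fin.sum_univ_castSucc, Fin.sum_univ_castSucc, Fin.sum_univ_castSucc, Fin.sum_univ_castSucc,
    Fin.sum_univ_castSucc, Fin.sum_univ_eight]
  rfl

theorem magic_ge {K : ℕ} {σ : Equiv.Perm (Fin 21)} (h : Magic (n := 10) Fin.val K σ) :
    25 ≤ K := by
  by_contra hK25
  have hK : K ≤ 24 := by omega
  clear hK25
  have s1 : ∑ i, (σ i).val = 210 := by
    rw [Equiv.sum_comp σ (fun i => i.val)]
    decide +kernel
  have s2 : ∑ i, (8 - (σ i).val) = 36 := by
    rw [Equiv.sum_comp σ (fun i => 8 - i.val)]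
    decide +kernel
  have h0 : (σ 0).val + (σ 1).val + (σ 2).val = K := h ⟨0, by norm_num⟩
  have h1 : (σ 2).val + (σ 3).val + (σ 4).val = K := h ⟨1, by norm_num⟩
  have h2 : (σ 4).val + (σ 5).val + (σ 6).val = K := h ⟨2, by norm_num⟩
  have h3 : (σ 6).val + (σ 7).val + (σ 8).val = K := h ⟨3, by norm_num⟩
  have h4 : (σ 8).val + (σ 9).val + (σ 10).val = K := h ⟨4, by norm_num⟩
  have h5 : (σ 10).val + (σ 11).val + (σ 12).val = K := h ⟨5, by norm_num⟩
  have h6 : (σ 12).val + (σ 13).val + (σ 14).val = K := h ⟨6, by norm_num⟩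
  have h7 : (σ 14).val + (σ 15).val + (σ 16).val = K := h ⟨7, by norm_num⟩
  have h8 : (σ 16).val + (σ 17).val + (σ 18).val = K := h ⟨8, by norm_num⟩
  have h9 : (σ 18).val + (σ 19).val + (σ 20).val = K := h ⟨9, by norm_num⟩
  obtain ⟨t, ht⟩ : ∃ t : Fin 21 → ℕ, ∀ i, t i = 8 - (σ i).val := ⟨_, fun _ => rfl⟩
  simp only [← ht] at s2
  have hs : ∀ i, 8 ≤ (σ i).val + t i := by intro i; rw [ht]; omega
  have q1 := hs 2
  have q2 := hs 4
  have q3 := hs 6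
  have q4 := hs 8
  have q5 := hs 10
  have q6 := hs 12
  have q7 := hs 14
  have q8 := hs 16
  have q9 := hs 18
  clear ht hs
  rw [sum21] at s1 s2
  clear h
  linarith

open Classical in
/-- number of labelings with (zero-based) magic sum `K` -/
noncomputable def NN (K : ℕ) : ℕ :=
  (Finset.univ.filter (fun σ : Equiv.Perm (Fin 21) => Magic (n := 10) Fin.val K σ)).card

theorem trans_rev_rev (σ : Equiv.Perm (Fin 21)) :
    ((σ.trans Fin.revPerm : Equiv.Perm (Fin 21)).trans Fin.revPerm : Equiv.Perm (Fin 21)) = σ := by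
  ext x
  simp

theorem rev_trans_rev (σ : Equiv.Perm (Fin 21)) :
    (Fin.revPerm.trans (Fin.revPerm.trans σ : Equiv.Perm (Fin 21)) : Equiv.Perm (Fin 21)) = σ := by
  ext x
  simp

theorem NN_dual {K J : ℕ} (h : K + J = 60) : NN K = NN J := by
  classical
  have hJ : J = 60 - K := by omega
  have hK : K = 60 - J := by omega
  unfold NN
  apply Finset.card_bij' (fun (σ : Equiv.Perm (Fin 21)) _ => (σ.trans Fin.revPerm : Equiv.Perm (Fin 21)))
    (fun (σ : Equiv.Perm (Fin 21)) _ => (σ.trans Fin.revPerm : Equiv.Perm (Fin 21)))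
  · intro σ hσ
    simp only [Finset.mem_filter, Finset.mem_univ, true_and] at hσ ⊢
    rw [hJ]; exact magic_dual hσ
  · intro σ hσ
    simp only [Finset.mem_filter, Finset.mem_univ, true_and] at hσ ⊢
    rw [hK]; exact magic_dual hσ
  · intro σ _; exact trans_rev_rev σ
  · intro σ _; exact trans_rev_rev σ

theorem magic_unique {K J : ℕ} {σ : Equiv.Perm (Fin 21)} (h : Magic (n := 10) Fin.val K σ)
    (h' : Magic (n := 10) Fin.val J σ) : K = J := by
  have h0 : (σ 0).val + (σ 1).val + (σ 2).val = K := h ⟨0, by norm_num⟩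
  have h1 : (σ 0).val + (σ 1).val + (σ 2).val = J := h' ⟨0, by norm_num⟩
  omega

open Classical in
theorem card_all : (Finset.univ.filter (fun σ : Equiv.Perm (Fin 21) =>
    ∃ K, Magic (n := 10) Fin.val K σ)).card = ∑ K ∈ Finset.Icc 25 35, NN K := by
  unfold NN
  rw [← Finset.card_biUnion]
  · congr 1
    ext σ
    simp only [Finset.mem_filter, Finset.mem_univ, true_and, Finset.mem_biUnion, Finset.mem_Icc]
    constructor
    · rintro ⟨K, hK⟩
      refine ⟨K, ⟨magic_ge hK, ?_⟩, hK⟩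
      have h1 := magic_ge (magic_dual hK)
      have h2 := magic_le hK
      omega
    · rintro ⟨K, _, hK⟩
      exact ⟨K, hK⟩
  · intro K _ J _ hne
    change Disjoint _ _
    rw [Finset.disjoint_left]
    intro σ h1 h2
    simp only [Finset.mem_filter, Finset.mem_univ, true_and] at h1 h2
    exact hne (magic_unique h1 h2)

open Classical in
theorem card_half : (Finset.univ.filter (fun σ : Equiv.Perm (Fin 21) =>
    ∃ K, Magic (n := 10) Fin.val K σ)).card =
    2 * (Finset.univ.filter (fun σ : Equiv.Perm (Fin 21) =>
    (∃ K, Magic (n := 10) Fin.val K σ) ∧ (σ 0).val < (σ 20).val)).card := by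
  have h1 : (Finset.univ.filter (fun σ : Equiv.Perm (Fin 21) =>
      (∃ K, Magic (n := 10) Fin.val K σ) ∧ ¬ (σ 0).val < (σ 20).val)).card =
      (Finset.univ.filter (fun σ : Equiv.Perm (Fin 21) =>
      (∃ K, Magic (n := 10) Fin.val K σ) ∧ (σ 0).val < (σ 20).val)).card := by
    have r0 : ∀ σ : Equiv.Perm (Fin 21), (Fin.revPerm.trans σ : Equiv.Perm (Fin 21)) 0 = σ 20 := by
      intro σ; rfl
    have r1 : ∀ σ : Equiv.Perm (Fin 21), (Fin.revPerm.trans σ : Equiv.Perm (Fin 21)) 20 = σ 0 := by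
      intro σ; rfl
    apply Finset.card_bij'
      (fun (σ : Equiv.Perm (Fin 21)) _ => (Fin.revPerm.trans σ : Equiv.Perm (Fin 21)))
      (fun (σ : Equiv.Perm (Fin 21)) _ => (Fin.revPerm.trans σ : Equiv.Perm (Fin 21)))
    · intro σ hσ
      simp only [Finset.mem_filter, Finset.mem_univ, true_and] at hσ ⊢
      obtain ⟨⟨K, hK⟩, hlt⟩ := hσ
      refine ⟨⟨K, magic_rev hK⟩, ?_⟩
      rw [r0, r1]
      have hne : (σ 0).val ≠ (σ 20).val := by
        intro hh
        have := σ.injective (Fin.ext hh)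
        exact absurd this (by decide)
      omega
    · intro σ hσ
      simp only [Finset.mem_filter, Finset.mem_univ, true_and] at hσ ⊢
      obtain ⟨⟨K, hK⟩, hlt⟩ := hσ
      refine ⟨⟨K, magic_rev hK⟩, ?_⟩
      rw [r0, r1]
      omega
    · intro σ _; exact rev_trans_rev σ
    · intro σ _; exact rev_trans_rev σ
  rw [← Finset.card_filter_add_card_filter_not (fun σ : Equiv.Perm (Fin 21) =>
    (σ 0).val < (σ 20).val), Finset.filter_filter, Finset.filter_filter, h1]
  omega

theorem values (h25 : NN 25 = 6304) (h26 : NN 26 = 38672) (h27 : NN 27 = 107184)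
    (h28 : NN 28 = 185704) (h29 : NN 29 = 290160) (h30 : NN 30 = 245968) :
    ∑ K ∈ Finset.Icc 25 35, NN K = 2 * 751008 := by
  have e : Finset.Icc 25 35 = {25, 26, 27, 28, 29, 30, 31, 32, 33, 34, 35} := by decide
  rw [e]
  simp only [Finset.sum_insert, Finset.mem_insert, Finset.mem_singleton, Finset.sum_singleton,
    Nat.reduceEqDiff, or_self, not_false_eq_true]
  rw [NN_dual (show 31 + 29 = 60 by norm_num), NN_dual (show 32 + 28 = 60 by norm_num),
    NN_dual (show 33 + 27 = 60 by norm_num), NN_dual (show 34 + 26 = 60 by norm_num),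
    NN_dual (show 35 + 25 = 60 by norm_num), h25, h26, h27, h28, h29, h30]
  norm_num

/-- the kernel computation -/
theorem computation : verify 25 6304 = true ∧ verify 26 38672 = true ∧ verify 27 107184 = true ∧
    verify 28 185704 = true ∧ verify 29 290160 = true ∧ verify 30 245968 = true :=
  ⟨by decide +kernel, by decide +kernel, by decide +kernel, by decide +kernel, by decide +kernel,
    by decide +kernel⟩

end EMTL

/-- The number of edge-magic total labelings of the path `P 10`, counted up to the
reversal symmetry of the path, is `751008`. -/
theorem pathEMTLCountUpToRev_P10 : pathEMTLCountUpToRev 10 = 751008 := by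
  classical
  have h1 : pathEMTLCountUpToRev 10 = (Finset.univ.filter (fun σ : Equiv.Perm (Fin 21) =>
      (∃ K, EMTL.Magic (n := 10) Fin.val K σ) ∧ (σ 0).val < (σ 20).val)).card := by
    unfold pathEMTLCountUpToRev
    refine Finset.card_bij (fun (σ : Equiv.Perm (Fin 21)) _ => σ) ?_ ?_ ?_
    · intro σ hσ
      simp only [Finset.mem_filter, Finset.mem_univ, true_and] at hσ ⊢
      obtain ⟨⟨k, hk⟩, hlt⟩ := hσ
      refine ⟨⟨k - 3, fun i => ?_⟩, hlt⟩
      have := hk i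
      omega
    · intro σ _ τ _ hh; exact hh
    · intro σ hσ
      refine ⟨σ, ?_, rfl⟩
      simp only [Finset.mem_filter, Finset.mem_univ, true_and] at hσ ⊢
      obtain ⟨⟨k, hk⟩, hlt⟩ := hσ
      refine ⟨⟨k + 3, fun i => ?_⟩, hlt⟩
      have := hk i
      omega
  obtain ⟨v25, v26, v27, v28, v29, v30⟩ := EMTL.computation
  have h2 := EMTL.values (EMTL.count_of_verify (by norm_num) v25)
    (EMTL.count_of_verify (by norm_num) v26) (EMTL.count_of_verify (by norm_num) v27)
    (EMTL.count_of_verify (by norm_num) v28) (EMTL.count_of_verify (by norm_num) v29)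
    (EMTL.count_of_verify (by norm_num) v30)
  rw [← EMTL.card_all, EMTL.card_half, ← h1] at h2
  exact Nat.eq_of_mul_eq_mul_left (by norm_num) h2
end

section
/- The number of edge-magic total labelings of the path P_11 (the path with 12 vertices and 11 edges), counted up to the reversal symmetry of the path, is 5222768. -/
namespace PEM
set_option linter.unusedVariables false

inductive Opt (α : Type) where | none | some (a : α)
inductive Nd (α : Type) where | L (l : α) | R (r : α) | B (l r : α)
section Programs
open Nd

/-- strict program builders -/
noncomputable def bPass {α β : Type} (f : α → Opt α) (k : (Nd α → Opt (Nd α)) → β) : β :=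
  k (Nd.rec (motive := fun _ => Opt (Nd α))
    (fun l => Opt.rec (motive := fun _ => Opt (Nd α)) Opt.none (fun l' => Opt.some (L l')) (f l))
    (fun r => Opt.rec (motive := fun _ => Opt (Nd α)) Opt.none (fun r' => Opt.some (R r')) (f r))
    (fun l r => Opt.rec (motive := fun _ => Opt α → Opt (Nd α))
       (fun y => Opt.rec (motive := fun _ => Opt (Nd α)) Opt.none (fun r' => Opt.some (R r')) y)
       (fun l' y => Opt.rec (motive := fun _ => Opt (Nd α)) (Opt.some (L l')) (fun r' => Opt.some (B l' r')) y) (f l) (f r)))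
noncomputable def bTake {α β : Type} (f : α → Opt α) (k : (Nd α → Opt (Nd α)) → β) : β :=
  k (Nd.rec (motive := fun _ => Opt (Nd α))
    (fun l => Opt.rec (motive := fun _ => Opt (Nd α)) Opt.none (fun l' => Opt.some (R l')) (f l))
    (fun _ => Opt.none)
    (fun l _ => Opt.rec (motive := fun _ => Opt (Nd α)) Opt.none (fun l' => Opt.some (R l')) (f l)))
noncomputable def bAdd {α β : Type} (g : α → α → α) (k : (Nd α → Nd α → Nd α) → β) : β :=
  k (Nd.rec (motive := fun _ => Nd α → Nd α)
    (fun l t => Nd.rec (motive := fun _ => Nd α) (fun l' => L (g l l')) (fun r' => B l r') (fun l' r' => B (g l l') r') t)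
    (fun r t => Nd.rec (motive := fun _ => Nd α) (fun l' => B l' r) (fun r' => R (g r r')) (fun l' r' => B l' (g r r')) t)
    (fun l r t => Nd.rec (motive := fun _ => Nd α) (fun l' => B (g l l') r) (fun r' => B l (g r r')) (fun l' r' => B (g l l') (g r r')) t))
noncomputable def bJoin {α β : Type} (g : α → α → Nat) (k : (Nd α → Nd α → Nat) → β) : β :=
  k (Nd.rec (motive := fun _ => Nd α → Nat)
    (fun l t => Nd.rec (motive := fun _ => Nat) (fun _ => 0) (fun r' => g l r') (fun _ r' => g l r') t)
    (fun r t => Nd.rec (motive := fun _ => Nat) (fun l' => g r l') (fun _ => 0) (fun l' _ => g r l') t)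
    (fun l r t => Nd.rec (motive := fun _ => Nat) (fun l' => g r l') (fun r' => g l r') (fun l' r' => Nat.add (g l r') (g r l')) t))
noncomputable def bJTake {α β : Type} (g : α → α → Nat) (k : (Nd α → Nd α → Nat) → β) : β :=
  k (Nd.rec (motive := fun _ => Nd α → Nat)
    (fun l t => Nd.rec (motive := fun _ => Nat) (fun l' => g l l') (fun _ => 0) (fun l' _ => g l l') t)
    (fun _ _ => 0)
    (fun l _ t => Nd.rec (motive := fun _ => Nat) (fun l' => g l l') (fun _ => 0) (fun l' _ => g l l') t))
noncomputable def Tr (h : Nat) : Type := Nat.rec (motive := fun _ => Type) Nat (fun _ A => Nd A) h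
noncomputable def low (x : Nat) : Nat := bif Nat.blt x 11 then Nat.pow 2 x else 0
noncomputable def nforce {β : Type} (n : Nat) (k : Nat → β) : β := Nat.rec (motive := fun _ => β) (k 0) (fun m _ => k (Nat.succ m)) n
noncomputable def insB (x y : Nat) {β : Type} (h : Nat) : ((Tr h → Opt (Tr h)) → β) → β :=
  Nat.rec (motive := fun h => ((Tr h → Opt (Tr h)) → β) → β)
   (fun k => nforce (Nat.add (low x) (low y)) fun s => bif Nat.beq s 0 then k (fun t => Opt.some t) else k (fun t : Nat => 
       (fun z => Bool.rec (motive := fun _ => Opt Nat) (Opt.some (Nat.shiftLeft z (Nat.mul 24 s))) Opt.none (Nat.beq z 0)) (Nat.land t (Nat.sub (Nat.pow 2 (Nat.mul 24 (Nat.sub 2048 s))) 1))))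
   (fun h ih k => bif Bool.and (Nat.ble (Nat.add 12 h) x) (Nat.ble (Nat.add 12 h) y) then k (fun t => Opt.some t) else ih (fun f =>
     bif Bool.or (Nat.beq x (Nat.add 11 h)) (Nat.beq y (Nat.add 11 h)) then bTake f k else bPass f k)) h
noncomputable def addB {β : Type} (h : Nat) : ((Tr h → Tr h → Tr h) → β) → β :=
  Nat.rec (motive := fun h => ((Tr h → Tr h → Tr h) → β) → β)
   (fun k => k Nat.add) (fun h ih k => ih (fun f => bAdd f k)) h
noncomputable def joinB (e : Nat) {β : Type} (h : Nat) : ((Tr h → Tr h → Nat) → β) → β :=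
  Nat.rec (motive := fun h => ((Tr h → Tr h → Nat) → β) → β)
   (fun k => nforce (Nat.shiftLeft 16777215 (Nat.mul 24 (Nat.sub 2047 (low e)))) fun M => k (fun (u v : Nat) => Bool.rec (motive := fun _ => Nat) (Nat.mul M M) (Nat.land (Nat.mul u v) M) (Nat.ble (Nat.mul (Nat.mod u 16777215) (Nat.mod v 16777215)) 16777215)))
   (fun h ih k => ih (fun f => bif Nat.beq e (Nat.add 11 h) then bJTake f k else bJoin f k)) h
noncomputable def single (b : Nat) (h : Nat) : Tr h :=
  Nat.rec (motive := Tr) (Nat.shiftLeft 1 (Nat.mul 24 (low b)))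
    (fun h ih => bif Nat.beq b (Nat.add 11 h) then Nd.R ih else Nd.L ih) h
abbrev O := Opt (Tr 12)
noncomputable def forceO {β : Type} (t : O) (k : O → β) : β := Opt.rec (motive := fun _ => β) (k Opt.none) (fun t => 
  Nd.rec (motive := fun _ => β) (fun l => k (Opt.some (Nd.L l))) (fun l => k (Opt.some (Nd.R l))) (fun l r => k (Opt.some (Nd.B l r))) t) t
noncomputable def get (L : List O) (n : Nat) : O :=
  List.rec (motive := fun _ => Nat → O) (fun _ => Opt.none) (fun t _ ih n => bif Nat.beq n 0 then t else ih (Nat.sub n 1)) L n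
noncomputable def ok (k x y : Nat) : Bool :=
  Bool.and (Nat.ble (Nat.add x y) k) (Bool.and (Nat.ble (Nat.sub k (Nat.add x y)) 22)
   (Bool.and (Bool.not (Nat.beq x y)) (Bool.and (Bool.not (Nat.beq x (Nat.sub k (Nat.add x y)))) (Bool.not (Nat.beq y (Nat.sub k (Nat.add x y)))))))
noncomputable def addO (g : Tr 12 → Tr 12 → Tr 12) (s t : O) : O :=
  Opt.rec (motive := fun _ => O) t (fun s => Opt.rec (motive := fun _ => O) (Opt.some s) (fun t => Opt.some (g s t)) t) s
noncomputable def insO (g : Tr 12 → O) (s : O) : O :=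
  Opt.rec (motive := fun _ => O) Opt.none (fun s => g s) s
noncomputable def joinO (g : Tr 12 → Tr 12 → Nat) (s t : O) : Nat :=
  Opt.rec (motive := fun _ => Nat) 0 (fun s => Opt.rec (motive := fun _ => Nat) 0 (fun t => g s t) t) s
noncomputable def build {γ α : Type} (F : Nat → (γ → α) → α) (n : Nat) : (List γ → α) → α :=
  Nat.rec (motive := fun _ => (List γ → α) → α) (fun f => f [])
   (fun b ih f => ih (fun l => F (Nat.sub 22 b) (fun t => f (t :: l)))) n
noncomputable def cell {α : Type} (k : Nat) (L : List O) (x y : Nat) (f : O → α) : α :=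
  bif Bool.and (Nat.blt y x) (ok k x y) then insB x y 12 (fun p => forceO (get L (Nat.sub k (Nat.add x y))) fun t => forceO (insO p t) f) else f Opt.none
noncomputable def getL (L : List (List O)) (n : Nat) : List O :=
  List.rec (motive := fun _ => Nat → List O) (fun _ => []) (fun t _ ih n => bif Nat.beq n 0 then t else ih (Nat.sub n 1)) L n
noncomputable def tget (T : List (List O)) (x y : Nat) : O := bif Nat.blt y x then get (getL T x) y else get (getL T y) x
noncomputable def row (g : Tr 12 → Tr 12 → Tr 12) (k : Nat) (T : List (List O)) (b : Nat) (n : Nat) : O :=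
  Nat.rec (motive := fun _ => O) Opt.none (fun y ih => bif ok k b y then
     forceO (tget T b y) fun t => addO g ih t else ih) n
noncomputable def level0 {α : Type} (n : Nat) : (List O → α) → α :=
  build (fun b => forceO (Opt.some (single b 12))) n
noncomputable def step {α : Type} (k : Nat) (L : List O) (f : (List O → α)) : α :=
  addB 12 (fun g => build (fun x => build (fun y => cell k L x y) 23) 23 (fun T => 
   build (fun b => forceO (row g k T b 23)) 23 f))
noncomputable def jrow (k : Nat) (L : List O) (b : Nat) (n : Nat) : Nat :=
  Nat.rec (motive := fun _ => Nat) 0 (fun a ih => bif ok k a b then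
     joinB (Nat.sub k (Nat.add a b)) 12 (fun p => forceO (get L a) fun t1 => forceO (get L b) fun t2 => Nat.add ih (Nat.shiftRight (joinO p t1 t2) (Nat.mul 24 (Nat.sub 2047 (low (Nat.sub k (Nat.add a b))))))) else ih) n
noncomputable def jall (k : Nat) (L : List O) (n : Nat) : Nat :=
  Nat.rec (motive := fun _ => Nat) 0 (fun b ih => Nat.add ih (jrow k L b b)) n
noncomputable def cnt5 (k : Nat) : Nat :=
  level0 23 fun l => step k l fun l => step k l fun l => step k l fun l => step k l fun l => step k l fun l => jall k l 23

end Programs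

/-! ### Removing the continuation-passing style -/

noncomputable def insF (x y h : ℕ) : Tr h → Opt (Tr h) := insB x y h id
noncomputable def addF (h : ℕ) : Tr h → Tr h → Tr h := addB h id
noncomputable def joinF (e h : ℕ) : Tr h → Tr h → ℕ := joinB e h id

theorem nforce_eq {β : Type} (n : ℕ) (k : ℕ → β) : nforce n k = k n := by
  cases n <;> rfl

theorem forceO_eq {β : Type} (t : O) (k : O → β) : forceO t k = k t := by
  rcases t with _ | t
  · rfl
  · change Nd (Tr 11) at t
    cases t <;> rfl

theorem cond_app {α β : Type} (b : Bool) (k : α → β) (x y : α) :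
    cond b (k x) (k y) = k (cond b x y) := by cases b <;> rfl

noncomputable def insLeaf (s : ℕ) : ℕ → Opt ℕ := fun t : Nat =>
  (fun z => Bool.rec (motive := fun _ => Opt Nat) (Opt.some (Nat.shiftLeft z (Nat.mul 24 s))) Opt.none
    (Nat.beq z 0)) (Nat.land t (Nat.sub (Nat.pow 2 (Nat.mul 24 (Nat.sub 2048 s))) 1))

noncomputable def jLeaf (M : ℕ) : ℕ → ℕ → ℕ := fun (u v : Nat) =>
  Bool.rec (motive := fun _ => Nat) (Nat.mul M M) (Nat.land (Nat.mul u v) M)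
    (Nat.ble (Nat.mul (Nat.mod u 16777215) (Nat.mod v 16777215)) 16777215)

theorem insB_eq (x y : ℕ) : ∀ (h : ℕ) {β : Type} (k : (Tr h → Opt (Tr h)) → β),
    insB x y h k = k (insF x y h)
  | 0, β, k => by
    have e1 : ∀ {γ : Type} (k : (Tr 0 → Opt (Tr 0)) → γ), insB x y 0 k =
      nforce (Nat.add (low x) (low y)) fun s => bif Nat.beq s 0 then k (fun t => Opt.some t)
        else k (insLeaf s) := fun k => rfl
    unfold insF
    rw [e1, e1, nforce_eq, nforce_eq]
    cases Nat.beq (Nat.add (low x) (low y)) 0 <;> rfl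
  | h+1, β, k => by
    have e1 : ∀ {γ : Type} (k : (Tr (h+1) → Opt (Tr (h+1))) → γ), insB x y (h+1) k =
      bif Bool.and (Nat.ble (Nat.add 12 h) x) (Nat.ble (Nat.add 12 h) y) then k (fun t => Opt.some t)
      else insB x y h (fun f => bif Bool.or (Nat.beq x (Nat.add 11 h)) (Nat.beq y (Nat.add 11 h))
        then bTake f k else bPass f k) := fun k => rfl
    unfold insF
    rw [e1, e1, insB_eq x y h, insB_eq x y h]
    cases Bool.and (Nat.ble (Nat.add 12 h) x) (Nat.ble (Nat.add 12 h) y) <;>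
    cases Bool.or (Nat.beq x (Nat.add 11 h)) (Nat.beq y (Nat.add 11 h)) <;> rfl

theorem insF_zero (x y : ℕ) : insF x y 0 = bif Nat.beq (Nat.add (low x) (low y)) 0
    then (fun t => Opt.some t) else insLeaf (Nat.add (low x) (low y)) := by
  have e1 : insF x y 0 =
      nforce (Nat.add (low x) (low y)) fun s => bif Nat.beq s 0 then (fun t => Opt.some t)
        else (insLeaf s) := rfl
  rw [e1, nforce_eq]

theorem insF_succ (x y h : ℕ) : insF x y (h+1) =
    bif Bool.and (Nat.ble (Nat.add 12 h) x) (Nat.ble (Nat.add 12 h) y) then (fun t => Opt.some t)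
      else bif Bool.or (Nat.beq x (Nat.add 11 h)) (Nat.beq y (Nat.add 11 h))
        then bTake (insF x y h) id else bPass (insF x y h) id := by
  have e1 : insF x y (h+1) =
      bif Bool.and (Nat.ble (Nat.add 12 h) x) (Nat.ble (Nat.add 12 h) y) then (fun t => Opt.some t)
      else insB x y h (fun f => bif Bool.or (Nat.beq x (Nat.add 11 h)) (Nat.beq y (Nat.add 11 h))
        then bTake f id else bPass f id) := rfl
  rw [e1, insB_eq]

theorem addB_eq : ∀ (h : ℕ) {β : Type} (k : (Tr h → Tr h → Tr h) → β), addB h k = k (addF h)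
  | 0, β, k => rfl
  | h+1, β, k => by
    have e1 : ∀ {γ : Type} (k : (Tr (h+1) → Tr (h+1) → Tr (h+1)) → γ), addB (h+1) k =
      addB h (fun f => bAdd f k) := fun k => rfl
    unfold addF
    rw [e1, e1, addB_eq h, addB_eq h]
    rfl

theorem addF_succ (h : ℕ) : addF (h+1) = bAdd (addF h) id := by
  have e1 : addF (h+1) = addB h (fun f => bAdd f id) := rfl
  rw [e1, addB_eq]

theorem joinB_eq (e : ℕ) : ∀ (h : ℕ) {β : Type} (k : (Tr h → Tr h → ℕ) → β),
    joinB e h k = k (joinF e h)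
  | 0, β, k => by
    have e1 : ∀ {γ : Type} (k : (Tr 0 → Tr 0 → ℕ) → γ), joinB e 0 k =
      nforce (Nat.shiftLeft 16777215 (Nat.mul 24 (Nat.sub 2047 (low e)))) fun M => k (jLeaf M) :=
      fun k => rfl
    unfold joinF
    rw [e1, e1, nforce_eq, nforce_eq]
    rfl
  | h+1, β, k => by
    have e1 : ∀ {γ : Type} (k : (Tr (h+1) → Tr (h+1) → ℕ) → γ), joinB e (h+1) k =
      joinB e h (fun f => bif Nat.beq e (Nat.add 11 h) then bJTake f k else bJoin f k) := fun k => rfl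
    unfold joinF
    rw [e1, e1, joinB_eq e h, joinB_eq e h]
    cases Nat.beq e (Nat.add 11 h) <;> rfl

theorem joinF_zero (e : ℕ) :
    joinF e 0 = jLeaf (Nat.shiftLeft 16777215 (Nat.mul 24 (Nat.sub 2047 (low e)))) := by
  have e1 : joinF e 0 =
      nforce (Nat.shiftLeft 16777215 (Nat.mul 24 (Nat.sub 2047 (low e)))) fun M => jLeaf M := rfl
  rw [e1, nforce_eq]

theorem joinF_succ (e h : ℕ) : joinF e (h+1) =
    bif Nat.beq e (Nat.add 11 h) then bJTake (joinF e h) id else bJoin (joinF e h) id := by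
  have e1 : joinF e (h+1) =
      joinB e h (fun f => bif Nat.beq e (Nat.add 11 h) then bJTake f id else bJoin f id) := rfl
  rw [e1, joinB_eq]

/-! ### Semantics of tries -/

noncomputable def look : (h : ℕ) → Tr h → Finset ℕ → ℕ
  | 0, v, _ => v
  | h+1, t, A => Nd.rec (motive := fun _ => ℕ)
      (fun l => if 11 + h ∈ A then 0 else look h l A)
      (fun r => if 11 + h ∈ A then look h r A else 0)
      (fun l r => if 11 + h ∈ A then look h r A else look h l A) t

noncomputable def olook (h : ℕ) (t : Opt (Tr h)) (A : Finset ℕ) : ℕ :=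
  Opt.rec (motive := fun _ => ℕ) 0 (fun t => look h t A) t

theorem look_L (h : ℕ) (l : Tr h) (A : Finset ℕ) :
    look (h+1) (Nd.L l : Nd (Tr h)) A = if 11 + h ∈ A then 0 else look h l A := rfl
theorem look_R (h : ℕ) (r : Tr h) (A : Finset ℕ) :
    look (h+1) (Nd.R r : Nd (Tr h)) A = if 11 + h ∈ A then look h r A else 0 := rfl
theorem look_B (h : ℕ) (l r : Tr h) (A : Finset ℕ) :
    look (h+1) (Nd.B l r : Nd (Tr h)) A = if 11 + h ∈ A then look h r A else look h l A := rfl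
theorem olook_none (h : ℕ) (A : Finset ℕ) : olook h Opt.none A = 0 := rfl
theorem olook_some (h : ℕ) (t : Tr h) (A : Finset ℕ) : olook h (Opt.some t) A = look h t A := rfl

theorem look_congr : ∀ (h : ℕ) (t : Tr h) (A A' : Finset ℕ),
    (∀ i, 11 ≤ i → i < 11 + h → (i ∈ A ↔ i ∈ A')) → look h t A = look h t A'
  | 0, t, A, A', H => rfl
  | h+1, t, A, A', H => by
    change Nd (Tr h) at t
    have H0 := H (11+h) (by omega) (by omega)
    have IH := fun t => look_congr h t A A' (fun i h1 h2 => H i h1 (by omega))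
    rcases t with l | r | ⟨l, r⟩
    · rw [look_L, look_L]; simp only [H0, IH]
    · rw [look_R, look_R]; simp only [H0, IH]
    · rw [look_B, look_B]; simp only [H0, IH]

theorem look_add : ∀ (h : ℕ) (s t : Tr h) (A : Finset ℕ),
    look h (addF h s t) A = look h s A + look h t A
  | 0, s, t, A => rfl
  | h+1, s, t, A => by
    have IH := look_add h
    rw [addF_succ]
    change Nd (Tr h) at s t
    rcases s with l | r | ⟨l, r⟩ <;> rcases t with l' | r' | ⟨l', r'⟩ <;>
      simp only [bAdd, id, look_L, look_R, look_B, IH] <;> split_ifs <;> simp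

theorem olook_add (s t : O) (A : Finset ℕ) :
    olook 12 (addO (addF 12) s t) A = olook 12 s A + olook 12 t A := by
  rcases s with _ | s <;> rcases t with _ | t
  · rfl
  · simp [addO, olook]
  · simp [addO, olook]
  · exact look_add 12 s t A

/-- The base of the polynomial encoding. -/
def XX : ℕ := 16777216

theorem XX_eq : XX = 2 ^ 24 := by unfold XX; norm_num

/-- Truncated shift. -/
noncomputable def ts (s v : ℕ) : ℕ := if s = 0 then v else v % XX ^ (2048 - s) * XX ^ s

theorem insLeaf_look (s t : ℕ) (A : Finset ℕ) :
    olook 0 (insLeaf s t) A = t % XX ^ (2048 - s) * XX ^ s := by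
  have hz : Nat.land t (Nat.sub (Nat.pow 2 (Nat.mul 24 (Nat.sub 2048 s))) 1) = t % XX ^ (2048 - s) := by
    have := Nat.and_two_pow_sub_one_eq_mod t (24 * (2048 - s))
    rw [XX_eq, ← pow_mul]
    exact this
  unfold insLeaf
  rw [hz]
  generalize t % XX ^ (2048 - s) = z
  cases hb : Nat.beq z 0
  · simp only [hb]
    change Nat.shiftLeft z (24 * s) = z * XX ^ s
    rw [XX_eq, ← pow_mul]
    exact Nat.shiftLeft_eq z _
  · have := Nat.eq_of_beq_eq_true hb
    subst this
    change 0 = 0 * XX ^ s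
    simp

theorem insF_zero_look (x y t : ℕ) (A : Finset ℕ) :
    olook 0 (insF x y 0 t) A = ts (low x + low y) t := by
  rw [insF_zero]
  unfold ts
  have h1 : Nat.add (low x) (low y) = low x + low y := rfl
  rw [h1]
  generalize low x + low y = s
  cases hb : Nat.beq s 0
  · have : s ≠ 0 := Nat.ne_of_beq_eq_false hb
    rw [if_neg this]
    exact insLeaf_look s t A
  · have := Nat.eq_of_beq_eq_true hb
    rw [if_pos this]
    rfl

theorem low_of_ge {x : ℕ} (h : 11 ≤ x) : low x = 0 := by
  have : Nat.blt x 11 = false := by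
    rw [Bool.eq_false_iff]; intro h2
    have := Nat.le_of_ble_eq_true h2
    omega
  unfold low
  rw [this]; rfl

theorem low_of_lt {x : ℕ} (h : x < 11) : low x = 2 ^ x := by
  have : Nat.blt x 11 = true := Nat.ble_eq_true_of_le h
  unfold low
  rw [this]; rfl

theorem olook_R (h : ℕ) (o : Opt (Tr h)) (A : Finset ℕ) :
    olook (h+1) (Opt.rec (motive := fun _ => Opt (Nd (Tr h))) Opt.none
      (fun l' => Opt.some (Nd.R l')) o) A = if 11 + h ∈ A then olook h o A else 0 := by
  cases o
  · simp [olook]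
  · rfl

theorem olook_L (h : ℕ) (o : Opt (Tr h)) (A : Finset ℕ) :
    olook (h+1) (Opt.rec (motive := fun _ => Opt (Nd (Tr h))) Opt.none
      (fun l' => Opt.some (Nd.L l')) o) A = if 11 + h ∈ A then 0 else olook h o A := by
  cases o
  · simp [olook]
  · rfl

theorem olook_take (h : ℕ) (f : Tr h → Opt (Tr h)) (t : Tr (h+1)) (A A' : Finset ℕ)
    (hA : 11 + h ∉ A') (g : ℕ → ℕ) (hg : g 0 = 0)
    (H2 : ∀ l, olook h (f l) A = g (look h l A')) :
    olook (h+1) ((bTake f id : Nd (Tr h) → Opt (Nd (Tr h))) t) A =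
      if 11 + h ∈ A then g (look (h+1) t A') else 0 := by
  change Nd (Tr h) at t
  rcases t with l | r | ⟨l, r⟩
  · rw [look_L, if_neg hA, ← H2]; exact olook_R h (f l) A
  · rw [look_R, if_neg hA, hg]; simp; rfl
  · rw [look_B, if_neg hA, ← H2]; exact olook_R h (f l) A

theorem olook_pass (h : ℕ) (f : Tr h → Opt (Tr h)) (t : Tr (h+1)) (A A' : Finset ℕ)
    (hA : 11 + h ∈ A' ↔ 11 + h ∈ A) (g : ℕ → ℕ) (hg : g 0 = 0)
    (H2 : ∀ l, olook h (f l) A = g (look h l A')) :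
    olook (h+1) ((bPass f id : Nd (Tr h) → Opt (Nd (Tr h))) t) A = g (look (h+1) t A') := by
  change Nd (Tr h) at t
  rcases t with l | r | ⟨l, r⟩
  · refine (olook_L h (f l) A).trans ?_
    rw [look_L, H2]; simp only [hA]; split_ifs <;> simp [hg]
  · refine (olook_R h (f r) A).trans ?_
    rw [look_R, H2]; simp only [hA]; split_ifs <;> simp [hg]
  · rw [look_B]
    simp only [hA]
    have h1 := H2 l
    have h2 := H2 r
    simp only [bPass, id]
    rcases hl : f l with _ | l' <;> rcases hr : f r with _ | r' <;> rw [hl] at h1 <;> rw [hr] at h2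
    · rw [apply_ite g, ← h1, ← h2]; simp [olook]
    · rw [apply_ite g, ← h1, ← h2]; rfl
    · rw [apply_ite g, ← h1, ← h2]; rfl
    · rw [apply_ite g, ← h1, ← h2]; rfl

theorem ts_zero (s : ℕ) : ts s 0 = 0 := by simp [ts]

theorem olook_ins (x y : ℕ) (hxy : x ≠ y) : ∀ (h : ℕ) (t : Tr h) (A : Finset ℕ),
    olook h (insF x y h t) A = if ((11 ≤ x → x < 11 + h → x ∈ A) ∧ (11 ≤ y → y < 11 + h → y ∈ A))
      then ts (low x + low y) (look h t (A \ {x, y})) else 0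
  | 0, t, A => by
    rw [if_pos ⟨by omega, by omega⟩]
    exact insF_zero_look x y t A
  | h+1, t, A => by
    have IH := fun t => olook_ins x y hxy h t A
    rw [insF_succ]
    cases hb : Bool.and (Nat.ble (Nat.add 12 h) x) (Nat.ble (Nat.add 12 h) y)
    · cases hc : Bool.or (Nat.beq x (Nat.add 11 h)) (Nat.beq y (Nat.add 11 h))
      · have hx : x ≠ 11 + h := by
          rintro rfl
          simp [Nat.add] at hc
        have hy : y ≠ 11 + h := by
          rintro rfl
          simp [Nat.add] at hc
        have := olook_pass h (insF x y h) t A (A \ {x, y})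
          (by simp [hx.symm, hy.symm])
          (fun v => if ((11 ≤ x → x < 11 + h → x ∈ A) ∧ (11 ≤ y → y < 11 + h → y ∈ A))
            then ts (low x + low y) v else 0) (by simp [ts_zero]) IH
        refine this.trans ?_
        refine if_congr ?_ rfl rfl
        constructor
        · rintro ⟨h1, h2⟩
          exact ⟨fun a b => h1 a (by omega), fun a b => h2 a (by omega)⟩
        · rintro ⟨h1, h2⟩
          exact ⟨fun a b => h1 a (by omega), fun a b => h2 a (by omega)⟩
      · have hxy' : x = 11 + h ∨ y = 11 + h := by
          rcases Bool.or_eq_true_iff.mp hc with h | h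
          · exact Or.inl (Nat.eq_of_beq_eq_true h)
          · exact Or.inr (Nat.eq_of_beq_eq_true h)
        have := olook_take h (insF x y h) t A (A \ {x, y})
          (by rcases hxy' with h | h <;> simp [h])
          (fun v => if ((11 ≤ x → x < 11 + h → x ∈ A) ∧ (11 ≤ y → y < 11 + h → y ∈ A))
            then ts (low x + low y) v else 0) (by simp [ts_zero]) IH
        refine this.trans ?_
        rw [← ite_and]
        refine if_congr ?_ rfl rfl
        rcases hxy' with hx | hy
        · subst hx
          constructor
          · rintro ⟨h0, h1, h2⟩
            exact ⟨fun _ _ => h0, fun a b => h2 a (by omega)⟩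
          · rintro ⟨h1, h2⟩
            exact ⟨h1 (by omega) (by omega), fun a b => by omega, fun a b => h2 a (by omega)⟩
        · subst hy
          constructor
          · rintro ⟨h0, h1, h2⟩
            exact ⟨fun a b => h1 a (by omega), fun _ _ => h0⟩
          · rintro ⟨h1, h2⟩
            exact ⟨h2 (by omega) (by omega), fun a b => h1 a (by omega), fun a b => by omega⟩
    · have hb' := Bool.and_eq_true_iff.mp hb
      have hx : 12 + h ≤ x := Nat.le_of_ble_eq_true hb'.1
      have hy : 12 + h ≤ y := Nat.le_of_ble_eq_true hb'.2
      rw [if_pos ⟨fun _ _ => by omega, fun _ _ => by omega⟩, low_of_ge (by omega), low_of_ge (by omega)]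
      change look (h+1) t A = ts 0 _
      unfold ts
      rw [if_pos rfl]
      apply look_congr
      intro i h1 h2
      have : i ≠ x := by omega
      have : i ≠ y := by omega
      simp [*]

/-! ### Join -/

theorem jLeaf_zero_left (M v : ℕ) : jLeaf M 0 v = 0 := by
  have : Nat.ble (Nat.mul (Nat.mod 0 16777215) (Nat.mod v 16777215)) 16777215 = true := by
    apply Nat.ble_eq_true_of_le
    change (0 % 16777215) * (v % 16777215) ≤ _
    simp
  unfold jLeaf
  rw [this]
  change (0 * v) &&& M = 0
  simp

theorem jLeaf_zero_right (M v : ℕ) : jLeaf M v 0 = 0 := by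
  have : Nat.ble (Nat.mul (Nat.mod v 16777215) (Nat.mod 0 16777215)) 16777215 = true := by
    apply Nat.ble_eq_true_of_le
    change (v % 16777215) * (0 % 16777215) ≤ _
    simp
  unfold jLeaf
  rw [this]
  change (v * 0) &&& M = 0
  simp

noncomputable def jM (e : ℕ) : ℕ := Nat.shiftLeft 16777215 (Nat.mul 24 (Nat.sub 2047 (low e)))

/-- The set of high labels below height `h`, without `e`. -/
def UU (e h : ℕ) : Finset ℕ := (Finset.Ico 11 (11 + h)).erase e

theorem UU_succ_eq (h : ℕ) : UU (11 + h) (h+1) = UU (11 + h) h := by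
  ext i; simp only [UU, Finset.mem_erase, Finset.mem_Ico]; omega

theorem UU_succ_ne (e h : ℕ) (he : e ≠ 11 + h) : UU e (h+1) = insert (11 + h) (UU e h) := by
  ext i; simp only [UU, Finset.mem_erase, Finset.mem_Ico, Finset.mem_insert]; omega

theorem not_mem_UU (e h : ℕ) : 11 + h ∉ UU e h := by
  simp [UU]

theorem joinF_eq (e : ℕ) : ∀ (h : ℕ) (s t : Tr h), joinF e h s t =
    ∑ A ∈ (UU e h).powerset, jLeaf (jM e) (look h s A) (look h t (UU e h \ A))
  | 0, s, t => by
    rw [joinF_zero]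
    have : UU e 0 = ∅ := by ext; simp [UU]
    rw [this]
    simp
    rfl
  | h+1, s, t => by
    have IH := joinF_eq e h
    rw [joinF_succ]
    have hn := not_mem_UU e h
    have key : ∀ A ∈ (UU e h).powerset, 11 + h ∉ A := fun A hA hm =>
      hn (Finset.mem_powerset.mp hA hm)
    change Nd (Tr h) at s t
    cases hb : Nat.beq e (Nat.add 11 h)
    · have he : e ≠ 11 + h := Nat.ne_of_beq_eq_false hb
      rw [UU_succ_ne e h he, Finset.sum_powerset_insert hn]
      have k1 : ∀ A ∈ (UU e h).powerset, ∀ (l r : Tr h), 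
          look h l (insert (11+h) (UU e h) \ A) = look h l (UU e h \ A) := by
        intro A hA l r
        apply look_congr
        intro i h1 h2
        have : i ≠ 11 + h := by omega
        simp [this]
      have k2 : ∀ A ∈ (UU e h).powerset, ∀ (l : Tr h), 
          look h l (insert (11+h) (UU e h) \ insert (11+h) A) = look h l (UU e h \ A) := by
        intro A hA l
        apply look_congr
        intro i h1 h2
        have : i ≠ 11 + h := by omega
        simp [this]
      have k3 : ∀ A ∈ (UU e h).powerset, ∀ (l : Tr h), 
          look h l (insert (11+h) A) = look h l A := by
        intro A hA l
        apply look_congr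
        intro i h1 h2
        have : i ≠ 11 + h := by omega
        simp [this]
      have S1 : ∑ A ∈ (UU e h).powerset, jLeaf (jM e) (look (h+1) s A)
          (look (h+1) t (insert (11+h) (UU e h) \ A)) = 
          Nd.rec (motive := fun _ => ℕ) (fun l => Nd.rec (motive := fun _ => ℕ) (fun _ => 0)
            (fun r' => joinF e h l r') (fun _ r' => joinF e h l r') t) (fun _ => 0)
            (fun l _ => Nd.rec (motive := fun _ => ℕ) (fun _ => 0)
            (fun r' => joinF e h l r') (fun _ r' => joinF e h l r') t) s := by
        rcases s with l | r | ⟨l, r⟩ <;> rcases t with l' | r' | ⟨l', r'⟩ <;>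
        first
        | (simp only [IH]; apply Finset.sum_congr rfl; intro A hA
           simp only [look_L, look_R, look_B, Finset.mem_sdiff, if_false,
            Finset.mem_insert_self, key A hA, not_false_eq_true, and_true, if_true, k1 A hA _ l])
        | (apply Finset.sum_eq_zero; intro A hA
           simp only [look_L, look_R, look_B, Finset.mem_sdiff, if_false,
            Finset.mem_insert_self, key A hA, not_false_eq_true, and_true, if_true, jLeaf_zero_left,
            jLeaf_zero_right])
      have S2 : ∑ A ∈ (UU e h).powerset, jLeaf (jM e) (look (h+1) s (insert (11+h) A))
          (look (h+1) t (insert (11+h) (UU e h) \ insert (11+h) A)) = 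
          Nd.rec (motive := fun _ => ℕ) (fun _ => 0)
            (fun r => Nd.rec (motive := fun _ => ℕ) (fun l' => joinF e h r l')
            (fun _ => 0) (fun l' _ => joinF e h r l') t)
            (fun _ r => Nd.rec (motive := fun _ => ℕ) (fun l' => joinF e h r l')
            (fun _ => 0) (fun l' _ => joinF e h r l') t) s := by
        rcases s with l | r | ⟨l, r⟩ <;> rcases t with l' | r' | ⟨l', r'⟩ <;>
        first
        | (simp only [IH]; apply Finset.sum_congr rfl; intro A hA
           simp only [look_L, look_R, look_B, Finset.mem_sdiff,
            Finset.mem_insert_self, not_true_eq_false, and_false, if_true, if_false, k2 A hA, k3 A hA])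
        | (apply Finset.sum_eq_zero; intro A hA
           simp only [look_L, look_R, look_B, Finset.mem_sdiff,
            Finset.mem_insert_self, not_true_eq_false, and_false, if_true, if_false, jLeaf_zero_left,
            jLeaf_zero_right])
      rw [S1, S2]
      rcases s with l | r | ⟨l, r⟩ <;> rcases t with l' | r' | ⟨l', r'⟩ <;>
        simp [bJoin, cond]
    · have he : e = 11 + h := Nat.eq_of_beq_eq_true hb
      have hU : UU e (h+1) = UU e h := by subst he; exact UU_succ_eq h
      rw [hU]
      have key2 : ∀ A, 11 + h ∉ UU e h \ A := fun A hm => hn (Finset.mem_sdiff.mp hm).1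
      rcases s with l | r | ⟨l, r⟩ <;> rcases t with l' | r' | ⟨l', r'⟩ <;>
        simp only [bJTake, id, cond, IH] <;>
      first
        | (apply Finset.sum_congr rfl; intro A hA
           simp only [look_L, look_R, look_B, if_neg (key A hA), if_neg (key2 A)])
        | (symm; apply Finset.sum_eq_zero; intro A hA
           simp only [look_L, look_R, look_B, if_neg (key A hA), if_neg (key2 A), jLeaf_zero_left,
            jLeaf_zero_right])

theorem joinO_eq (e : ℕ) (s t : O) : joinO (joinF e 12) s t =
    ∑ A ∈ (UU e 12).powerset, jLeaf (jM e) (olook 12 s A) (olook 12 t (UU e 12 \ A)) := by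
  rcases s with _ | s
  · simp [olook, joinO, jLeaf_zero_left]
  rcases t with _ | t
  · simp [olook, joinO, jLeaf_zero_right]
  exact joinF_eq e 12 s t

/-! ### Lists, levels and walks -/

noncomputable def bl {γ : Type} (G : ℕ → γ) : ℕ → List γ
  | 0 => []
  | b+1 => G (22 - b) :: bl G b

theorem build_eq {γ α : Type} (F : ℕ → (γ → α) → α) (G : ℕ → γ) (hF : ∀ i k, F i k = k (G i)) :
    ∀ (n : ℕ) (f : List γ → α), build F n f = f (bl G n)
  | 0, f => rfl
  | b+1, f => by
    have e1 : build F (b+1) f = build F b (fun l => F (22 - b) (fun t => f (t :: l))) := rfl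
    rw [e1, build_eq F G hF b, hF]; rfl

theorem get_eq : ∀ (L : List O) (n : ℕ), get L n = L.getD n Opt.none
  | [], n => rfl
  | t :: l, n => by
    have e1 : get (t :: l) n = bif Nat.beq n 0 then t else get l (n - 1) := rfl
    rw [e1, get_eq l]
    cases n <;> rfl

theorem getL_eq : ∀ (L : List (List O)) (n : ℕ), getL L n = L.getD n []
  | [], n => rfl
  | t :: l, n => by
    have e1 : getL (t :: l) n = bif Nat.beq n 0 then t else getL l (n - 1) := rfl
    rw [e1, getL_eq l]
    cases n <;> rfl

theorem bl_getD {γ : Type} (G : ℕ → γ) (d : γ) : ∀ (n i : ℕ), n ≤ 23 → i < n →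
    (bl G n).getD i d = G (23 - n + i)
  | 0, i, _, h => by omega
  | b+1, 0, hb, _ => by
    have : 23 - (b+1) + 0 = 22 - b := by omega
    rw [this]; rfl
  | b+1, i+1, hb, h => by
    have : 23 - (b+1) + (i+1) = 23 - b + i := by omega
    rw [this, ← bl_getD G d b i (by omega) (by omega)]; rfl

theorem get_bl (G : ℕ → O) {i : ℕ} (hi : i < 23) : get (bl G 23) i = G i := by
  rw [get_eq, bl_getD G _ 23 i le_rfl hi]; simp

theorem getL_bl (G : ℕ → List O) {i : ℕ} (hi : i < 23) : getL (bl G 23) i = G i := by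
  rw [getL_eq, bl_getD G _ 23 i le_rfl hi]; simp

theorem ok_iff (k x y : ℕ) : ok k x y = true ↔
    x + y ≤ k ∧ k - (x + y) ≤ 22 ∧ x ≠ y ∧ x ≠ k - (x + y) ∧ y ≠ k - (x + y) := by
  unfold ok
  simp only [Bool.and_eq_true, Nat.ble_eq, Bool.not_eq_true', Nat.beq_eq_true_eq,
    Nat.add_eq, Nat.sub_eq, Nat.beq_eq]
  simp [Bool.eq_false_iff]

noncomputable def cellv (k : ℕ) (L : List O) (x y : ℕ) : O :=
  bif Bool.and (Nat.blt y x) (ok k x y) then insO (insF x y 12) (get L (k - (x + y))) else Opt.none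

theorem cell_eq {α : Type} (k : ℕ) (L : List O) (x y : ℕ) (f : O → α) :
    cell k L x y f = f (cellv k L x y) := by
  unfold cell cellv
  rw [insB_eq, forceO_eq, forceO_eq]
  cases Bool.and (Nat.blt y x) (ok k x y) <;> rfl

noncomputable def Tb (k : ℕ) (L : List O) : List (List O) :=
  bl (fun x => bl (fun y => cellv k L x y) 23) 23

noncomputable def nextL (k : ℕ) (L : List O) : List O :=
  bl (fun b => row (addF 12) k (Tb k L) b 23) 23

theorem step_eq {α : Type} (k : ℕ) (L : List O) (f : List O → α) : step k L f = f (nextL k L) := by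
  unfold step
  rw [addB_eq, build_eq _ (fun x => bl (fun y => cellv k L x y) 23), build_eq _ (fun b => row (addF 12) k (Tb k L) b 23)]
  · rfl
  · intro i k; rw [forceO_eq]; rfl
  · intro i k'
    rw [build_eq _ (fun y => cellv k L i y)]
    intro j k''
    rw [cell_eq]

noncomputable def Lv (k : ℕ) : ℕ → List O
  | 0 => bl (fun b => Opt.some (single b 12)) 23
  | j+1 => nextL k (Lv k j)

theorem cnt5_eq (k : ℕ) : cnt5 k = jall k (Lv k 5) 23 := by
  unfold cnt5 level0
  rw [build_eq _ (fun b => Opt.some (single b 12)) (fun i k => forceO_eq _ k)]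
  simp only [step_eq]
  rfl

theorem olook_insO (x y : ℕ) (hxy : x ≠ y) (hx : x < 23) (hy : y < 23) (t : O) (A : Finset ℕ) :
    olook 12 (insO (insF x y 12) t) A = if ((11 ≤ x → x ∈ A) ∧ (11 ≤ y → y ∈ A))
      then ts (low x + low y) (olook 12 t (A \ {x, y})) else 0 := by
  rcases t with _ | t
  · simp [insO, olook, ts_zero]
  · refine (olook_ins x y hxy 12 t A).trans ?_
    refine if_congr ?_ rfl rfl
    constructor
    · rintro ⟨h1, h2⟩; exact ⟨fun a => h1 a (by omega), fun a => h2 a (by omega)⟩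
    · rintro ⟨h1, h2⟩; exact ⟨fun a _ => h1 a, fun a _ => h2 a⟩

theorem blt_t {a b : ℕ} (h : a < b) : Nat.blt a b = true := Nat.ble_eq_true_of_le h
theorem blt_f {a b : ℕ} (h : ¬ a < b) : Nat.blt a b = false := by
  rw [Bool.eq_false_iff]; intro h2; exact h (Nat.le_of_ble_eq_true h2)

theorem ok_symm (k x y : ℕ) : ok k x y = ok k y x := by
  rw [Bool.eq_iff_iff, ok_iff, ok_iff, Nat.add_comm x y]
  constructor <;> rintro ⟨a, b, c, d, e⟩ <;> exact ⟨a, b, c.symm, e, d⟩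

theorem olook_tget (k : ℕ) (L : List O) (x y : ℕ) (hx : x < 23) (hy : y < 23) (h : ok k x y = true)
    (A : Finset ℕ) :
    olook 12 (tget (Tb k L) x y) A = if ((11 ≤ x → x ∈ A) ∧ (11 ≤ y → y ∈ A))
      then ts (low x + low y) (olook 12 (get L (k - (x + y))) (A \ {x, y})) else 0 := by
  have hne : x ≠ y := ((ok_iff k x y).mp h).2.2.1
  unfold tget
  rcases lt_or_gt_of_ne hne with h1 | h1
  · rw [blt_f (by omega)]
    simp only [cond_false]
    unfold Tb
    rw [getL_bl _ hy, get_bl _ hx]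
    unfold cellv
    rw [blt_t h1, ok_symm k y x, h]
    simp only [Bool.and_self, cond_true]
    rw [olook_insO y x hne.symm hy hx, Nat.add_comm (low y), Nat.add_comm y x, Finset.pair_comm]
    exact if_congr and_comm rfl rfl
  · rw [blt_t h1]
    simp only [cond_true]
    unfold Tb
    rw [getL_bl _ hx, get_bl _ hy]
    unfold cellv
    rw [blt_t h1, h]
    simp only [Bool.and_self, cond_true]
    rw [olook_insO x y hne hx hy]

theorem olook_row (k : ℕ) (T : List (List O)) (b : ℕ) (A : Finset ℕ) : ∀ n,
    olook 12 (row (addF 12) k T b n) A = ∑ y ∈ Finset.range n,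
      if ok k b y = true then olook 12 (tget T b y) A else 0
  | 0 => rfl
  | n+1 => by
    have e1 : row (addF 12) k T b (n+1) = bif ok k b n then
      forceO (tget T b n) fun t => addO (addF 12) (row (addF 12) k T b n) t
      else row (addF 12) k T b n := rfl
    rw [e1, Finset.sum_range_succ, ← olook_row k T b A n, forceO_eq]
    cases ok k b n
    · simp
    · simp [olook_add]

/-- Walks, read from the outer end towards the tail. -/
noncomputable def W (k : ℕ) : ℕ → ℕ → Finset (List ℕ)
  | 0, b => {[b]}
  | j+1, b => ((Finset.range 23).filter (fun y => ok k b y = true)).biUnion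
      (fun y => (W k j (k - (b + y))).image (fun w => b :: y :: w))

noncomputable def lsum (w : List ℕ) : ℕ := (w.map low).sum

def MA (A : Finset ℕ) (w : List ℕ) : Prop :=
  ∀ i, 11 ≤ i → i < 23 → w.count i = if i ∈ A then 1 else 0

theorem W_sum {M : Type} [AddCommMonoid M] (k j b : ℕ) (f : List ℕ → M) :
    ∑ w ∈ W k (j+1) b, f w = ∑ y ∈ Finset.range 23, if ok k b y = true then
      ∑ w ∈ W k j (k - (b + y)), f (b :: y :: w) else 0 := by
  rw [← Finset.sum_filter]
  have e : W k (j+1) b = ((Finset.range 23).filter (fun y => ok k b y = true)).biUnion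
      (fun y => (W k j (k - (b + y))).image (fun w => b :: y :: w)) := rfl
  rw [e, Finset.sum_biUnion]
  · apply Finset.sum_congr rfl
    intro y _
    rw [Finset.sum_image]
    intro a _ c _ h
    simpa using h
  · intro y _ y' _ hyy
    rw [Function.onFun, Finset.disjoint_left]
    intro w hw hw'
    rw [Finset.mem_image] at hw hw'
    obtain ⟨v, _, rfl⟩ := hw
    obtain ⟨v', _, h⟩ := hw'
    simp at h
    exact hyy h.1.symm

theorem W_card (k : ℕ) : ∀ j b, (W k j b).card ≤ 23 ^ j
  | 0, b => by simp [W]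
  | j+1, b => by
    rw [Finset.card_eq_sum_ones, W_sum, pow_succ']
    have : ∀ y ∈ Finset.range 23, (if ok k b y = true then
      ∑ w ∈ W k j (k - (b + y)), 1 else 0) ≤ 23 ^ j := by
      intro y _
      split_ifs
      · rw [← Finset.card_eq_sum_ones]; exact W_card k j _
      · simp
    simpa using Finset.sum_le_card_nsmul _ _ _ this

theorem pow_sum_mod {ι : Type} (X N : ℕ) (F : Finset ι) (d : ι → ℕ)
    (hF : F.card < X) : (∑ w ∈ F, X ^ d w) % X ^ N = ∑ w ∈ F with d w < N, X ^ d w := by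
  have hX : 0 < X := by omega
  rw [← Finset.sum_filter_add_sum_filter_not F (fun w => d w < N)]
  obtain ⟨c, hc⟩ : X ^ N ∣ ∑ w ∈ F with ¬ d w < N, X ^ d w := by
    apply Finset.dvd_sum
    intro w hw
    apply pow_dvd_pow
    have := (Finset.mem_filter.mp hw).2
    omega
  rw [hc, Nat.add_mul_mod_self_left]
  apply Nat.mod_eq_of_lt
  rcases N with _ | N
  · simp
  · have h1 : ∑ w ∈ F with d w < N + 1, X ^ d w ≤ F.card * X ^ N := by
      calc _ ≤ ∑ w ∈ F with d w < N + 1, X ^ N := by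
            apply Finset.sum_le_sum
            intro w hw
            apply Nat.pow_le_pow_right hX
            have := (Finset.mem_filter.mp hw).2
            omega
        _ = (F.filter (fun w => d w < N+1)).card * X ^ N := by simp
        _ ≤ _ := Nat.mul_le_mul_right _ (Finset.card_filter_le _ _)
    calc _ ≤ _ := h1
      _ < X * X ^ N := Nat.mul_lt_mul_of_pos_right hF (by positivity)
      _ = _ := by ring

theorem ts_sum {ι : Type} (s : ℕ) (hs : s < 2048) (F : Finset ι) (d : ι → ℕ) (hd : ∀ w ∈ F, d w < 2048)
    (hF : F.card < XX) : ts s (∑ w ∈ F, XX ^ d w) = ∑ w ∈ F with d w + s < 2048, XX ^ (d w + s) := by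
  unfold ts
  split_ifs with h
  · subst h
    rw [Finset.filter_true_of_mem (by simpa using hd)]
    simp
  · rw [pow_sum_mod XX _ F d hF, Finset.sum_mul]
    have : (F.filter fun w => d w < 2048 - s) = F.filter fun w => d w + s < 2048 := by
      apply Finset.filter_congr; intro w _; omega
    rw [this]
    apply Finset.sum_congr rfl
    intro w _
    rw [pow_add]

theorem MA_cons (A : Finset ℕ) (b y : ℕ) (w : List ℕ) (hb : b < 23) (hy : y < 23) (hne : b ≠ y) :
    MA A (b :: y :: w) ↔ ((11 ≤ b → b ∈ A) ∧ (11 ≤ y → y ∈ A)) ∧ MA (A \ {b, y}) w := by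
  unfold MA
  simp only [List.count_cons, beq_iff_eq, Finset.mem_sdiff, Finset.mem_insert, Finset.mem_singleton]
  constructor
  · intro H
    refine ⟨⟨fun h => ?_, fun h => ?_⟩, fun i h1 h2 => ?_⟩
    · have := H b h hb
      by_contra hc
      rw [if_neg hc] at this
      simp at this
    · have := H y h hy
      by_contra hc
      rw [if_neg hc] at this
      simp at this
    · have := H i h1 h2
      by_cases e1 : b = i
      · subst e1
        simp at this ⊢
        split_ifs at this <;> omega
      · by_cases e2 : y = i
        · subst e2
          simp at this ⊢
          split_ifs at this <;> omega
        · have e1' := Ne.symm e1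
          have e2' := Ne.symm e2
          simpa [e1, e2, e1', e2'] using this
  · rintro ⟨⟨hbA, hyA⟩, H⟩ i h1 h2
    have := H i h1 h2
    by_cases e1 : b = i
    · subst e1
      simp [hne.symm, hbA h1] at this ⊢
      exact this
    · by_cases e2 : y = i
      · subst e2
        simp [hne, hyA h1] at this ⊢
        exact this
      · have e1' := Ne.symm e1
        have e2' := Ne.symm e2
        simpa [e1, e2, e1', e2'] using this

theorem look_single (b : ℕ) (A : Finset ℕ) : ∀ h, look h (single b h) A =
    if (∀ i, 11 ≤ i → i < 11 + h → (i ∈ A ↔ b = i)) then XX ^ low b else 0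
  | 0 => by
    rw [if_pos (by intro i h1 h2; omega)]
    change Nat.shiftLeft 1 (24 * low b) = _
    rw [XX_eq, ← pow_mul]
    exact Nat.one_shiftLeft _
  | h+1 => by
    have IH := look_single b A h
    have e1 : single b (h+1) = bif Nat.beq b (11 + h) then (Nd.R (single b h) : Nd (Tr h)) else Nd.L (single b h) := rfl
    rw [e1]
    have hall : (∀ i, 11 ≤ i → i < 11 + (h+1) → (i ∈ A ↔ b = i)) ↔
       (11 + h ∈ A ↔ b = 11 + h) ∧ (∀ i, 11 ≤ i → i < 11 + h → (i ∈ A ↔ b = i)) := by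
      constructor
      · intro H; exact ⟨H _ (by omega) (by omega), fun i h1 h2 => H i h1 (by omega)⟩
      · rintro ⟨h0, H⟩ i h1 h2
        rcases Nat.lt_or_ge i (11 + h) with h3 | h3
        · exact H i h1 h3
        · have : i = 11 + h := by omega
          subst this; exact h0
    cases hb : Nat.beq b (11 + h)
    · have := Nat.ne_of_beq_eq_false hb
      rw [cond_false, look_L, IH, if_congr hall rfl rfl]
      by_cases hA : 11 + h ∈ A <;> simp [hA, this]
    · have := Nat.eq_of_beq_eq_true hb
      rw [cond_true, look_R, IH, if_congr hall rfl rfl]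
      by_cases hA : 11 + h ∈ A <;> simp [hA, this]

theorem low_le (x : ℕ) : low x ≤ 1024 := by
  rcases Nat.lt_or_ge x 11 with h | h
  · rw [low_of_lt h]
    exact (Nat.pow_le_pow_right (by norm_num) (by omega : x ≤ 10)).trans (by norm_num)
  · rw [low_of_ge h]; omega

theorem low_add_lt {x y : ℕ} (h : x ≠ y) : low x + low y < 2048 := by
  have hx := low_le x
  have hy := low_le y
  rcases Nat.lt_or_ge x 10 with h1 | h1
  · have : low x ≤ 512 := by
      rw [low_of_lt (by omega)]
      exact (Nat.pow_le_pow_right (by norm_num) (by omega : x ≤ 9)).trans (by norm_num)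
    omega
  · rcases Nat.lt_or_ge x 11 with h2 | h2
    · rcases Nat.lt_or_ge y 11 with h3 | h3
      · have : low y ≤ 512 := by
          rw [low_of_lt (by omega)]
          exact (Nat.pow_le_pow_right (by norm_num) (by omega : y ≤ 9)).trans (by norm_num)
        omega
      · rw [low_of_ge h3]; omega
    · rw [low_of_ge h2]; omega

open Classical in
theorem Lv_look (k : ℕ) : ∀ j, j ≤ 5 → ∀ b < 23, ∀ A : Finset ℕ, olook 12 (get (Lv k j) b) A =
    ∑ w ∈ W k j b with (MA A w ∧ lsum w < 2048), XX ^ lsum w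
  | 0, _, b, hb, A => by
    have e : Lv k 0 = bl (fun b => Opt.some (single b 12)) 23 := rfl
    rw [e, get_bl _ hb, olook_some, look_single]
    have hl : lsum [b] = low b := by simp [lsum]
    have e2 : W k 0 b = {[b]} := rfl
    rw [e2, Finset.sum_filter, Finset.sum_singleton, hl]
    refine if_congr ?_ rfl rfl
    unfold MA
    have := low_le b
    constructor
    · intro H
      refine ⟨fun i h1 h2 => ?_, by omega⟩
      have := H i h1 (by omega)
      by_cases hA : i ∈ A
      · have := this.mp hA
        simp [hA, this]
      · have : b ≠ i := fun h => hA (this.mpr h)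
        simp [hA, this]
    · rintro ⟨H, -⟩ i h1 h2
      have := H i h1 (by omega)
      by_cases hbi : b = i
      · simp [hbi] at this ⊢
        by_contra hc
        simp [hc] at this
      · simp [hbi] at this ⊢
        exact this
  | j+1, hj, b, hb, A => by
    have e : Lv k (j+1) = nextL k (Lv k j) := rfl
    rw [e]
    unfold nextL
    rw [get_bl _ hb, olook_row, Finset.sum_filter, W_sum]
    apply Finset.sum_congr rfl
    intro y hy
    rw [Finset.mem_range] at hy
    split_ifs with hok
    · obtain ⟨o1, o2, o3, o4, o5⟩ := (ok_iff k b y).mp hok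
      rw [olook_tget k _ b y hb hy hok, Lv_look k j (by omega) _ (by omega)]
      have hcard : (W k j (k - (b + y))).card < XX := by
        refine (W_card k j _).trans_lt ?_
        refine (Nat.pow_le_pow_right (by norm_num) (by omega : j ≤ 4)).trans_lt ?_
        unfold XX; norm_num
      rw [ts_sum _ (low_add_lt o3) _ _ (fun w hw => (Finset.mem_filter.mp hw).2.2)
        ((Finset.card_filter_le _ _).trans_lt hcard), Finset.filter_filter]
      rw [← Finset.sum_filter]
      have hs : ∀ w, lsum (b :: y :: w) = lsum w + (low b + low y) := by
        intro w; simp [lsum]; omega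
      simp only [hs, MA_cons A b y _ hb hy o3]
      split_ifs with hc
      · apply Finset.sum_congr
        · apply Finset.filter_congr
          intro w _
          constructor
          · rintro ⟨⟨h1, h2⟩, h3⟩; exact ⟨⟨hc, h1⟩, h3⟩
          · rintro ⟨⟨_, h1⟩, h3⟩; exact ⟨⟨h1, by omega⟩, h3⟩
        · intros; rfl
      · symm
        apply Finset.sum_eq_zero
        intro w hw
        exact absurd (Finset.mem_filter.mp hw).2.1.1 hc
    · rfl

/-! ### Value of the join -/

theorem land_window (y n : ℕ) : y &&& ((2 ^ 24 - 1) <<< n) = (y / 2 ^ n % 2 ^ 24) * 2 ^ n := by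
  rw [← Nat.shiftLeft_eq]
  apply Nat.eq_of_testBit_eq
  intro i
  rw [Nat.testBit_and, Nat.testBit_shiftLeft, Nat.testBit_shiftLeft, Nat.testBit_two_pow_sub_one,
    Nat.testBit_mod_two_pow, ← Nat.shiftRight_eq_div_pow, Nat.testBit_shiftRight]
  by_cases h : n ≤ i
  · have : n + (i - n) = i := by omega
    rw [this]
    cases y.testBit i <;> simp [h]
  · simp [h]

theorem pow_sum_digit {ι : Type} (X N : ℕ) (F : Finset ι) (d : ι → ℕ)
    (hF : F.card < X) : (∑ w ∈ F, X ^ d w) / X ^ N % X * X ^ N = (F.filter fun w => d w = N).card * X ^ N := by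
  have h1 := pow_sum_mod X N F d hF
  have h2 := pow_sum_mod X (N+1) F d hF
  rw [Nat.mod_pow_succ, h1] at h2
  have h3 : ∑ w ∈ F with d w < N + 1, X ^ d w = ∑ w ∈ F with d w < N, X ^ d w +
      (F.filter fun w => d w = N).card * X ^ N := by
    rw [← Finset.sum_filter_add_sum_filter_not (F.filter fun w => d w < N + 1) (fun w => d w < N),
      Finset.filter_filter, Finset.filter_filter]
    congr 1
    · apply Finset.sum_congr
      · apply Finset.filter_congr; intro w _; omega
      · intros; rfl
    · have e : (F.filter fun w => d w < N + 1 ∧ ¬ d w < N) = F.filter fun w => d w = N := by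
        apply Finset.filter_congr; intro w _; omega
      rw [e, Finset.sum_congr rfl (g := fun _ => X ^ N)]
      · simp
      · intro w hw; rw [(Finset.mem_filter.mp hw).2]
  rw [h3] at h2
  have := Nat.add_left_cancel h2
  rw [← this, Nat.mul_comm]

theorem sum_mod_pred {ι : Type} (Y : ℕ) (F : Finset ι) (d : ι → ℕ) (hF : F.card < Y) :
    (∑ w ∈ F, (Y + 1) ^ d w) % Y = F.card := by
  have h1 : ∀ n, (Y + 1) ^ n ≡ 1 [MOD Y] := by
    intro n
    have : Y + 1 ≡ 1 [MOD Y] := by simp [Nat.ModEq]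
    simpa using this.pow n
  have h2 : ∑ w ∈ F, (Y + 1) ^ d w ≡ ∑ w ∈ F, 1 [MOD Y] := by
    classical
    induction F using Finset.induction_on with
    | empty => rfl
    | insert a s ha ih =>
      rw [Finset.sum_insert ha, Finset.sum_insert ha]
      exact (h1 _).add (ih (by rw [Finset.card_insert_of_notMem ha] at hF; omega))
  have h3 : (∑ w ∈ F, (Y + 1) ^ d w) % Y = (∑ w ∈ F, 1) % Y := h2
  rw [h3, ← Finset.card_eq_sum_ones, Nat.mod_eq_of_lt hF]

theorem jM_eq (e : ℕ) : jM e = (2 ^ 24 - 1) <<< (24 * (2047 - low e)) := rfl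

theorem jM_eq2 (e : ℕ) : jM e = 16777215 * XX ^ (2047 - low e) := by
  have : jM e = 16777215 <<< (24 * (2047 - low e)) := rfl
  rw [this, Nat.shiftLeft_eq, XX_eq, ← pow_mul]

theorem jLeaf_value {ι : Type} (e : ℕ) (F G : Finset ι) (d : ι → ℕ)
    (hF : F.card < 16777215) (hG : G.card < 16777215) :
    jLeaf (jM e) (∑ w ∈ F, XX ^ d w) (∑ w ∈ G, XX ^ d w) =
      ((F ×ˢ G).filter fun p => d p.1 + d p.2 = 2047 - low e).card * XX ^ (2047 - low e) ∨
    jLeaf (jM e) (∑ w ∈ F, XX ^ d w) (∑ w ∈ G, XX ^ d w) = jM e * jM e := by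
  unfold jLeaf
  cases hb : Nat.ble (Nat.mul (Nat.mod (∑ w ∈ F, XX ^ d w) 16777215)
      (Nat.mod (∑ w ∈ G, XX ^ d w) 16777215)) 16777215
  · right
    simp only [hb]; rfl
  · left
    simp only [hb]
    have h1 : (∑ w ∈ F, XX ^ d w) % 16777215 = F.card := sum_mod_pred 16777215 F d hF
    have h2 : (∑ w ∈ G, XX ^ d w) % 16777215 = G.card := sum_mod_pred 16777215 G d hG
    have h3 := Nat.le_of_ble_eq_true hb
    have h4 : F.card * G.card ≤ 16777215 := by
      rw [← h1, ← h2]; exact h3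
    have h5 : Nat.mul (∑ w ∈ F, XX ^ d w) (∑ w ∈ G, XX ^ d w) =
        ∑ p ∈ F ×ˢ G, XX ^ (d p.1 + d p.2) := by
      refine (Finset.sum_mul_sum _ _ _ _).trans ?_
      rw [Finset.sum_product]
      simp only [pow_add]
    rw [h5]
    generalize hy : ∑ p ∈ F ×ˢ G, XX ^ (d p.1 + d p.2) = y
    rw [jM_eq]
    refine (land_window y _).trans ?_
    have h6 : (F ×ˢ G).card < XX := by
      rw [Finset.card_product]; exact h4.trans_lt (by unfold XX; norm_num)
    have h7 := pow_sum_digit XX (2047 - low e) (F ×ˢ G) (fun p => d p.1 + d p.2) h6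
    rw [hy] at h7
    rw [pow_mul, ← XX_eq]
    exact h7

theorem sum_shift {ι : Type} (S : Finset ι) (e : ℕ) (f c : ι → ℕ)
    (h : ∀ A ∈ S, f A = c A * XX ^ (2047 - low e) ∨ f A = jM e * jM e)
    (hlt : Nat.shiftRight (∑ A ∈ S, f A) (Nat.mul 24 (Nat.sub 2047 (low e))) < 16777215 * 16777215) :
    Nat.shiftRight (∑ A ∈ S, f A) (Nat.mul 24 (Nat.sub 2047 (low e))) = ∑ A ∈ S, c A := by
  have e1 : ∀ z, Nat.shiftRight z (Nat.mul 24 (Nat.sub 2047 (low e))) = z / XX ^ (2047 - low e) := by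
    intro z
    rw [XX_eq, ← pow_mul]
    exact Nat.shiftRight_eq_div_pow z _
  rw [e1] at hlt ⊢
  have hX : 0 < XX := by unfold XX; norm_num
  generalize hN : 2047 - low e = N at *
  have hP : 0 < XX ^ N := pow_pos hX N
  have h' : ∀ A ∈ S, f A = c A * XX ^ N := by
    intro A hA
    rcases h A hA with h1 | h1
    · exact h1
    · exfalso
      have h2 : jM e * jM e ≤ ∑ A ∈ S, f A := by
        rw [← h1]; exact Finset.single_le_sum (fun _ _ => Nat.zero_le _) hA
      have h3 : (16777215 * 16777215) * XX ^ N ≤ jM e * jM e := by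
        rw [jM_eq2, hN]
        calc (16777215 * 16777215) * XX ^ N ≤ (16777215 * 16777215) * XX ^ N * XX ^ N :=
              Nat.le_mul_of_pos_right _ hP
          _ = _ := by ring
      have h4 := (Nat.le_div_iff_mul_le hP).mpr (h3.trans h2)
      omega
  rw [Finset.sum_congr rfl h', ← Finset.sum_mul, Nat.mul_div_cancel _ hP]

open Classical in
noncomputable def pairsA (k a b e : ℕ) (A : Finset ℕ) : ℕ :=
  ((((W k 5 a).filter fun w => MA A w ∧ lsum w < 2048) ×ˢ
    ((W k 5 b).filter fun w => MA (UU e 12 \ A) w ∧ lsum w < 2048)).filter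
      fun p => lsum p.1 + lsum p.2 = 2047 - low e).card

theorem W5_card (k b : ℕ) : (W k 5 b).card < 16777215 :=
  (W_card k 5 b).trans_lt (by norm_num)

theorem term_eq (k a b e : ℕ) (ha : a < 23) (hb : b < 23)
    (hlt : Nat.shiftRight (joinO (joinF e 12) (get (Lv k 5) a) (get (Lv k 5) b))
      (Nat.mul 24 (Nat.sub 2047 (low e))) < 16777215 * 16777215) :
    Nat.shiftRight (joinO (joinF e 12) (get (Lv k 5) a) (get (Lv k 5) b))
      (Nat.mul 24 (Nat.sub 2047 (low e))) = ∑ A ∈ (UU e 12).powerset, pairsA k a b e A := by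
  classical
  rw [joinO_eq] at hlt ⊢
  refine sum_shift _ e _ _ (fun A _ => ?_) hlt
  rw [Lv_look k 5 le_rfl a ha, Lv_look k 5 le_rfl b hb]
  refine (jLeaf_value e _ _ lsum ((Finset.card_filter_le _ _).trans_lt (W5_card k a))
    ((Finset.card_filter_le _ _).trans_lt (W5_card k b))).imp ?_ id
  intro h
  rw [h]
  unfold pairsA
  congr!

theorem jrow_eq (k b : ℕ) (hb : b < 23) : ∀ n ≤ 23, jrow k (Lv k 5) b n < 16777215 * 16777215 →
    jrow k (Lv k 5) b n = ∑ a ∈ Finset.range n, if ok k a b = true then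
      ∑ A ∈ (UU (k - (a + b)) 12).powerset, pairsA k a b (k - (a + b)) A else 0
  | 0, _, _ => rfl
  | n+1, hn, hlt => by
    have e1 : jrow k (Lv k 5) b (n+1) = bif ok k n b then
     joinB (k - (n + b)) 12 (fun p => forceO (get (Lv k 5) n) fun t1 => forceO (get (Lv k 5) b) fun t2 =>
      jrow k (Lv k 5) b n + (Nat.shiftRight (joinO p t1 t2) (Nat.mul 24 (Nat.sub 2047 (low (k - (n + b)))))))
      else jrow k (Lv k 5) b n := rfl
    rw [joinB_eq, forceO_eq, forceO_eq] at e1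
    rw [e1] at hlt ⊢
    rw [Finset.sum_range_succ]
    cases hok : ok k n b
    · rw [hok, cond_false] at hlt
      rw [cond_false, jrow_eq k b hb n (by omega) hlt]
      simp
    · rw [hok, cond_true] at hlt
      rw [cond_true, jrow_eq k b hb n (by omega) (by omega),
        term_eq k n b (k - (n + b)) (by omega) hb (by omega)]
      simp

theorem jall_eq (k : ℕ) : ∀ n ≤ 23, jall k (Lv k 5) n < 16777215 * 16777215 →
    jall k (Lv k 5) n = ∑ b ∈ Finset.range n, ∑ a ∈ Finset.range b, if ok k a b = true then
      ∑ A ∈ (UU (k - (a + b)) 12).powerset, pairsA k a b (k - (a + b)) A else 0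
  | 0, _, _ => rfl
  | n+1, hn, hlt => by
    have e1 : jall k (Lv k 5) (n+1) = jall k (Lv k 5) n + jrow k (Lv k 5) n n := rfl
    rw [e1] at hlt ⊢
    rw [Finset.sum_range_succ, jall_eq k n (by omega) (by omega),
      jrow_eq k n (by omega) n (by omega) (by omega)]

/-! ### The binary sum lemma -/

theorem bin_lemma : ∀ (m : ℕ) (c : ℕ → ℕ), ∑ i ∈ Finset.range (m+1), c i * 2 ^ i + 1 = 2 ^ (m+1) →
    m + 1 ≤ ∑ i ∈ Finset.range (m+1), c i ∧
    (∑ i ∈ Finset.range (m+1), c i = m + 1 → ∀ i < m + 1, c i = 1)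
  | 0, c, h => by
    simp at h
    refine ⟨by simp [h], fun _ i hi => ?_⟩
    have : i = 0 := by omega
    rw [this]; exact h
  | m+1, c, h => by
    rw [Finset.sum_range_succ'] at h
    have h2 : ∑ i ∈ Finset.range (m+1), c (i+1) * 2 ^ (i+1) =
        2 * ∑ i ∈ Finset.range (m+1), c (i+1) * 2 ^ i := by
      rw [Finset.mul_sum]; apply Finset.sum_congr rfl; intros; ring
    rw [h2, pow_zero, mul_one, pow_succ 2 (m+1)] at h
    obtain ⟨q, hq⟩ : ∃ q, c 0 = 2 * q + 1 := ⟨c 0 / 2, by omega⟩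
    have IH := bin_lemma m (fun i => c (i+1) + if i = 0 then q else 0) (by
      simp only [add_mul, Finset.sum_add_distrib]
      have : ∑ i ∈ Finset.range (m+1), (if i = 0 then q else 0) * 2 ^ i = q := by
        rw [Finset.sum_eq_single 0] <;> simp +contextual
      rw [this]; omega)
    have h3 : ∑ i ∈ Finset.range (m+1), (c (i+1) + if i = 0 then q else 0) =
      ∑ i ∈ Finset.range (m+1), c (i+1) + q := by
      rw [Finset.sum_add_distrib]
      congr 1
      rw [Finset.sum_eq_single 0] <;> simp +contextual
    rw [h3] at IH
    rw [Finset.sum_range_succ', hq]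
    refine ⟨by omega, fun h4 i hi => ?_⟩
    have hq0 : q = 0 := by omega
    rcases i with _ | i
    · omega
    · have := IH.2 (by omega) i (by omega)
      simpa [hq0] using this

theorem lsum_eq_count (l : List ℕ) (hl : ∀ x ∈ l, x < 23) :
    lsum l = ∑ i ∈ Finset.range 11, l.count i * 2 ^ i := by
  induction l with
  | nil => simp [lsum]
  | cons a l ih =>
    have e : lsum (a :: l) = low a + lsum l := by simp [lsum]
    rw [e, ih (fun x hx => hl x (List.mem_cons_of_mem _ hx))]
    simp only [List.count_cons, add_mul, Finset.sum_add_distrib, beq_iff_eq]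
    rw [Nat.add_comm]
    congr 1
    rcases Nat.lt_or_ge a 11 with h | h
    · rw [low_of_lt h, Finset.sum_eq_single a] <;> simp +contextual
      · intro b _ h1 h2; exact absurd h2.symm h1
      · omega
    · rw [low_of_ge h]
      symm
      apply Finset.sum_eq_zero
      intro i hi
      rw [Finset.mem_range] at hi
      rw [if_neg (by omega)]; simp

theorem length_eq_count (l : List ℕ) (hl : ∀ x ∈ l, x < 23) :
    l.length = ∑ i ∈ Finset.range 23, l.count i := by
  induction l with
  | nil => simp
  | cons a l ih =>
    rw [List.length_cons, ih (fun x hx => hl x (List.mem_cons_of_mem _ hx))]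
    simp only [List.count_cons, Finset.sum_add_distrib, beq_iff_eq]
    have := hl a List.mem_cons_self
    rw [Finset.sum_ite_eq, if_pos (Finset.mem_range.mpr this)]

theorem nodup_iff_conditions (l : List ℕ) (hl : ∀ x ∈ l, x < 23) (hlen : l.length = 23) :
    l.Nodup ↔ (∀ i, 11 ≤ i → i < 23 → l.count i = 1) ∧ lsum l = 2047 := by
  constructor
  · intro hn
    have h1 : ∀ i, i < 23 → l.count i = 1 := by
      have hsub : l.toFinset = Finset.range 23 := by
        apply Finset.eq_of_subset_of_card_le
        · intro x hx; exact Finset.mem_range.mpr (hl x (List.mem_toFinset.mp hx))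
        · rw [List.toFinset_card_of_nodup hn, hlen, Finset.card_range]
      intro i hi
      apply List.count_eq_one_of_mem hn
      rw [← List.mem_toFinset, hsub, Finset.mem_range]; exact hi
    refine ⟨fun i _ hi => h1 i hi, ?_⟩
    rw [lsum_eq_count l hl, Finset.sum_congr rfl (g := fun i => 2 ^ i)]
    · decide
    · intro i hi
      rw [Finset.mem_range] at hi
      rw [h1 i (by omega), one_mul]
  · rintro ⟨h1, h2⟩
    rw [lsum_eq_count l hl] at h2
    have h3 := length_eq_count l hl
    rw [hlen, ← Finset.sum_range_add_sum_Ico _ (by norm_num : 11 ≤ 23)] at h3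
    have h4 : ∑ i ∈ Finset.Ico 11 23, l.count i = 12 := by
      rw [Finset.sum_congr rfl (g := fun _ => 1)]
      · simp
      · intro i hi; rw [Finset.mem_Ico] at hi; exact h1 i hi.1 hi.2
    have h5 := (bin_lemma 10 (fun i => l.count i) (by rw [h2]; norm_num)).2 (by
      change ∑ i ∈ Finset.range 11, _ = 11
      omega)
    rw [List.nodup_iff_count_le_one]
    intro a
    rcases Nat.lt_or_ge a 11 with h | h
    · exact (h5 a h).le
    · rcases Nat.lt_or_ge a 23 with h' | h'
      · exact (h1 a h h').le
      · rw [List.count_eq_zero_of_not_mem]; omega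
        intro hm; have := hl a hm; omega

theorem W_mem_basic (k : ℕ) : ∀ j b, b < 23 → ∀ w ∈ W k j b, w.length = 2 * j + 1 ∧ ∀ x ∈ w, x < 23
  | 0, b, hb, w, hw => by
    have : w = [b] := by simpa [W] using hw
    subst this; simpa using hb
  | j+1, b, hb, w, hw => by
    have e : W k (j+1) b = ((Finset.range 23).filter (fun y => ok k b y = true)).biUnion
      (fun y => (W k j (k - (b + y))).image (fun w => b :: y :: w)) := rfl
    rw [e, Finset.mem_biUnion] at hw
    obtain ⟨y, hy, hw⟩ := hw
    rw [Finset.mem_filter, Finset.mem_range] at hy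
    rw [Finset.mem_image] at hw
    obtain ⟨v, hv, rfl⟩ := hw
    have hok := (ok_iff k b y).mp hy.2
    obtain ⟨h1, h2⟩ := W_mem_basic k j _ (by omega) v hv
    refine ⟨by simp [h1]; omega, ?_⟩
    intro x hx
    simp only [List.mem_cons] at hx
    rcases hx with rfl | rfl | hx
    · exact hb
    · exact hy.1
    · exact h2 x hx

theorem MA_iff (e : ℕ) (A : Finset ℕ) (hA : A ⊆ UU e 12) (w1 w2 : List ℕ) :
    (MA A w1 ∧ MA (UU e 12 \ A) w2) ↔ A = (UU e 12).filter (· ∈ w1) ∧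
      ∀ i, 11 ≤ i → i < 23 → (e :: (w1 ++ w2)).count i = 1 := by
  have hU : ∀ i, i ∈ UU e 12 ↔ i ≠ e ∧ 11 ≤ i ∧ i < 23 := by
    intro i; simp [UU]
  have hc : ∀ i, (e :: (w1 ++ w2)).count i = w1.count i + w2.count i + if e = i then 1 else 0 := by
    intro i; simp [List.count_cons, List.count_append]
  simp only [hc]
  unfold MA
  constructor
  · rintro ⟨h1, h2⟩
    refine ⟨?_, ?_⟩
    · ext i
      rw [Finset.mem_filter]
      constructor
      · intro hi
        have hi' := hA hi
        refine ⟨hi', ?_⟩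
        have := h1 i ((hU i).mp hi').2.1 ((hU i).mp hi').2.2
        rw [if_pos hi] at this
        rw [← List.count_pos_iff]; omega
      · rintro ⟨hi', hw⟩
        by_contra hi
        have := h1 i ((hU i).mp hi').2.1 ((hU i).mp hi').2.2
        rw [if_neg hi] at this
        rw [← List.count_pos_iff] at hw; omega
    · intro i ha hb
      rw [h1 i ha hb, h2 i ha hb]
      by_cases hi : i ∈ A
      · have := ((hU i).mp (hA hi)).1
        simp [hi, Ne.symm this]
      · by_cases he : e = i
        · have : i ∉ UU e 12 := by rw [hU]; simp [he]
          simp [hi, he]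
          intro h; subst he; exact this h
        · have : i ∈ UU e 12 := by rw [hU]; exact ⟨Ne.symm he, ha, hb⟩
          simp [hi, he, this]
  · rintro ⟨h1, h2⟩
    have key : ∀ i, 11 ≤ i → i < 23 → (i ∈ A ↔ i ≠ e ∧ 0 < w1.count i) := by
      intro i ha hb
      rw [h1, Finset.mem_filter, hU, List.count_pos_iff]
      tauto
    refine ⟨fun i ha hb => ?_, fun i ha hb => ?_⟩
    · have h3 := h2 i ha hb
      have h4 := key i ha hb
      by_cases h5 : e = i
      · have h6 : i ∉ A := fun h => (h4.mp h).1 h5.symm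
        rw [if_pos h5] at h3
        rw [if_neg h6]; omega
      · rw [if_neg h5] at h3
        by_cases h6 : i ∈ A
        · have := (h4.mp h6).2
          rw [if_pos h6]; omega
        · have : ¬ (0 < w1.count i) := fun h => h6 (h4.mpr ⟨Ne.symm h5, h⟩)
          rw [if_neg h6]; omega
    · have h3 := h2 i ha hb
      have h4 := key i ha hb
      have h7 : i ∈ UU e 12 \ A ↔ i ≠ e ∧ ¬ (0 < w1.count i) := by
        rw [Finset.mem_sdiff, hU, h4]; tauto
      by_cases h5 : e = i
      · have h6 : i ∉ UU e 12 \ A := fun h => (h7.mp h).1 h5.symm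
        rw [if_pos h5] at h3
        rw [if_neg h6]; omega
      · rw [if_neg h5] at h3
        by_cases h6 : i ∈ UU e 12 \ A
        · have := (h7.mp h6).2
          rw [if_pos h6]; omega
        · have : ¬ ¬ (0 < w1.count i) := fun h => h6 (h7.mpr ⟨Ne.symm h5, h⟩)
          rw [if_neg h6]; omega

theorem pairs_collapse (k a b e : ℕ) (ha : a < 23) (hb : b < 23) (he : e < 23) :
    ∑ A ∈ (UU e 12).powerset, pairsA k a b e A =
      ((W k 5 a ×ˢ W k 5 b).filter fun p => (e :: (p.1 ++ p.2)).Nodup).card := by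
  classical
  have h1 : ∀ A, pairsA k a b e A = ∑ p ∈ W k 5 a ×ˢ W k 5 b,
      if (MA A p.1 ∧ MA (UU e 12 \ A) p.2) ∧ lsum p.1 + lsum p.2 = 2047 - low e then 1 else 0 := by
    intro A
    unfold pairsA
    rw [← Finset.filter_product, Finset.filter_filter, ← Finset.card_filter]
    congr 1
    apply Finset.filter_congr
    intro p _
    constructor
    · rintro ⟨⟨⟨a1, a2⟩, a3, a4⟩, a5⟩; exact ⟨⟨a1, a3⟩, a5⟩
    · rintro ⟨⟨a1, a3⟩, a5⟩; exact ⟨⟨⟨a1, by omega⟩, a3, by omega⟩, a5⟩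
  simp only [h1]
  rw [Finset.sum_comm, Finset.card_filter]
  apply Finset.sum_congr rfl
  rintro ⟨w1, w2⟩ hp
  rw [Finset.mem_product] at hp
  obtain ⟨l1, m1⟩ := W_mem_basic k 5 a ha _ hp.1
  obtain ⟨l2, m2⟩ := W_mem_basic k 5 b hb _ hp.2
  simp only at l1 m1 l2 m2 ⊢
  have hl : ∀ x ∈ e :: (w1 ++ w2), x < 23 := by
    intro x hx
    simp only [List.mem_cons, List.mem_append] at hx
    rcases hx with rfl | hx | hx
    · exact he
    · exact m1 x hx
    · exact m2 x hx
  have hn := nodup_iff_conditions (e :: (w1 ++ w2)) hl (by simp [l1, l2])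
  have hs : lsum (e :: (w1 ++ w2)) = 2047 ↔ lsum w1 + lsum w2 = 2047 - low e := by
    have := low_le e
    simp [lsum]; omega
  rw [hs] at hn
  rw [Finset.sum_eq_single ((UU e 12).filter (· ∈ w1))]
  · refine if_congr ?_ rfl rfl
    rw [hn, MA_iff e _ (Finset.filter_subset _ _)]; simp
  · intro A hA hne
    rw [if_neg]
    rintro ⟨h2, -⟩
    exact hne ((MA_iff e A (Finset.mem_powerset.mp hA) w1 w2).mp h2).1
  · intro h
    exact absurd (Finset.mem_powerset.mpr (Finset.filter_subset _ _)) h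

theorem cnt5_value (k : ℕ) (hlt : cnt5 k < 16777215 * 16777215) :
    cnt5 k = ∑ b ∈ Finset.range 23, ∑ a ∈ Finset.range b, if ok k a b = true then
      ((W k 5 a ×ˢ W k 5 b).filter fun p => ((k - (a + b)) :: (p.1 ++ p.2)).Nodup).card else 0 := by
  rw [cnt5_eq] at hlt ⊢
  rw [jall_eq k 23 le_rfl hlt]
  apply Finset.sum_congr rfl
  intro b hb
  apply Finset.sum_congr rfl
  intro a ha
  rw [Finset.mem_range] at ha hb
  split_ifs with hok
  · have := (ok_iff k a b).mp hok
    exact pairs_collapse k a b _ (by omega) hb (by omega)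
  · rfl

/-! ### From walks to permutations -/

theorem W_mem_iff (k : ℕ) : ∀ j b, b < 23 → ∀ w, w ∈ W k j b ↔
    w.length = 2 * j + 1 ∧ w.getD 0 0 = b ∧ (∀ x ∈ w, x < 23) ∧
    ∀ i < j, ok k (w.getD (2*i) 0) (w.getD (2*i+1) 0) = true ∧
      w.getD (2*i+2) 0 = k - (w.getD (2*i) 0 + w.getD (2*i+1) 0)
  | 0, b, hb, w => by
    have e : W k 0 b = {[b]} := rfl
    rw [e, Finset.mem_singleton]
    constructor
    · rintro rfl
      refine ⟨rfl, rfl, by simpa using hb, fun i hi => by omega⟩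
    · rintro ⟨h1, h2, -⟩
      match w, h1 with
      | [x], _ => simpa using h2
  | j+1, b, hb, w => by
    have e : W k (j+1) b = ((Finset.range 23).filter (fun y => ok k b y = true)).biUnion
      (fun y => (W k j (k - (b + y))).image (fun w => b :: y :: w)) := rfl
    rw [e, Finset.mem_biUnion]
    constructor
    · rintro ⟨y, hy, hw⟩
      rw [Finset.mem_filter, Finset.mem_range] at hy
      rw [Finset.mem_image] at hw
      obtain ⟨v, hv, rfl⟩ := hw
      have hok := (ok_iff k b y).mp hy.2
      obtain ⟨h1, h2, h3, h4⟩ := (W_mem_iff k j _ (by omega) v).mp hv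
      refine ⟨by simp [h1]; omega, rfl, ?_, ?_⟩
      · intro x hx
        simp only [List.mem_cons] at hx
        rcases hx with rfl | rfl | hx
        · exact hb
        · exact hy.1
        · exact h3 x hx
      · intro i hi
        rcases i with _ | i
        · exact ⟨hy.2, h2⟩
        · exact h4 i (by omega)
    · rintro ⟨h1, h2, h3, h4⟩
      match w, h1 with
      | x :: y :: v, h1 =>
        have hx : x = b := h2
        subst hx
        have h5 := h4 0 (by omega)
        have hok : ok k x y = true := h5.1
        have hok' := (ok_iff k x y).mp hok
        refine ⟨y, ?_, ?_⟩
        · rw [Finset.mem_filter, Finset.mem_range]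
          exact ⟨h3 y (by simp), hok⟩
        · rw [Finset.mem_image]
          refine ⟨v, ?_, rfl⟩
          rw [W_mem_iff k j _ (by omega)]
          refine ⟨by simp at h1; omega, h5.2, fun z hz => h3 z (by simp [hz]), fun i hi => ?_⟩
          exact h4 (i+1) (by omega)

/-- The label (starting from `0`) of the element with index `i`. -/
def fv (σ : Equiv.Perm (Fin 23)) (i : ℕ) : ℕ := if h : i < 23 then (σ ⟨i, h⟩).val else 0

theorem fv_lt (σ : Equiv.Perm (Fin 23)) (i : ℕ) : fv σ i < 23 := by
  unfold fv; split_ifs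
  · exact (σ _).isLt
  · omega

theorem fv_inj (σ : Equiv.Perm (Fin 23)) {i j : ℕ} (hi : i < 23) (hj : j < 23)
    (h : fv σ i = fv σ j) : i = j := by
  unfold fv at h
  rw [dif_pos hi, dif_pos hj] at h
  have := σ.injective (Fin.ext h)
  simpa using this

theorem fv_ext (σ τ : Equiv.Perm (Fin 23)) (h : ∀ i < 23, fv σ i = fv τ i) : σ = τ := by
  apply Equiv.ext
  rintro ⟨i, hi⟩
  have := h i hi
  unfold fv at this
  rw [dif_pos hi, dif_pos hi] at this
  exact Fin.ext this

theorem fv_exists (f : ℕ → ℕ) (h1 : ∀ i < 23, f i < 23)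
    (h2 : ∀ i < 23, ∀ j < 23, f i = f j → i = j) :
    ∃ σ : Equiv.Perm (Fin 23), ∀ i < 23, fv σ i = f i := by
  have hinj : Function.Injective (fun i : Fin 23 => (⟨f i.1, h1 i.1 i.2⟩ : Fin 23)) := by
    intro i j h
    exact Fin.ext (h2 i i.2 j j.2 (by simpa using h))
  refine ⟨Equiv.ofBijective _ (Finite.injective_iff_bijective.mp hinj), fun i hi => ?_⟩
  unfold fv
  rw [dif_pos hi]
  rfl

def MG (k : ℕ) (σ : Equiv.Perm (Fin 23)) : Prop :=
  ∀ i < 11, fv σ (2*i) + fv σ (2*i+1) + fv σ (2*i+2) = k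

def wL (σ : Equiv.Perm (Fin 23)) : List ℕ := (List.range 11).map fun i => fv σ (10 - i)
def wR (σ : Equiv.Perm (Fin 23)) : List ℕ := (List.range 11).map fun i => fv σ (12 + i)

theorem wL_getD (σ : Equiv.Perm (Fin 23)) (i : ℕ) (hi : i < 11) : (wL σ).getD i 0 = fv σ (10 - i) := by
  unfold wL
  rw [List.getD_eq_getElem _ _ (by simpa using hi)]
  simp

theorem wR_getD (σ : Equiv.Perm (Fin 23)) (i : ℕ) (hi : i < 11) : (wR σ).getD i 0 = fv σ (12 + i) := by
  unfold wR
  rw [List.getD_eq_getElem _ _ (by simpa using hi)]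
  simp

theorem ok_of (k : ℕ) (σ : Equiv.Perm (Fin 23)) (p q r : ℕ) (hp : p < 23) (hq : q < 23) (hr : r < 23)
    (h : fv σ p + fv σ q + fv σ r = k) (h1 : p ≠ q) (h2 : p ≠ r) (h3 : q ≠ r) :
    ok k (fv σ p) (fv σ q) = true ∧ fv σ r = k - (fv σ p + fv σ q) := by
  have e : fv σ r = k - (fv σ p + fv σ q) := by omega
  refine ⟨?_, e⟩
  rw [ok_iff, ← e]
  have := fv_lt σ r
  exact ⟨by omega, by omega, fun h => h1 (fv_inj σ hp hq h), fun h => h2 (fv_inj σ hp hr h),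
    fun h => h3 (fv_inj σ hq hr h)⟩

theorem wL_mem (k : ℕ) (σ : Equiv.Perm (Fin 23)) (h : MG k σ) : wL σ ∈ W k 5 (fv σ 10) := by
  rw [W_mem_iff k 5 _ (fv_lt σ _)]
  refine ⟨by simp [wL], wL_getD σ 0 (by omega), ?_, ?_⟩
  · intro x hx
    unfold wL at hx
    rw [List.mem_map] at hx
    obtain ⟨i, _, rfl⟩ := hx
    exact fv_lt σ _
  · intro i hi
    rw [wL_getD σ _ (by omega), wL_getD σ _ (by omega), wL_getD σ _ (by omega)]
    refine ok_of k σ _ _ _ (by omega) (by omega) (by omega) ?_ (by omega) (by omega) (by omega)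
    have := h (4 - i) (by omega)
    have e1 : 2 * (4 - i) = 10 - (2*i+2) := by omega
    have e2 : 2 * (4 - i) + 1 = 10 - (2*i+1) := by omega
    have e3 : 2 * (4 - i) + 2 = 10 - (2*i) := by omega
    rw [e3, e2, e1] at this
    omega

theorem wR_mem (k : ℕ) (σ : Equiv.Perm (Fin 23)) (h : MG k σ) : wR σ ∈ W k 5 (fv σ 12) := by
  rw [W_mem_iff k 5 _ (fv_lt σ _)]
  refine ⟨by simp [wR], wR_getD σ 0 (by omega), ?_, ?_⟩
  · intro x hx
    unfold wR at hx
    rw [List.mem_map] at hx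
    obtain ⟨i, _, rfl⟩ := hx
    exact fv_lt σ _
  · intro i hi
    rw [wR_getD σ _ (by omega), wR_getD σ _ (by omega), wR_getD σ _ (by omega)]
    refine ok_of k σ _ _ _ (by omega) (by omega) (by omega) ?_ (by omega) (by omega) (by omega)
    have := h (6 + i) (by omega)
    have e1 : 2 * (6 + i) = 12 + 2 * i := by omega
    rw [e1] at this
    exact this

theorem nodup_of (σ : Equiv.Perm (Fin 23)) : (fv σ 11 :: (wL σ ++ wR σ)).Nodup := by
  have e : fv σ 11 :: (wL σ ++ wR σ) =
      (11 :: ((List.range 11).map (fun i => 10 - i) ++ (List.range 11).map (fun i => 12 + i))).map (fv σ) := by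
    simp [wL, wR, Function.comp_def]
  rw [e]
  have hlt : ∀ x ∈ 11 :: ((List.range 11).map (fun i => 10 - i) ++ (List.range 11).map (fun i => 12 + i)),
      x < 23 := by decide
  apply List.Nodup.map_on
  · intro x hx y hy h
    exact fv_inj σ (hlt x hx) (hlt y hy) h
  · decide

def idx (i : ℕ) : ℕ := if i ≤ 11 then 11 - i else i

theorem exists_of_pair (k a b : ℕ) (ha : a < 23) (hb : b < 23) (hok : ok k a b = true)
    (w1 w2 : List ℕ) (h1 : w1 ∈ W k 5 a) (h2 : w2 ∈ W k 5 b)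
    (hn : ((k - (a + b)) :: (w1 ++ w2)).Nodup) :
    ∃ σ : Equiv.Perm (Fin 23), MG k σ ∧ fv σ 10 = a ∧ fv σ 12 = b ∧ wL σ = w1 ∧ wR σ = w2 := by
  obtain ⟨l1, s1, m1, c1⟩ := (W_mem_iff k 5 a ha w1).mp h1
  obtain ⟨l2, s2, m2, c2⟩ := (W_mem_iff k 5 b hb w2).mp h2
  have hok' := (ok_iff k a b).mp hok
  generalize he : k - (a + b) = e at hn hok'
  set L := e :: (w1 ++ w2) with hL
  have hlen : L.length = 23 := by simp [hL, l1, l2]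
  have hlt : ∀ x ∈ L, x < 23 := by
    intro x hx
    simp only [hL, List.mem_cons, List.mem_append] at hx
    rcases hx with rfl | hx | hx
    · omega
    · exact m1 x hx
    · exact m2 x hx
  have hidx : ∀ i < 23, idx i < 23 := by intro i hi; unfold idx; split_ifs <;> omega
  obtain ⟨σ, hσ⟩ := fv_exists (fun i => L.getD (idx i) 0)
    (by
      intro i hi
      have h := hidx i hi
      rw [List.getD_eq_getElem _ _ (by rw [hlen]; exact h)]
      exact hlt _ (List.getElem_mem _))
    (by
      intro i hi j hj h
      have h3 := hidx i hi
      have h4 := hidx j hj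
      rw [List.getD_eq_getElem _ _ (by rw [hlen]; exact h3),
        List.getD_eq_getElem _ _ (by rw [hlen]; exact h4), List.Nodup.getElem_inj_iff hn] at h
      unfold idx at h
      split_ifs at h <;> omega)
  have hL1 : ∀ i < 11, fv σ (10 - i) = w1.getD i 0 := by
    intro i hi
    rw [hσ _ (by omega)]
    have : idx (10 - i) = i + 1 := by unfold idx; split_ifs <;> omega
    rw [this, hL, List.getD_cons_succ, List.getD_append _ _ _ _ (by omega)]
  have hL2 : ∀ i < 11, fv σ (12 + i) = w2.getD i 0 := by
    intro i hi
    rw [hσ _ (by omega)]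
    have : idx (12 + i) = (11 + i) + 1 := by unfold idx; split_ifs <;> omega
    rw [this, hL, List.getD_cons_succ, List.getD_append_right _ _ _ _ (by omega)]
    congr 1
    omega
  have hL3 : fv σ 11 = e := by
    rw [hσ _ (by omega)]; rfl
  have h10 : fv σ 10 = a := by rw [← s1]; exact hL1 0 (by omega)
  have h12 : fv σ 12 = b := by rw [← s2]; exact hL2 0 (by omega)
  refine ⟨σ, ?_, h10, h12, ?_, ?_⟩
  · intro i hi
    rcases Nat.lt_trichotomy i 5 with h | h | h
    · obtain ⟨d1, d2⟩ := c1 (4 - i) (by omega)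
      rw [← hL1 _ (by omega), ← hL1 _ (by omega)] at d1
      rw [← hL1 _ (by omega), ← hL1 _ (by omega), ← hL1 _ (by omega)] at d2
      have := (ok_iff _ _ _).mp d1
      have e1 : 2 * i = 10 - (2*(4-i)+2) := by omega
      have e2 : 2 * i + 1 = 10 - (2*(4-i)+1) := by omega
      have e3 : 2 * i + 2 = 10 - (2*(4-i)) := by omega
      rw [e3, e2, e1]
      omega
    · subst h
      change fv σ 10 + fv σ 11 + fv σ 12 = k
      rw [h10, hL3, h12]; omega
    · obtain ⟨d1, d2⟩ := c2 (i - 6) (by omega)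
      rw [← hL2 _ (by omega), ← hL2 _ (by omega)] at d1
      rw [← hL2 _ (by omega), ← hL2 _ (by omega), ← hL2 _ (by omega)] at d2
      have := (ok_iff _ _ _).mp d1
      have e1 : 2 * i = 12 + 2*(i-6) := by omega
      have e2 : 2 * i + 1 = 12 + (2*(i-6)+1) := by omega
      have e3 : 2 * i + 2 = 12 + (2*(i-6)+2) := by omega
      rw [e3, e2, e1]
      omega
  · apply List.ext_getElem
    · simp [wL, l1]
    · intro i h3 h4
      have hi : i < 11 := by omega
      rw [← List.getD_eq_getElem _ 0 h3, ← List.getD_eq_getElem _ 0 h4, wL_getD σ i hi, hL1 i hi]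
  · apply List.ext_getElem
    · simp [wR, l2]
    · intro i h3 h4
      have hi : i < 11 := by omega
      rw [← List.getD_eq_getElem _ 0 h3, ← List.getD_eq_getElem _ 0 h4, wR_getD σ i hi, hL2 i hi]

open Classical in
theorem fiber_card (k a b : ℕ) (ha : a < 23) (hb : b < 23) :
    (Finset.univ.filter fun σ : Equiv.Perm (Fin 23) => MG k σ ∧ fv σ 10 = a ∧ fv σ 12 = b).card =
    if ok k a b = true then
      ((W k 5 a ×ˢ W k 5 b).filter fun p => ((k - (a + b)) :: (p.1 ++ p.2)).Nodup).card else 0 := by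
  have mid : ∀ σ, MG k σ → ok k (fv σ 10) (fv σ 12) = true ∧ fv σ 11 = k - (fv σ 10 + fv σ 12) := by
    intro σ h
    refine ok_of k σ 10 12 11 (by omega) (by omega) (by omega) ?_ (by omega) (by omega) (by omega)
    have : fv σ 10 + fv σ 11 + fv σ 12 = k := h 5 (by omega)
    omega
  split_ifs with hok
  · apply Finset.card_bij (fun σ _ => (wL σ, wR σ))
    · intro σ hσ
      obtain ⟨-, h1, rfl, rfl⟩ := Finset.mem_filter.mp hσ
      rw [Finset.mem_filter, Finset.mem_product]
      refine ⟨⟨wL_mem k σ h1, wR_mem k σ h1⟩, ?_⟩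
      rw [← (mid σ h1).2]
      exact nodup_of σ
    · intro σ hσ τ hτ h
      obtain ⟨-, h1, h2, h3⟩ := Finset.mem_filter.mp hσ
      obtain ⟨-, h1', h2', h3'⟩ := Finset.mem_filter.mp hτ
      rw [Prod.mk.injEq] at h
      apply fv_ext
      intro i hi
      rcases Nat.lt_trichotomy i 11 with h4 | h4 | h4
      · have e1 := wL_getD σ (10 - i) (by omega)
        have e2 := wL_getD τ (10 - i) (by omega)
        have e3 : 10 - (10 - i) = i := by omega
        rw [e3] at e1 e2
        rw [← e1, ← e2, h.1]
      · subst h4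
        rw [(mid σ h1).2, (mid τ h1').2, h2, h3, h2', h3']
      · have e1 := wR_getD σ (i - 12) (by omega)
        have e2 := wR_getD τ (i - 12) (by omega)
        have e3 : 12 + (i - 12) = i := by omega
        rw [e3] at e1 e2
        rw [← e1, ← e2, h.2]
    · rintro ⟨w1, w2⟩ hp
      rw [Finset.mem_filter, Finset.mem_product] at hp
      obtain ⟨σ, h1, h2, h3, h4, h5⟩ := exists_of_pair k a b ha hb hok w1 w2 hp.1.1 hp.1.2 hp.2
      exact ⟨σ, Finset.mem_filter.mpr ⟨Finset.mem_univ _, h1, h2, h3⟩, by rw [h4, h5]⟩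
  · rw [Finset.card_eq_zero, Finset.filter_eq_empty_iff]
    rintro σ - ⟨h1, rfl, rfl⟩
    exact hok (mid σ h1).1

open Classical in
theorem half_card (k : ℕ) :
    (Finset.univ.filter fun σ : Equiv.Perm (Fin 23) => MG k σ ∧ fv σ 10 < fv σ 12).card =
    ∑ b ∈ Finset.range 23, ∑ a ∈ Finset.range b, if ok k a b = true then
      ((W k 5 a ×ˢ W k 5 b).filter fun p => ((k - (a + b)) :: (p.1 ++ p.2)).Nodup).card else 0 := by
  rw [Finset.card_eq_sum_card_fiberwise (f := fun σ => fv σ 12) (t := Finset.range 23)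
    (fun σ _ => by simpa using fv_lt σ 12)]
  apply Finset.sum_congr rfl
  intro b hb
  rw [Finset.mem_range] at hb
  rw [Finset.card_eq_sum_card_fiberwise (f := fun σ => fv σ 10) (t := Finset.range b)]
  · apply Finset.sum_congr rfl
    intro a ha
    rw [Finset.mem_range] at ha
    rw [← fiber_card k a b (by omega) hb]
    congr 1
    ext σ
    simp only [Finset.mem_filter, Finset.mem_univ, true_and]
    constructor
    · rintro ⟨⟨⟨h1, h2⟩, h3⟩, h4⟩; exact ⟨h1, h4, h3⟩
    · rintro ⟨h1, h4, h3⟩; exact ⟨⟨⟨h1, by omega⟩, h3⟩, h4⟩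
  · intro σ hσ
    have := Finset.mem_filter.mp hσ
    have h2 := (Finset.mem_filter.mp this.1).2.2
    have h3 := this.2
    simp only [Finset.coe_range, Set.mem_Iio]
    omega

/-! ### Symmetries -/

theorem exists_map (f : ℕ → ℕ) (g : ℕ → ℕ) (hf : ∀ i < 23, f i < 23 ∧ f (f i) = i)
    (hg : ∀ i < 23, g i < 23 ∧ g (g i) = i) :
    ∃ φ : Equiv.Perm (Fin 23) ≃ Equiv.Perm (Fin 23), ∀ σ, ∀ i < 23, fv (φ σ) i = g (fv σ (f i)) := by
  have h : ∀ f : ℕ → ℕ, (∀ i < 23, f i < 23 ∧ f (f i) = i) →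
      ∃ τ : Equiv.Perm (Fin 23), ∀ i < 23, fv τ i = f i := by
    intro f hf
    refine fv_exists f (fun i hi => (hf i hi).1) (fun i hi j hj h => ?_)
    rw [← (hf i hi).2, ← (hf j hj).2, h]
  obtain ⟨α, hα⟩ := h f hf
  obtain ⟨β, hβ⟩ := h g hg
  refine ⟨(Equiv.mulLeft β).trans (Equiv.mulRight α), fun σ i hi => ?_⟩
  have h1 : fv (β * σ * α) i = fv β (fv σ (fv α i)) := by
    unfold fv
    rw [dif_pos hi, dif_pos hi, dif_pos (α ⟨i, hi⟩).isLt, dif_pos (σ _).isLt]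
    rfl
  refine h1.trans ?_
  rw [hα i hi, hβ _ (fv_lt σ _)]

open Classical in
theorem card_map (φ : Equiv.Perm (Fin 23) ≃ Equiv.Perm (Fin 23)) (P Q : Equiv.Perm (Fin 23) → Prop)
    (h : ∀ σ, P σ ↔ Q (φ σ)) : (Finset.univ.filter P).card = (Finset.univ.filter Q).card := by
  apply Finset.card_equiv φ
  intro σ
  simp [h]

theorem rev_exists : ∃ φ : Equiv.Perm (Fin 23) ≃ Equiv.Perm (Fin 23),
    ∀ σ, ∀ i < 23, fv (φ σ) i = fv σ (22 - i) :=
  exists_map (fun i => 22 - i) (fun i => i) (fun i hi => by constructor <;> omega)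
    (fun i hi => ⟨hi, rfl⟩)

theorem compl_exists : ∃ φ : Equiv.Perm (Fin 23) ≃ Equiv.Perm (Fin 23),
    ∀ σ, ∀ i < 23, fv (φ σ) i = 22 - fv σ i :=
  exists_map (fun i => i) (fun i => 22 - i) (fun i hi => ⟨hi, rfl⟩)
    (fun i hi => by constructor <;> omega)

theorem MG_rev (k : ℕ) (σ τ : Equiv.Perm (Fin 23)) (h : ∀ i < 23, fv τ i = fv σ (22 - i)) :
    MG k σ ↔ MG k τ := by
  unfold MG
  constructor
  · intro H i hi
    rw [h _ (by omega), h _ (by omega), h _ (by omega)]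
    have := H (10 - i) (by omega)
    have e1 : 2 * (10 - i) = 22 - (2*i+2) := by omega
    have e2 : 2 * (10 - i) + 1 = 22 - (2*i+1) := by omega
    have e3 : 2 * (10 - i) + 2 = 22 - (2*i) := by omega
    rw [e3, e2, e1] at this
    omega
  · intro H i hi
    have := H (10 - i) (by omega)
    rw [h _ (by omega), h _ (by omega), h _ (by omega)] at this
    have e1 : 22 - (2 * (10 - i)) = 2*i+2 := by omega
    have e2 : 22 - (2 * (10 - i) + 1) = 2*i+1 := by omega
    have e3 : 22 - (2 * (10 - i) + 2) = 2*i := by omega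
    rw [e3, e2, e1] at this
    omega

open Classical in
/-- Number of labelings with magic sum `k` (for labels starting from `0`). -/
noncomputable def TT (k : ℕ) : ℕ := (Finset.univ.filter fun σ : Equiv.Perm (Fin 23) => MG k σ).card

open Classical in
theorem split_card (P : Equiv.Perm (Fin 23) → Prop) (i : ℕ) (hi : i < 11)
    (hP : ∀ σ τ : Equiv.Perm (Fin 23), (∀ i < 23, fv τ i = fv σ (22 - i)) → (P σ ↔ P τ)) :
    (Finset.univ.filter P).card = 2 * (Finset.univ.filter fun σ => P σ ∧ fv σ i < fv σ (22 - i)).card := by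
  obtain ⟨φ, hφ⟩ := rev_exists
  have h1 := card_map φ (fun σ => P σ ∧ ¬ (fv σ i < fv σ (22 - i)))
    (fun σ => P σ ∧ fv σ i < fv σ (22 - i)) (by
      intro σ
      rw [hP σ (φ σ) (hφ σ), hφ σ i (by omega), hφ σ (22 - i) (by omega)]
      have e : 22 - (22 - i) = i := by omega
      rw [e]
      have : fv σ i ≠ fv σ (22 - i) := fun h => by
        have := fv_inj σ (by omega) (by omega) h; omega
      constructor
      · rintro ⟨a, b⟩; exact ⟨a, by omega⟩
      · rintro ⟨a, b⟩; exact ⟨a, by omega⟩)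
  have h2 := Finset.card_filter_add_card_filter_not (s := Finset.univ.filter P)
    (fun σ => fv σ i < fv σ (22 - i))
  rw [Finset.filter_filter, Finset.filter_filter] at h2
  rw [← h2, two_mul]
  congr 1
  convert h1 using 2
  · ext; simp
  · ext; simp

theorem TT_eq (k : ℕ) (hlt : cnt5 k < 16777215 * 16777215) : TT k = 2 * cnt5 k := by
  classical
  rw [cnt5_value k hlt, ← half_card k]
  unfold TT
  convert split_card (MG k) 10 (by omega) (MG_rev k) using 3

theorem TT_compl (k : ℕ) (hk : k ≤ 66) : TT k = TT (66 - k) := by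
  classical
  obtain ⟨φ, hφ⟩ := compl_exists
  unfold TT
  apply card_map φ
  intro σ
  unfold MG
  have : ∀ i < 11, (fv σ (2*i) + fv σ (2*i+1) + fv σ (2*i+2) = k ↔
    fv (φ σ) (2*i) + fv (φ σ) (2*i+1) + fv (φ σ) (2*i+2) = 66 - k) := by
    intro i hi
    rw [hφ σ _ (by omega), hφ σ _ (by omega), hφ σ _ (by omega)]
    have := fv_lt σ (2*i)
    have := fv_lt σ (2*i+1)
    have := fv_lt σ (2*i+2)
    omega
  exact forall₂_congr this

theorem fv_sum (σ : Equiv.Perm (Fin 23)) (g : ℕ → ℕ) :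
    ∑ i ∈ Finset.range 23, g (fv σ i) = ∑ i ∈ Finset.range 23, g i := by
  rw [Finset.sum_range, Finset.sum_range, ← Equiv.sum_comp σ (fun i => g i.val)]
  apply Finset.sum_congr rfl
  rintro ⟨i, hi⟩ _
  unfold fv
  rw [dif_pos hi]

theorem MG_lower (k : ℕ) (σ : Equiv.Perm (Fin 23)) (h : MG k σ) : 28 ≤ k := by
  have h0 := h 0 (by omega)
  have h1 := h 1 (by omega)
  have h2 := h 2 (by omega)
  have h3 := h 3 (by omega)
  have h4 := h 4 (by omega)
  have h5 := h 5 (by omega)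
  have h6 := h 6 (by omega)
  have h7 := h 7 (by omega)
  have h8 := h 8 (by omega)
  have h9 := h 9 (by omega)
  have h10 := h 10 (by omega)
  have hs := fv_sum σ (fun x => x)
  have ht := fv_sum σ (fun x => 10 - x)
  have e1 : ∑ i ∈ Finset.range 23, i = 253 := by decide
  have e2 : ∑ i ∈ Finset.range 23, (10 - i) = 55 := by decide
  rw [e1] at hs
  rw [e2] at ht
  simp only [Finset.sum_range_succ, Finset.sum_range_zero] at hs ht
  simp only [Nat.mul_zero, Nat.zero_add, Nat.reduceMul, Nat.reduceAdd] at h0 h1 h2 h3 h4 h5 h6 h7 h8 h9 h10 hs ht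
  have hx : ∀ x : ℕ, 10 ≤ x + (10 - x) := fun x => by omega
  have g1 := hx (fv σ 2)
  have g2 := hx (fv σ 4)
  have g3 := hx (fv σ 6)
  have g4 := hx (fv σ 8)
  have g5 := hx (fv σ 10)
  have g6 := hx (fv σ 12)
  have g7 := hx (fv σ 14)
  have g8 := hx (fv σ 16)
  have g9 := hx (fv σ 18)
  have g10 := hx (fv σ 20)
  generalize 10 - fv σ 2 = t2 at *
  generalize 10 - fv σ 4 = t4 at *
  generalize 10 - fv σ 6 = t6 at *
  generalize 10 - fv σ 8 = t8 at *
  generalize 10 - fv σ 10 = t10 at *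
  generalize 10 - fv σ 12 = t12 at *
  generalize 10 - fv σ 14 = t14 at *
  generalize 10 - fv σ 16 = t16 at *
  generalize 10 - fv σ 18 = t18 at *
  generalize 10 - fv σ 20 = t20 at *
  have ht' : t2 + t4 + t6 + t8 + t10 + t12 + t14 + t16 + t18 + t20 ≤ 55 := by
    rw [← ht]
    linarith [Nat.zero_le (10 - fv σ 0), Nat.zero_le (10 - fv σ 1), Nat.zero_le (10 - fv σ 3),
      Nat.zero_le (10 - fv σ 5), Nat.zero_le (10 - fv σ 7), Nat.zero_le (10 - fv σ 9),
      Nat.zero_le (10 - fv σ 11), Nat.zero_le (10 - fv σ 13), Nat.zero_le (10 - fv σ 15),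
      Nat.zero_le (10 - fv σ 17), Nat.zero_le (10 - fv σ 19), Nat.zero_le (10 - fv σ 21),
      Nat.zero_le (10 - fv σ 22)]
  clear ht hx
  have hfin : 298 ≤ 11 * k := by linarith
  omega

theorem MG_upper (k : ℕ) (σ : Equiv.Perm (Fin 23)) (h : MG k σ) : k ≤ 38 := by
  obtain ⟨φ, hφ⟩ := compl_exists
  have hk : k ≤ 66 := by
    have := h 0 (by omega)
    have := fv_lt σ (2*0)
    have := fv_lt σ (2*0+1)
    have := fv_lt σ (2*0+2)
    omega
  have : MG (66 - k) (φ σ) := by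
    intro i hi
    have := h i hi
    rw [hφ σ _ (by omega), hφ σ _ (by omega), hφ σ _ (by omega)]
    have := fv_lt σ (2*i)
    have := fv_lt σ (2*i+1)
    have := fv_lt σ (2*i+2)
    omega
  have := MG_lower _ _ this
  omega

open Classical in
theorem total_card : (Finset.univ.filter fun σ : Equiv.Perm (Fin 23) => ∃ k, MG k σ).card =
    ∑ k ∈ Finset.Icc 28 38, TT k := by
  have e : (Finset.univ.filter fun σ : Equiv.Perm (Fin 23) => ∃ k, MG k σ) =
      (Finset.Icc 28 38).biUnion (fun k => Finset.univ.filter fun σ => MG k σ) := by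
    ext σ
    simp only [Finset.mem_filter, Finset.mem_univ, true_and, Finset.mem_biUnion, Finset.mem_Icc]
    constructor
    · rintro ⟨k, h⟩; exact ⟨k, ⟨MG_lower k σ h, MG_upper k σ h⟩, h⟩
    · rintro ⟨k, _, h⟩; exact ⟨k, h⟩
  rw [e, Finset.card_biUnion]
  · rfl
  · intro k _ l _ hkl
    rw [Function.onFun, Finset.disjoint_left]
    intro σ h1 h2
    have a := (Finset.mem_filter.mp h1).2 0 (by omega)
    have b := (Finset.mem_filter.mp h2).2 0 (by omega)
    omega

theorem final_card
    (hc : Nat.beq (cnt5 33) 1103904 = true ∧ Nat.beq (cnt5 34) 836000 = true ∧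
      Nat.beq (cnt5 35) 683640 = true ∧ Nat.beq (cnt5 36) 340108 = true ∧
      Nat.beq (cnt5 37) 156596 = true ∧ Nat.beq (cnt5 38) 43088 = true) :
    pathEMTLCountUpToRev 11 = 5222768 := by
  classical
  obtain ⟨c33, c34, c35, c36, c37, c38⟩ := hc
  have key : ∀ k n : ℕ, Nat.beq (cnt5 k) n = true → n < 16777215 * 16777215 → TT k = 2 * n := by
    intro k n h hn
    have := Nat.eq_of_beq_eq_true h
    rw [TT_eq k (by rw [this]; exact hn), this]
  have t33 := key 33 _ c33 (by norm_num)
  have t34 := key 34 _ c34 (by norm_num)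
  have t35 := key 35 _ c35 (by norm_num)
  have t36 := key 36 _ c36 (by norm_num)
  have t37 := key 37 _ c37 (by norm_num)
  have t38 := key 38 _ c38 (by norm_num)
  have t28 : TT 28 = TT 38 := TT_compl 28 (by norm_num)
  have t29 : TT 29 = TT 37 := TT_compl 29 (by norm_num)
  have t30 : TT 30 = TT 36 := TT_compl 30 (by norm_num)
  have t31 : TT 31 = TT 35 := TT_compl 31 (by norm_num)
  have t32 : TT 32 = TT 34 := TT_compl 32 (by norm_num)
  have htot := total_card
  have hS : ∑ k ∈ Finset.Icc 28 38, TT k = TT 28 + TT 29 + TT 30 + TT 31 + TT 32 + TT 33 + TT 34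
      + TT 35 + TT 36 + TT 37 + TT 38 := by
    have : Finset.Icc 28 38 = Finset.Ico 28 39 := by decide
    rw [this]
    simp [Finset.sum_Ico_succ_top]
  rw [hS, t28, t29, t30, t31, t32, t33, t34, t35, t36, t37, t38] at htot
  have hsplit := split_card (fun σ => ∃ k, MG k σ) 0 (by omega)
    (fun σ τ h => exists_congr fun k => MG_rev k σ τ h)
  have hfin : (Finset.univ.filter fun σ : Equiv.Perm (Fin 23) =>
      (∃ k, MG k σ) ∧ fv σ 0 < fv σ (22 - 0)).card = 5222768 := by omega
  rw [← hfin]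
  unfold pathEMTLCountUpToRev
  apply congrArg Finset.card
  ext σ
  simp only [Finset.mem_filter, Finset.mem_univ, true_and]
  have hv : ∀ (i : ℕ) (h : i < 23), fv σ i = (σ ⟨i, h⟩).val := by
    intro i h; unfold fv; rw [dif_pos h]
  apply and_congr
  · constructor
    · rintro ⟨k, h⟩
      refine ⟨k - 3, fun i hi => ?_⟩
      have := h ⟨i, hi⟩
      rw [hv _ (by omega), hv _ (by omega), hv _ (by omega)]
      simp only at this
      omega
    · rintro ⟨k, h⟩
      refine ⟨k + 3, fun i => ?_⟩
      have := h i.1 i.2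
      have hi := i.2
      rw [hv _ (by omega), hv _ (by omega), hv _ (by omega)] at this
      omega
  · rw [hv 0 (by omega), hv (22 - 0) (by omega)]

set_option maxHeartbeats 0 in
theorem tall : Nat.beq (cnt5 33) 1103904 = true ∧ Nat.beq (cnt5 34) 836000 = true ∧
    Nat.beq (cnt5 35) 683640 = true ∧ Nat.beq (cnt5 36) 340108 = true ∧
    Nat.beq (cnt5 37) 156596 = true ∧ Nat.beq (cnt5 38) 43088 = true := by
  refine ⟨?_, ?_, ?_, ?_, ?_, ?_⟩
  · decide +kernel
  · decide +kernel
  · decide +kernel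
  · decide +kernel
  · decide +kernel
  · decide +kernel

end PEM

/-- The number of edge-magic total labelings of the path `P 11`, counted up to the
reversal symmetry of the path, is `5222768`. -/
theorem pathEMTLCountUpToRev_P11 : pathEMTLCountUpToRev 11 = 5222768 :=
  PEM.final_card PEM.tall
end
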